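/- arXiv:2509.22629 — 3 statements merged into one kernel-verified Lean document; each statement's English description precedes it below -/
import Mathlib

section
/- Let s, n ∈ ℕ with s ≤ n and let p, q, R, α, η > 0 satisfy p ≤ 1/(2^{11}s²), 2p ≤ q ≤ α < 1, R ≥ 2^{−6}pn and η ≤ (1−α)^{2s}/4. Let ℋ be an s-uniform hypergraph on an n-element vertex set V, and let 𝒥 be the hypergraph on V whose edges are the sets L ⊆ V such that ℋ[L] is (p/(q−p), ηR)-Janson. Then there exist a family 𝒴 of pairs of subsets of V and functions g : ℐ(𝒥) → 𝒴 and f : 𝒴 → 2^V such that: (1) for every I ∈ ℐ(𝒥), if g(I) = (S,T) then S ∪ T ⊆ I ⊆ f(S,T); (2) every (S,T) ∈ 𝒴 satisfies |S| ≤ 2^{11}ps²n and |T| ≤ qn/α; and (3) for every Y ∈ 𝒴, the hypergraph ℋ[f(Y)] is not (p, R)-Janson. -/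
open scoped Classical

noncomputable section

/-- Total mass `e(ν)` of a measure `ν` on the hypergraph `G`. -/
def eMass {V : Type*} (G : Finset (Finset V)) (ν : Finset V → ℝ) : ℝ := ∑ E ∈ G, ν E

/-- Degree `d_ν(L)` of a set `L` in the measure `ν`. -/
def dMass {V : Type*} (G : Finset (Finset V)) (ν : Finset V → ℝ) (L : Finset V) : ℝ :=
  ∑ E ∈ G.filter (fun E => L ⊆ E), ν E

/-- `Λ_p(ν) = Σ_{L ⊆ V, |L| ≥ 2} d_ν(L)² p^{−|L|}`. -/
def lamP {V : Type*} [Fintype V] (p : ℝ) (G : Finset (Finset V)) (ν : Finset V → ℝ) : ℝ :=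
  ∑ L ∈ (Finset.univ : Finset (Finset V)).filter (fun L => 2 ≤ L.card),
    dMass G ν L ^ 2 / p ^ L.card

/-- `ν` is a (nonnegative) measure supported on the edges of `G`. -/
def IsMeasureOn {V : Type*} (G : Finset (Finset V)) (ν : Finset V → ℝ) : Prop :=
  (∀ E, 0 ≤ ν E) ∧ ∀ E, E ∉ G → ν E = 0

/-- The induced subhypergraph `G[X]`. -/
def indHG {V : Type*} (G : Finset (Finset V)) (X : Finset V) : Finset (Finset V) :=
  G.filter (fun E => E ⊆ X)

/-- `G` is `(p,R)`-Janson: for `R > 0` there is a measure `ν` on `G` with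
`Λ_p(ν) < e(ν)²/R`; for `R = 0` every hypergraph is `(p,R)`-Janson. -/
def IsJanson {V : Type*} [Fintype V] (p R : ℝ) (G : Finset (Finset V)) : Prop :=
  0 < R → ∃ ν : Finset V → ℝ, IsMeasureOn G ν ∧ lamP p G ν < eMass G ν ^ 2 / R

/-- `I` is an independent set of the hypergraph `G`: no edge of `G` is a subset of `I`. -/
def IndepIn {V : Type*} (G : Finset (Finset V)) (I : Finset V) : Prop := ∀ E ∈ G, ¬ E ⊆ I

/-- Probability that the `p`-random subset of `V` equals `X`. -/
def binWeight {V : Type*} [Fintype V] (p : ℝ) (X : Finset V) : ℝ :=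
  p ^ X.card * (1 - p) ^ (Fintype.card V - X.card)

/-- Probability that the `p`-random subset of `V` belongs to `A`. -/
def binMass {V : Type*} [Fintype V] (p : ℝ) (A : Finset (Finset V)) : ℝ :=
  ∑ X ∈ A, binWeight p X

/-- Members of `A` containing `L`. -/
def above {V : Type*} (A : Finset (Finset V)) (L : Finset V) : Finset (Finset V) :=
  A.filter fun X => L ⊆ X

/-- Sets whose union with `L` is in `A`. -/
def link {V : Type*} [Fintype V] (A : Finset (Finset V)) (L : Finset V) : Finset (Finset V) :=
  Finset.univ.filter fun X => X ∪ L ∈ A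

/-- Every `L ∈ A` is contained in the `p`-random set, conditioned to lie in `A`, with probability
at least `((1-δ)p)^{|L|}`. -/
def IsStable {V : Type*} [Fintype V] (p δ : ℝ) (A : Finset (Finset V)) : Prop :=
  ∀ L ∈ A, ((1 - δ) * p) ^ L.card * binMass p A ≤ binMass p (above A L)

section Weights

variable {V : Type*} [Fintype V] {p δ : ℝ} {A B : Finset (Finset V)} {L : Finset V}

lemma binWeight_nonneg (h0 : 0 ≤ p) (h1 : p ≤ 1) (X : Finset V) : 0 ≤ binWeight p X :=
  mul_nonneg (pow_nonneg h0 _) (pow_nonneg (sub_nonneg.2 h1) _)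

lemma binMass_nonneg (h0 : 0 ≤ p) (h1 : p ≤ 1) (A : Finset (Finset V)) : 0 ≤ binMass p A :=
  Finset.sum_nonneg fun X _ => binWeight_nonneg h0 h1 X

lemma binMass_mono (h0 : 0 ≤ p) (h1 : p ≤ 1) (h : A ⊆ B) : binMass p A ≤ binMass p B :=
  Finset.sum_le_sum_of_subset_of_nonneg h fun X _ _ => binWeight_nonneg h0 h1 X

lemma binMass_univ (p : ℝ) : binMass p (Finset.univ : Finset (Finset V)) = 1 := by
  have h := Finset.sum_pow_mul_eq_add_pow p (1 - p) (Finset.univ : Finset V)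
  rw [Finset.powerset_univ, Finset.card_univ] at h
  unfold binMass binWeight
  rw [h]
  simp

lemma binMass_le_one (h0 : 0 ≤ p) (h1 : p ≤ 1) (A : Finset (Finset V)) : binMass p A ≤ 1 :=
  (binMass_mono h0 h1 (Finset.subset_univ A)).trans_eq (binMass_univ p)

lemma pow_card_le_binMass (h0 : 0 ≤ p) (h1 : p ≤ 1) (hA : ∅ ∈ A) :
    (1 - p) ^ Fintype.card V ≤ binMass p A := by
  have h := Finset.single_le_sum (f := binWeight p)
    (fun X _ => binWeight_nonneg h0 h1 X) hA
  simpa [binWeight, binMass] using h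

lemma sum_binWeight_insert (p : ℝ) (v : V) (f : Finset V → ℝ) :
    (∑ X, binWeight p X * f (insert v X)) * p =
      ∑ X, binWeight p X * if v ∈ X then f X else 0 := by
  have split : ∀ F : Finset V → ℝ, ∑ X, F X =
      ∑ X ∈ (Finset.univ.erase v).powerset, (F X + F (insert v X)) := by
    intro F
    rw [Finset.sum_add_distrib, ← Finset.sum_powerset_insert (Finset.notMem_erase v _),
      Finset.insert_erase (Finset.mem_univ v), Finset.powerset_univ]
  rw [split, split, Finset.sum_mul]
  refine Finset.sum_congr rfl fun X hX => ?_
  have hv : v ∉ X := fun h => Finset.notMem_erase v _ (Finset.mem_powerset.1 hX h)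
  have hlt : X.card < Fintype.card V := by
    have h := Finset.card_le_univ (insert v X)
    rw [Finset.card_insert_of_notMem hv] at h
    omega
  obtain ⟨k, hk⟩ : ∃ k, Fintype.card V = X.card + 1 + k := ⟨_, (Nat.add_sub_of_le hlt).symm⟩
  have e1 : Fintype.card V - X.card = k + 1 := by omega
  have e2 : Fintype.card V - (X.card + 1) = k := by omega
  simp only [binWeight, Finset.card_insert_of_notMem hv, Finset.insert_idem, hv, if_false, e1, e2,
    Finset.mem_insert_self, if_true]
  ring

lemma sum_binWeight_union (p : ℝ) (L : Finset V) (f : Finset V → ℝ) :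
    (∑ X, binWeight p X * f (X ∪ L)) * p ^ L.card =
      ∑ X, binWeight p X * if L ⊆ X then f X else 0 := by
  induction L using Finset.induction_on generalizing f with
  | empty => simp
  | insert v L hv ih =>
    have h := ih fun X => f (insert v X)
    simp only [Finset.union_insert] at h ⊢
    rw [Finset.card_insert_of_notMem hv, pow_succ, ← mul_assoc, h]
    have h2 := sum_binWeight_insert p v fun X => if L ⊆ X then f X else 0
    simp only [Finset.subset_insert_iff_of_notMem hv] at h2
    rw [h2]
    refine Finset.sum_congr rfl fun X _ => ?_
    by_cases hvX : v ∈ X <;> simp [Finset.insert_subset_iff, hvX]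

lemma binMass_link_mul (p : ℝ) (A : Finset (Finset V)) (L : Finset V) :
    binMass p (link A L) * p ^ L.card = binMass p (above A L) := by
  have h := sum_binWeight_union p L fun X => if X ∈ A then 1 else 0
  simp only [mul_ite, mul_one, mul_zero] at h
  rw [← Finset.sum_filter] at h
  unfold binMass link above
  rw [h, ← Finset.sum_filter, ← Finset.sum_filter]
  congr 1
  ext X
  simp [and_comm]

lemma link_subset (hA : IsLowerSet (A : Set (Finset V))) (L : Finset V) : link A L ⊆ A := by
  intro X hX
  exact hA (Finset.subset_union_left (s₂ := L)) (Finset.mem_filter.1 hX).2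

lemma binMass_above_le (h0 : 0 ≤ p) (h1 : p ≤ 1) (hA : IsLowerSet (A : Set (Finset V)))
    (L : Finset V) : binMass p (above A L) ≤ p ^ L.card * binMass p A := by
  rw [← binMass_link_mul, mul_comm]
  exact mul_le_mul_of_nonneg_left (binMass_mono h0 h1 (link_subset hA L)) (pow_nonneg h0 _)

lemma card_le_of_pow_le {n k : ℕ} (h0 : 0 < p) (hpδ : p ≤ δ) (hδ : δ < 1)
    (h : (1 - p) ^ n ≤ (1 - δ) ^ k) : (k : ℝ) ≤ p * n / δ := by
  have hδ0 : 0 < δ := h0.trans_le hpδ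
  have h2 : (1 - δ) ^ (p / δ) ≤ 1 - p := by
    have h3 := rpow_one_add_le_one_add_mul_self (s := -δ) (by linarith)
      (p := p / δ) (by positivity) ((div_le_one hδ0).2 hpδ)
    have : p / δ * -δ = -p := by field_simp
    rw [this] at h3
    simpa [sub_eq_add_neg] using h3
  have h4 : (1 - δ) ^ (p / δ * n) ≤ (1 - δ) ^ (k : ℝ) := by
    rw [Real.rpow_mul (by linarith), Real.rpow_natCast, Real.rpow_natCast]
    exact (pow_le_pow_left₀ (Real.rpow_nonneg (by linarith) _) h2 n).trans h
  rw [Real.rpow_le_rpow_left_iff_of_base_lt_one (by linarith) (by linarith)] at h4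
  rwa [div_mul_eq_mul_div] at h4

end Weights

/-- The container algorithm: fingerprints `g I` and stable down-sets `F I` that depend on `I`
only through the fingerprint. -/
lemma exists_stable {V : Type*} [Fintype V] {p δ : ℝ} (h0 : 0 < p) (h1 : p ≤ 1) (hδ0 : 0 ≤ δ)
    (hδ1 : δ ≤ 1) (A : Finset (Finset V)) (hA : IsLowerSet (A : Set (Finset V))) :
    ∃ (g : Finset V → Finset V) (F : Finset V → Finset (Finset V)), ∀ I ∈ A,
      g I ⊆ I ∧ I ∈ F I ∧ F I ⊆ A ∧ IsLowerSet (F I : Set (Finset V)) ∧ IsStable p δ (F I) ∧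
      binMass p (F I) ≤ (1 - δ) ^ (g I).card * binMass p A ∧
      ∀ S, g I ⊆ S → S ⊆ I → F S = F I := by
  induction A using Finset.strongInduction with
  | H A ih =>
  by_cases hs : IsStable p δ A
  · exact ⟨fun _ => ∅, fun _ => A, fun I hI => ⟨by simp, hI, subset_rfl, hA, hs, by simp,
      fun _ _ _ => rfl⟩⟩
  unfold IsStable at hs
  push Not at hs
  obtain ⟨L, hL, hlt⟩ := hs
  have hc0 : 0 ≤ 1 - δ := by linarith
  have hM := binMass_nonneg h0.le h1 A
  have hlink : binMass p (link A L) < (1 - δ) ^ L.card * binMass p A := by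
    rw [← binMass_link_mul, mul_pow, mul_right_comm] at hlt
    exact lt_of_mul_lt_mul_right hlt (by positivity)
  have hlinkA : link A L ⊂ A := by
    refine (link_subset hA L).ssubset_of_ne fun h => ?_
    rw [h] at hlink
    exact absurd hlink (not_lt.2 (mul_le_of_le_one_left hM (pow_le_one₀ hc0 (by linarith))))
  have hdelA : (A.filter fun X => ¬ L ⊆ X) ⊂ A :=
    Finset.filter_ssubset.2 ⟨L, hL, by simp⟩
  obtain ⟨g₁, F₁, H₁⟩ := ih _ hlinkA (by
    intro X X' hle hX
    simp only [link, Finset.coe_filter, Finset.mem_univ, true_and, Set.mem_ofPred_eq] at hX ⊢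
    exact hA (Finset.union_subset_union_left hle) hX)
  obtain ⟨g₂, F₂, H₂⟩ := ih _ hdelA (by
    intro X X' hle hX
    simp only [Finset.coe_filter, Set.mem_ofPred_eq] at hX ⊢
    exact ⟨hA hle hX.1, fun h => hX.2 (h.trans hle)⟩)
  refine ⟨fun I => if L ⊆ I then L ∪ g₁ I else g₂ I, fun I => if L ⊆ I then F₁ I else F₂ I,
    fun I hI => ?_⟩
  by_cases hLI : L ⊆ I
  · obtain ⟨a, b, c, d, e, m, k⟩ := H₁ I (by
      simpa [link, Finset.union_eq_left.2 hLI] using hI)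
    simp only [hLI, if_true]
    refine ⟨Finset.union_subset hLI a, b, c.trans hlinkA.1, d, e, ?_, fun S hS hSI => ?_⟩
    · calc binMass p (F₁ I) ≤ (1 - δ) ^ (g₁ I).card * binMass p (link A L) := m
        _ ≤ (1 - δ) ^ (g₁ I).card * ((1 - δ) ^ L.card * binMass p A) := by gcongr
        _ = (1 - δ) ^ (L.card + (g₁ I).card) * binMass p A := by ring
        _ ≤ (1 - δ) ^ (L ∪ g₁ I).card * binMass p A := by
          refine mul_le_mul_of_nonneg_right ?_ hM
          exact pow_le_pow_of_le_one hc0 (by linarith) (Finset.card_union_le _ _)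
    · rw [if_pos (Finset.union_subset_left hS)]
      exact k S (Finset.union_subset_right hS) hSI
  · obtain ⟨a, b, c, d, e, m, k⟩ := H₂ I (by simp [hI, hLI])
    simp only [hLI, if_false]
    refine ⟨a, b, c.trans hdelA.1, d, e, m.trans ?_, fun S hS hSI => ?_⟩
    · exact mul_le_mul_of_nonneg_left (binMass_mono h0.le h1 hdelA.1) (by positivity)
    · rw [if_neg fun h => hLI (h.trans hSI)]
      exact k S hS hSI

lemma sum_degree_sq {V ι : Type*} (G : Finset ι) (M : ι → Finset V) (ν : ι → ℝ)
    (P : Finset (Finset V)) (c : Finset V → ℝ) :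
    ∑ L ∈ P, (∑ i ∈ G.filter (fun i => L ⊆ M i), ν i) ^ 2 / c L =
      ∑ i ∈ G, ∑ j ∈ G, ν i * ν j * ∑ L ∈ P.filter (fun L => L ⊆ M i ∩ M j), 1 / c L := by
  have h : ∀ L, (∑ i ∈ G.filter (fun i => L ⊆ M i), ν i) ^ 2 / c L =
      ∑ i ∈ G, ∑ j ∈ G, ν i * ν j * if L ⊆ M i ∩ M j then 1 / c L else 0 := by
    intro L
    rw [Finset.sum_filter, sq, Finset.sum_mul_sum, Finset.sum_div]
    refine Finset.sum_congr rfl fun i _ => ?_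
    rw [Finset.sum_div]
    refine Finset.sum_congr rfl fun j _ => ?_
    by_cases hi : L ⊆ M i <;> by_cases hj : L ⊆ M j <;>
      simp [Finset.subset_inter_iff, hi, hj, div_eq_mul_inv]
  rw [Finset.sum_congr rfl fun L _ => h L, Finset.sum_comm]
  refine Finset.sum_congr rfl fun i _ => ?_
  rw [Finset.sum_comm]
  exact Finset.sum_congr rfl fun j _ => by rw [Finset.sum_filter, Finset.mul_sum]

section SecondMoment

variable {V ι : Type*} [Fintype V]

lemma sum_binWeight_mul_sum (p : ℝ) (A : Finset (Finset V)) (G : Finset ι) (N : ι → Finset V)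
    (a : ι → ℝ) :
    ∑ X ∈ A, binWeight p X * ∑ i ∈ G.filter (fun i => N i ⊆ X), a i =
      ∑ i ∈ G, a i * binMass p (above A (N i)) := by
  simp only [binMass, above, Finset.sum_filter, Finset.mul_sum]
  rw [Finset.sum_comm]
  refine Finset.sum_congr rfl fun i _ => Finset.sum_congr rfl fun X _ => ?_
  by_cases h : N i ⊆ X <;> simp [h, mul_comm]

lemma sum_binWeight_mul_sum_sum (p : ℝ) (A : Finset (Finset V)) (G : Finset ι)
    (N : ι → Finset V) (a : ι → ι → ℝ) :
    ∑ X ∈ A, binWeight p X * ∑ i ∈ G.filter (fun i => N i ⊆ X),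
        ∑ j ∈ G.filter (fun j => N j ⊆ X), a i j =
      ∑ i ∈ G, ∑ j ∈ G, a i j * binMass p (above A (N i ∪ N j)) := by
  simp only [binMass, above, Finset.sum_filter, Finset.mul_sum]
  rw [Finset.sum_comm]
  refine Finset.sum_congr rfl fun i _ => ?_
  rw [Finset.sum_comm (s := G) (t := A)]
  refine Finset.sum_congr rfl fun X _ => ?_
  by_cases hi : N i ⊆ X
  · simp only [hi, if_true, Finset.mul_sum]
    refine Finset.sum_congr rfl fun j _ => ?_
    by_cases hj : N j ⊆ X <;> simp [hi, hj, Finset.union_subset_iff, mul_comm]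
  · simp [hi, Finset.union_subset_iff]

lemma sq_sum_binWeight_le {p : ℝ} (h0 : 0 ≤ p) (h1 : p ≤ 1) (A : Finset (Finset V))
    (Z : Finset V → ℝ) :
    (∑ X ∈ A, binWeight p X * Z X) ^ 2 ≤ binMass p A * ∑ X ∈ A, binWeight p X * Z X ^ 2 := by
  refine Finset.sum_sq_le_sum_mul_sum_of_sq_le_mul A (fun X _ => binWeight_nonneg h0 h1 X)
    (fun X _ => mul_nonneg (binWeight_nonneg h0 h1 X) (sq_nonneg _)) fun X _ => le_of_eq ?_
  ring

/-- If `v` is almost uncorrelated with the event `R ∈ A` for the `p`-random set `R`, then the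
degree of `v` in a family of minimal non-members of `A` is controlled by the degrees of larger
sets containing `v`. -/
lemma sq_degree_le {p δ : ℝ} (h0 : 0 < p) (h1 : p ≤ 1) (hδ0 : 0 ≤ δ)
    {A : Finset (Finset V)} (hA : IsLowerSet (A : Set (Finset V))) (hmass : 0 < binMass p A)
    (hst : IsStable p δ A) {s : ℕ} (hδ : δ * s ≤ 1 / 2) (hδ1 : δ ≤ 1) (v : V) (hv : {v} ∈ A)
    (G : Finset ι) (M : ι → Finset V) (ν : ι → ℝ) (hν : ∀ i ∈ G, 0 ≤ ν i)
    (hvM : ∀ i ∈ G, v ∈ M i) (hMA : ∀ i ∈ G, M i ∉ A) (hMe : ∀ i ∈ G, (M i).erase v ∈ A)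
    (hMs : ∀ i ∈ G, (M i).card ≤ s) :
    (∑ i ∈ G, ν i) ^ 2 / 4 ≤ δ * ((∑ i ∈ G, ν i) ^ 2 + p *
      ∑ L ∈ Finset.univ.filter (fun L : Finset V => v ∈ L ∧ 2 ≤ L.card),
        (∑ i ∈ G.filter (fun i => L ⊆ M i), ν i) ^ 2 / p ^ L.card) := by
  set m := binMass p A
  set B := A.filter fun X => insert v X ∉ A
  set N : ι → Finset V := fun i => (M i).erase v with hN
  set Z : Finset V → ℝ := fun X => ∑ i ∈ G.filter (fun i => N i ⊆ X), ν i / p ^ (N i).card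
    with hZ
  set P := Finset.univ.filter (fun L : Finset V => v ∈ L ∧ 2 ≤ L.card) with hP
  have hc0 : 0 ≤ 1 - δ := by linarith
  have hB : binMass p B ≤ δ * m := by
    have e1 : link A {v} = A.filter fun X => insert v X ∈ A := by
      ext X
      simp only [link, Finset.mem_filter, Finset.mem_univ, true_and, Finset.union_singleton]
      exact ⟨fun h => ⟨hA (Finset.subset_insert v X) h, h⟩, fun h => h.2⟩
    have e2 : binMass p (link A {v}) + binMass p B = m := by
      rw [e1]
      exact Finset.sum_filter_add_sum_filter_not A _ _
    have e3 := hst _ hv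
    rw [← binMass_link_mul, Finset.card_singleton, pow_one, pow_one, mul_right_comm] at e3
    have e4 := le_of_mul_le_mul_right e3 h0
    linarith
  have hZB : ∀ f : ℝ → ℝ, f 0 = 0 →
      ∑ X ∈ A, binWeight p X * f (Z X) = ∑ X ∈ B, binWeight p X * f (Z X) := by
    intro f hf
    symm
    refine Finset.sum_subset (Finset.filter_subset _ _) fun X hX hXB => ?_
    have hins : insert v X ∈ A := by
      by_contra h
      exact hXB (Finset.mem_filter.2 ⟨hX, h⟩)
    have : Z X = 0 := by
      rw [hZ]
      refine Finset.sum_eq_zero fun i hi => ?_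
      rw [Finset.mem_filter] at hi
      refine absurd (hA ?_ hins) (hMA i hi.1)
      exact Finset.subset_insert_iff.2 hi.2
    rw [this, hf, mul_zero]
  have hfirst : (∑ i ∈ G, ν i) / 2 * m ≤ ∑ X ∈ B, binWeight p X * Z X := by
    rw [← hZB (fun x => x) rfl]
    simp only [hZ]
    rw [sum_binWeight_mul_sum, Finset.sum_div, Finset.sum_mul]
    refine Finset.sum_le_sum fun i hi => ?_
    have hb : 1 / 2 ≤ (1 - δ) ^ (N i).card := by
      have h2 := one_add_mul_le_pow (a := -δ) (by linarith) (N i).card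
      have h3 : ((N i).card : ℝ) ≤ s := by
        exact_mod_cast (Finset.card_le_card (Finset.erase_subset _ _)).trans (hMs i hi)
      have h4 := mul_le_mul_of_nonneg_left h3 hδ0
      rw [← sub_eq_add_neg] at h2
      linarith
    have hs := hst _ (hMe i hi)
    calc ν i / 2 * m = ν i * (1 / 2 * m) := by ring
      _ ≤ ν i * ((1 - δ) ^ (N i).card * m) := by
        have := hν i hi
        gcongr
      _ = ν i / p ^ (N i).card * (((1 - δ) * p) ^ (N i).card * m) := by
        rw [mul_pow]
        field_simp
      _ ≤ _ := mul_le_mul_of_nonneg_left hs (div_nonneg (hν i hi) (by positivity))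
  have hsecond : ∑ X ∈ B, binWeight p X * Z X ^ 2 ≤ m * ((∑ i ∈ G, ν i) ^ 2 + p *
      ∑ L ∈ P, (∑ i ∈ G.filter (fun i => L ⊆ M i), ν i) ^ 2 / p ^ L.card) := by
    rw [← hZB (· ^ 2) (by norm_num), sum_degree_sq]
    simp only [hZ, sq (∑ _ ∈ _, _), Finset.sum_mul_sum]
    rw [sum_binWeight_mul_sum_sum, Finset.mul_sum, ← Finset.sum_add_distrib, Finset.mul_sum]
    refine Finset.sum_le_sum fun i hi => ?_
    rw [Finset.mul_sum, ← Finset.sum_add_distrib, Finset.mul_sum]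
    refine Finset.sum_le_sum fun j hj => ?_
    have hcard := Finset.card_union_add_card_inter (N i) (N j)
    have hinter : N i ∩ N j = (M i ∩ M j).erase v := by
      ext x
      simp only [hN, Finset.mem_inter, Finset.mem_erase]
      tauto
    have hvD : v ∈ M i ∩ M j := Finset.mem_inter.2 ⟨hvM i hi, hvM j hj⟩
    have hD : (N i ∩ N j).card + 1 = (M i ∩ M j).card := by
      rw [hinter, Finset.card_erase_add_one hvD]
    have hK : 1 / p ^ (N i ∩ N j).card ≤
        1 + p * ∑ L ∈ P.filter (fun L => L ⊆ M i ∩ M j), 1 / p ^ L.card := by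
      have hnn : ∀ L ∈ P.filter (fun L => L ⊆ M i ∩ M j), 0 ≤ 1 / p ^ L.card :=
        fun L _ => by positivity
      by_cases h2 : 2 ≤ (M i ∩ M j).card
      · have h3 := Finset.single_le_sum hnn
          (Finset.mem_filter.2 ⟨Finset.mem_filter.2 ⟨Finset.mem_univ _, hvD, h2⟩, subset_rfl⟩)
        have h4 := mul_le_mul_of_nonneg_left h3 h0.le
        have h5 : p * (1 / p ^ (M i ∩ M j).card) = 1 / p ^ (N i ∩ N j).card := by
          rw [← hD, pow_succ]
          field_simp
        rw [h5] at h4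
        linarith
      · have h3 : (N i ∩ N j).card = 0 := by omega
        have h4 := mul_nonneg h0.le (Finset.sum_nonneg hnn)
        rw [h3]
        simpa using h4
    have hνν := mul_nonneg (hν i hi) (hν j hj)
    calc ν i / p ^ (N i).card * (ν j / p ^ (N j).card) * binMass p (above A (N i ∪ N j))
        ≤ ν i / p ^ (N i).card * (ν j / p ^ (N j).card) * (p ^ (N i ∪ N j).card * m) := by
          refine mul_le_mul_of_nonneg_left (binMass_above_le h0.le h1 hA _) ?_
          have := hν i hi
          have := hν j hj
          positivity
      _ = ν i * ν j * m * (1 / p ^ (N i ∩ N j).card) := by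
        have : p ^ (N i).card * p ^ (N j).card =
            p ^ (N i ∪ N j).card * p ^ (N i ∩ N j).card := by
          rw [← pow_add, ← pow_add, hcard]
        rw [div_mul_div_comm, this]
        field_simp
      _ ≤ ν i * ν j * m *
          (1 + p * ∑ L ∈ P.filter (fun L => L ⊆ M i ∩ M j), 1 / p ^ L.card) :=
        mul_le_mul_of_nonneg_left hK (mul_nonneg hνν hmass.le)
      _ = _ := by ring
  set D := ∑ L ∈ P, (∑ i ∈ G.filter (fun i => L ⊆ M i), ν i) ^ 2 / p ^ L.card
  set a := ∑ i ∈ G, ν i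
  have ha : 0 ≤ a := Finset.sum_nonneg hν
  have hcs := sq_sum_binWeight_le h0.le h1 B Z
  have hDn : 0 ≤ D := Finset.sum_nonneg fun L _ => by positivity
  have key : (a / 2 * m) ^ 2 ≤ δ * m * (m * (a ^ 2 + p * D)) :=
    calc (a / 2 * m) ^ 2 ≤ (∑ X ∈ B, binWeight p X * Z X) ^ 2 := by gcongr
      _ ≤ binMass p B * ∑ X ∈ B, binWeight p X * Z X ^ 2 := hcs
      _ ≤ δ * m * (m * (a ^ 2 + p * D)) :=
        mul_le_mul hB hsecond (Finset.sum_nonneg fun X _ =>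
          mul_nonneg (binWeight_nonneg h0.le h1 X) (sq_nonneg _)) (by positivity)
  have hm2 : 0 < m ^ 2 := by positivity
  refine le_of_mul_le_mul_right ?_ hm2
  linarith [key]

end SecondMoment

section Janson

variable {V : Type*} [Fintype V] {p : ℝ} {G H : Finset (Finset V)} {ν : Finset V → ℝ}

lemma dMass_nonneg {V : Type*} {G : Finset (Finset V)} {ν : Finset V → ℝ}
    (hν : ∀ E, 0 ≤ ν E) (L : Finset V) : 0 ≤ dMass G ν L :=
  Finset.sum_nonneg fun E _ => hν E

lemma lamP_mono (hp : 0 ≤ p) (hν : ∀ E, 0 ≤ ν E) (hG : G ⊆ H) : lamP p G ν ≤ lamP p H ν := by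
  refine Finset.sum_le_sum fun L _ => ?_
  have h : dMass G ν L ≤ dMass H ν L :=
    Finset.sum_le_sum_of_subset_of_nonneg (Finset.filter_subset_filter _ hG) fun E _ _ => hν E
  have h0 := dMass_nonneg (G := G) hν L
  gcongr

lemma le_lamP_of_not_isJanson {R : ℝ} (h : ¬ IsJanson p R H) (hν : ∀ E, 0 ≤ ν E)
    (hG : G ⊆ H) : eMass G ν ^ 2 / R ≤ lamP p G ν := by
  unfold IsJanson at h
  push Not at h
  obtain ⟨_, h⟩ := h
  have hres : ∀ (Q : Finset V → Prop) [DecidablePred Q],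
      ∑ E ∈ H.filter Q, (if E ∈ G then ν E else 0) = ∑ E ∈ G.filter Q, ν E := by
    intro Q _
    rw [← Finset.sum_filter]
    congr 1
    ext E
    simp only [Finset.mem_filter]
    exact ⟨fun x => ⟨x.2, x.1.2⟩, fun x => ⟨⟨hG x.1, x.2⟩, x.1⟩⟩
  have h1 := h (fun E => if E ∈ G then ν E else 0)
    ⟨fun E => by
      by_cases hE : E ∈ G
      · simpa [hE] using hν E
      · simp [hE], fun E hE => if_neg fun h' => hE (hG h')⟩
  have e1 : eMass H (fun E => if E ∈ G then ν E else 0) = eMass G ν := by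
    simpa [eMass] using hres fun _ => True
  have e2 : lamP p H (fun E => if E ∈ G then ν E else 0) = lamP p G ν := by
    unfold lamP dMass
    exact Finset.sum_congr rfl fun L _ => by beta_reduce; rw [hres]
  rwa [e1, e2] at h1

lemma lamP_eq (p : ℝ) (G : Finset (Finset V)) (ν : Finset V → ℝ) :
    lamP p G ν = ∑ E ∈ G, ∑ E' ∈ G, ν E * ν E' *
      ∑ L ∈ (Finset.univ.filter fun L : Finset V => 2 ≤ L.card).filter (fun L => L ⊆ E ∩ E'),
        1 / p ^ L.card :=
  sum_degree_sq G (fun E => E) ν _ fun L => p ^ L.card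

lemma sum_inv_pow_le {q : ℝ} (hp : 0 < p) (hpq : p < q) (D : Finset V) :
    ∑ L ∈ (Finset.univ.filter fun L : Finset V => 2 ≤ L.card).filter (fun L => L ⊆ D),
        1 / (p / (q - p)) ^ L.card ≤
      q ^ D.card *
        ∑ L ∈ (Finset.univ.filter fun L : Finset V => 2 ≤ L.card).filter (fun L => L ⊆ D),
          1 / p ^ L.card := by
  have hqp : 0 < q - p := sub_pos.2 hpq
  have hq : 0 < q := hp.trans hpq
  by_cases hD : 2 ≤ D.card
  · calc _ ≤ ∑ L ∈ D.powerset, 1 / (p / (q - p)) ^ L.card := by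
          refine Finset.sum_le_sum_of_subset_of_nonneg (fun L hL => ?_) fun L _ _ => by positivity
          exact Finset.mem_powerset.2 (Finset.mem_filter.1 hL).2
      _ = ∑ L ∈ D.powerset, ((q - p) / p) ^ L.card * 1 ^ (D.card - L.card) := by
          refine Finset.sum_congr rfl fun L _ => ?_
          rw [one_pow, mul_one, ← one_div_pow, one_div_div]
      _ = q ^ D.card * (1 / p ^ D.card) := by
          rw [Finset.sum_pow_mul_eq_add_pow, div_add_one hp.ne', sub_add_cancel, div_pow,
            mul_one_div]
      _ ≤ _ := by
          refine mul_le_mul_of_nonneg_left ?_ (by positivity)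
          exact Finset.single_le_sum (f := fun L : Finset V => 1 / p ^ L.card)
            (fun L _ => by positivity) (Finset.mem_filter.2
              ⟨Finset.mem_filter.2 ⟨Finset.mem_univ _, hD⟩, subset_rfl⟩)
  · have hempty : (Finset.univ.filter fun L : Finset V => 2 ≤ L.card).filter
        (fun L => L ⊆ D) = ∅ := by
      refine Finset.filter_eq_empty_iff.2 fun L hL hLD => hD ?_
      exact (Finset.mem_filter.1 hL).2.trans (Finset.card_le_card hLD)
    rw [hempty]
    simp

/-- If every member of a stable down-set `A` induces a non-Janson hypergraph, then the edges
in `A` form a non-Janson hypergraph. -/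
lemma sq_eMass_le_lamP_of_mem {q α R : ℝ} {s : ℕ} (hp : 0 < p) (hpq : p < q) (hq1 : q ≤ 1)
    (hα1 : α ≤ 1) (hR : 0 < R) {A : Finset (Finset V)}
    (hA : IsLowerSet (A : Set (Finset V))) (hmass : 0 < binMass q A) (hst : IsStable q α A)
    (hGs : ∀ E ∈ G, E.card = s) (hGA : G ⊆ A) (hν : ∀ E, 0 ≤ ν E)
    (hnon : ∀ X ∈ A, eMass (indHG G X) ν ^ 2 / R ≤ lamP (p / (q - p)) (indHG G X) ν) :
    (1 - α) ^ (2 * s) * eMass G ν ^ 2 / R ≤ lamP p G ν := by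
  have hq : 0 < q := hp.trans hpq
  have hα : 0 ≤ 1 - α := sub_nonneg.2 hα1
  have hw := fun X : Finset V => binWeight_nonneg hq.le hq1 X
  set m := binMass q A
  have he : 0 ≤ eMass G ν := Finset.sum_nonneg fun E _ => hν E
  have hlow : ((1 - α) * q) ^ s * m * eMass G ν ≤
      ∑ X ∈ A, binWeight q X * eMass (indHG G X) ν := by
    have h1 := sum_binWeight_mul_sum q A G (fun E => E) ν
    unfold eMass indHG
    rw [h1, Finset.mul_sum]
    refine Finset.sum_le_sum fun E hE => ?_
    have h2 := hst E (hGA hE)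
    rw [hGs E hE] at h2
    rw [mul_comm]
    exact mul_le_mul_of_nonneg_left h2 (hν E)
  have hup : ∑ X ∈ A, binWeight q X * lamP (p / (q - p)) (indHG G X) ν ≤
      q ^ (2 * s) * m * lamP p G ν := by
    simp only [lamP_eq]
    unfold indHG
    rw [sum_binWeight_mul_sum_sum q A G (fun E => E), Finset.mul_sum]
    refine Finset.sum_le_sum fun E hE => ?_
    rw [Finset.mul_sum]
    refine Finset.sum_le_sum fun E' hE' => ?_
    have hK := sum_inv_pow_le hp hpq (E ∩ E')
    set K := ∑ L ∈ (Finset.univ.filter fun L : Finset V => 2 ≤ L.card).filter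
      (fun L => L ⊆ E ∩ E'), 1 / p ^ L.card
    have hνν := mul_nonneg (hν E) (hν E')
    have hqp : 0 < q - p := sub_pos.2 hpq
    have hc := Finset.card_union_add_card_inter E E'
    rw [hGs E hE, hGs E' hE', ← two_mul] at hc
    calc _ ≤ ν E * ν E' * (q ^ (E ∩ E').card * K) * (q ^ (E ∪ E').card * m) := by
          refine mul_le_mul (mul_le_mul_of_nonneg_left hK hνν)
            (binMass_above_le hq.le hq1 hA _) (binMass_nonneg hq.le hq1 _) ?_
          exact mul_nonneg hνν (mul_nonneg (by positivity)
            (Finset.sum_nonneg fun L _ => by positivity))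
      _ = q ^ (2 * s) * m * (ν E * ν E' * K) := by
          rw [← hc, pow_add]
          ring
  have hmid : (∑ X ∈ A, binWeight q X * eMass (indHG G X) ν ^ 2) / R ≤
      ∑ X ∈ A, binWeight q X * lamP (p / (q - p)) (indHG G X) ν := by
    rw [Finset.sum_div]
    refine Finset.sum_le_sum fun X hX => ?_
    rw [mul_div_assoc]
    exact mul_le_mul_of_nonneg_left (hnon X hX) (hw X)
  have hcs := sq_sum_binWeight_le hq.le hq1 A fun X => eMass (indHG G X) ν
  have h1 : (((1 - α) * q) ^ s * m * eMass G ν) ^ 2 ≤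
      (∑ X ∈ A, binWeight q X * eMass (indHG G X) ν) ^ 2 := by gcongr
  have h2 := (div_le_iff₀ hR).1 (hmid.trans hup)
  have h3 := (h1.trans hcs).trans (mul_le_mul_of_nonneg_left h2 hmass.le)
  rw [div_le_iff₀ hR]
  have hpos : 0 < q ^ (2 * s) * m ^ 2 := by positivity
  refine le_of_mul_le_mul_right ?_ hpos
  calc (1 - α) ^ (2 * s) * eMass G ν ^ 2 * (q ^ (2 * s) * m ^ 2)
      = (((1 - α) * q) ^ s * m * eMass G ν) ^ 2 := by
        simp only [mul_pow]
        ring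
    _ ≤ _ := h3
    _ = _ := by ring

/-- The edges outside a stable down-set `A`, all of whose vertices are in `A`, form a non-Janson
hypergraph. -/
lemma sq_eMass_le_lamP_of_notMem {δ : ℝ} {s : ℕ} (hp : 0 < p) (hp1 : p ≤ 1) (hδ0 : 0 ≤ δ)
    (hδ1 : δ ≤ 1 / 8) (hδs : δ * s ≤ 1 / 2 ^ 11) {A : Finset (Finset V)}
    (hA : IsLowerSet (A : Set (Finset V))) (hempty : ∅ ∈ A) (hmass : 0 < binMass p A)
    (hst : IsStable p δ A) (hGs : ∀ E ∈ G, E.card = s) (hGA : ∀ E ∈ G, E ∉ A)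
    (hGv : ∀ E ∈ G, ∀ v ∈ E, {v} ∈ A) (hν : ∀ E, 0 ≤ ν E) :
    2 ^ 10 * eMass G ν ^ 2 ≤ p * Fintype.card V * lamP p G ν := by
  have hmin : ∀ E, ∃ M : Finset V, M ⊆ E ∧ (E ∈ G → M ∉ A ∧ ∀ v ∈ M, M.erase v ∈ A) := by
    intro E
    by_cases hE : E ∈ G
    · obtain ⟨M, hME, hM⟩ := Finset.exists_le_minimal (E.powerset.filter (· ∉ A))
        (Finset.mem_filter.2 ⟨Finset.mem_powerset_self E, hGA E hE⟩)
      refine ⟨M, hME, fun _ => ⟨(Finset.mem_filter.1 hM.prop).2, fun v hv => ?_⟩⟩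
      by_contra h
      have h2 := hM.le_of_le (Finset.mem_filter.2
        ⟨Finset.mem_powerset.2 ((Finset.erase_subset v M).trans hME), h⟩) (Finset.erase_subset v M)
      exact Finset.notMem_erase v M (h2 hv)
    · exact ⟨∅, by simp, fun h => absurd h hE⟩
  choose M hME hM using hmin
  have hMcard : ∀ E ∈ G, 2 ≤ (M E).card := by
    intro E hE
    by_contra h
    have h1 : (M E).card = 0 ∨ (M E).card = 1 := by omega
    rcases h1 with h1 | h1
    · rw [Finset.card_eq_zero] at h1
      exact (hM E hE).1 (h1 ▸ hempty)
    · obtain ⟨v, hv⟩ := Finset.card_eq_one.1 h1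
      refine (hM E hE).1 (hv ▸ hGv E hE v (hME E ?_))
      simp [hv]
  have hMs : ∀ E ∈ G, (M E).card ≤ s := fun E hE =>
    (Finset.card_le_card (hME E)).trans_eq (hGs E hE)
  set a : V → ℝ := fun v => ∑ E ∈ G.filter (fun E => v ∈ M E), ν E with ha
  set c : Finset V → ℝ := fun L => (∑ E ∈ G.filter (fun E => L ⊆ M E), ν E) ^ 2 / p ^ L.card
    with hc
  set D : V → ℝ := fun v => ∑ L ∈ Finset.univ.filter
    (fun L : Finset V => v ∈ L ∧ 2 ≤ L.card), c L with hD
  have hc0 : ∀ L, 0 ≤ c L := fun L => by positivity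
  have hvert : ∀ v, a v ^ 2 ≤ 8 * δ * p * D v := by
    intro v
    by_cases hv : {v} ∈ A
    · have h := sq_degree_le hp hp1 hδ0 hA hmass hst (s := s)
        (hδs.trans (by norm_num)) (by linarith) v hv (G.filter fun E => v ∈ M E) M ν
        (fun E _ => hν E) (fun E hE => (Finset.mem_filter.1 hE).2)
        (fun E hE => (hM E (Finset.mem_filter.1 hE).1).1)
        (fun E hE => (hM E (Finset.mem_filter.1 hE).1).2 v (Finset.mem_filter.1 hE).2)
        (fun E hE => hMs E (Finset.mem_filter.1 hE).1)
      have hDv : ∑ L ∈ Finset.univ.filter (fun L : Finset V => v ∈ L ∧ 2 ≤ L.card),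
          (∑ E ∈ (G.filter fun E => v ∈ M E).filter (fun E => L ⊆ M E), ν E) ^ 2 / p ^ L.card =
          D v := by
        refine Finset.sum_congr rfl fun L hL => ?_
        have hvL := (Finset.mem_filter.1 hL).2.1
        rw [hc, Finset.filter_filter]
        congr 3
        ext E
        simp only [Finset.mem_filter]
        exact ⟨fun x => ⟨x.1, x.2.2⟩, fun x => ⟨x.1, x.2 hvL, x.2⟩⟩
      rw [hDv] at h
      have h2 : δ * a v ^ 2 ≤ 1 / 8 * a v ^ 2 := mul_le_mul_of_nonneg_right hδ1 (sq_nonneg _)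
      change a v ^ 2 / 4 ≤ δ * (a v ^ 2 + p * D v) at h
      linarith
    · have h0 : a v = 0 := by
        rw [ha]
        refine Finset.sum_eq_zero fun E hE => ?_
        rw [Finset.mem_filter] at hE
        exact absurd (hGv E hE.1 v (hME E hE.2)) hv
      have hDn : 0 ≤ D v := Finset.sum_nonneg fun L _ => hc0 L
      rw [h0, sq, zero_mul]
      exact mul_nonneg (by positivity) hDn
  have hsum_a : 2 * eMass G ν ≤ ∑ v, a v := by
    have h1 : ∑ v, a v = ∑ E ∈ G, (M E).card * ν E := by
      simp only [ha, Finset.sum_filter]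
      rw [Finset.sum_comm]
      refine Finset.sum_congr rfl fun E _ => ?_
      rw [← Finset.sum_filter]
      simp
    rw [h1, eMass, Finset.mul_sum]
    refine Finset.sum_le_sum fun E hE => mul_le_mul_of_nonneg_right ?_ (hν E)
    exact_mod_cast hMcard E hE
  have hsum_D : ∑ v, D v ≤ s * lamP p G ν := by
    have h1 : ∑ v, D v = ∑ L ∈ Finset.univ.filter (fun L : Finset V => 2 ≤ L.card),
        L.card * c L := by
      simp only [hD, Finset.sum_filter]
      rw [Finset.sum_comm]
      refine Finset.sum_congr rfl fun L _ => ?_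
      by_cases hL : 2 ≤ L.card <;> simp [hL]
    rw [h1, lamP, Finset.mul_sum]
    refine Finset.sum_le_sum fun L _ => ?_
    by_cases hL : L.card ≤ s
    · have h2 : c L ≤ dMass G ν L ^ 2 / p ^ L.card := by
        have h3 : ∑ E ∈ G.filter (fun E => L ⊆ M E), ν E ≤ dMass G ν L := by
          refine Finset.sum_le_sum_of_subset_of_nonneg (fun E hE => ?_) fun E _ _ => hν E
          rw [Finset.mem_filter] at hE ⊢
          exact ⟨hE.1, hE.2.trans (hME E)⟩
        have h4 : 0 ≤ ∑ E ∈ G.filter (fun E => L ⊆ M E), ν E :=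
          Finset.sum_nonneg fun E _ => hν E
        simp only [hc]
        gcongr
      exact mul_le_mul (by exact_mod_cast hL) h2 (hc0 L) (by positivity)
    · have h2 : G.filter (fun E => L ⊆ M E) = ∅ :=
        Finset.filter_eq_empty_iff.2 fun E hE h =>
          hL ((Finset.card_le_card h).trans (hMs E hE))
      have h3 : c L = 0 := by simp [hc, h2]
      rw [h3, mul_zero]
      positivity
  have he : 0 ≤ eMass G ν := Finset.sum_nonneg fun E _ => hν E
  have hΛ : 0 ≤ lamP p G ν := Finset.sum_nonneg fun L _ => by positivity
  have key : (2 * eMass G ν) ^ 2 ≤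
      Fintype.card V * (8 * p * (1 / 2 ^ 11 * lamP p G ν)) :=
    calc (2 * eMass G ν) ^ 2 ≤ (∑ v, a v) ^ 2 := by gcongr
      _ ≤ Fintype.card V * ∑ v, a v ^ 2 := sq_sum_le_card_mul_sum_sq
      _ ≤ Fintype.card V * ∑ v, 8 * δ * p * D v := by
        gcongr with v
        exact hvert v
      _ = Fintype.card V * (8 * p * (δ * ∑ v, D v)) := by
        rw [← Finset.mul_sum]
        ring
      _ ≤ Fintype.card V * (8 * p * (δ * (s * lamP p G ν))) := by gcongr
      _ ≤ _ := by
        rw [← mul_assoc δ]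
        gcongr
  nlinarith [key]

end Janson

/-- **Theorem 4.4 (container theorem with fingerprints).**
Let `s ≤ n`, `p ≤ 1/(2^{11}s²)`, `2p ≤ q ≤ α < 1`, `R ≥ 2^{-6}pn` and `η ≤ (1-α)^{2s}/4`,
and let `𝒥` be the hypergraph on `V` whose edges are the sets `L` such that `ℋ[L]` is
`(p/(q-p), ηR)`-Janson.  Then there are a family `𝒴` of pairs of subsets of `V` and functions
`g : ℐ(𝒥) → 𝒴`, `f : 𝒴 → 2^V` such that (1) `S ∪ T ⊆ I ⊆ f(S,T)` whenever `g(I) = (S,T)`;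
(2) `|S| ≤ 2^{11}ps²n` and `|T| ≤ qn/α` for every `(S,T) ∈ 𝒴`; and (3) `ℋ[f(Y)]` is not
`(p,R)`-Janson for every `Y ∈ 𝒴`. -/
theorem containers_with_fingerprints
    {V : Type*} [Fintype V] (s n : ℕ) (hsn : s ≤ n) (hn : Fintype.card V = n)
    (p q R α η : ℝ) (hp : 0 < p) (hq : 0 < q) (hR : 0 < R) (hα : 0 < α) (hη : 0 < η)
    (hp' : p ≤ 1 / (2 ^ 11 * (s : ℝ) ^ 2)) (hpq : 2 * p ≤ q) (hqα : q ≤ α) (hα1 : α < 1)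
    (hRn : p * (n : ℝ) / 2 ^ 6 ≤ R) (hηR : η ≤ (1 - α) ^ (2 * s) / 4)
    (H : Finset (Finset V)) (hunif : ∀ E ∈ H, E.card = s) :
    ∃ (Y : Finset (Finset V × Finset V)) (g : Finset V → Finset V × Finset V)
      (f : Finset V × Finset V → Finset V),
      (∀ I : Finset V,
        IndepIn (Finset.univ.filter fun L : Finset V =>
            IsJanson (p / (q - p)) (η * R) (indHG H L)) I →
          g I ∈ Y ∧ (g I).1 ∪ (g I).2 ⊆ I ∧ I ⊆ f (g I)) ∧
      (∀ ST ∈ Y, (ST.1.card : ℝ) ≤ 2 ^ 11 * p * (s : ℝ) ^ 2 * (n : ℝ) ∧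
        (ST.2.card : ℝ) ≤ q * (n : ℝ) / α) ∧
      (∀ ST ∈ Y, ¬ IsJanson p R (indHG H (f ST))) := by
  have hs : 1 ≤ s := by
    by_contra h
    obtain rfl : s = 0 := by omega
    norm_num at hp'
    linarith
  have hs1 : (1 : ℝ) ≤ s := by exact_mod_cast hs
  have hpq' : p < q := by linarith
  have hq1 : q ≤ 1 := by linarith
  obtain ⟨δ, hδ⟩ : ∃ δ : ℝ, δ = 1 / (2 ^ 11 * (s : ℝ) ^ 2) := ⟨_, rfl⟩
  rw [← hδ] at hp'
  have hδ0 : 0 < δ := hp.trans_le hp'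
  have hδs : δ * s ≤ 1 / 2 ^ 11 := by
    rw [hδ, div_mul_eq_mul_div, div_le_div_iff₀ (by positivity) (by positivity)]
    nlinarith
  have hδ8 : δ ≤ 1 / 8 := by
    have := mul_le_mul_of_nonneg_left hs1 hδ0.le
    norm_num at hδs ⊢
    linarith
  have hp1 : p ≤ 1 := by linarith
  set J := Finset.univ.filter fun L : Finset V => IsJanson (p / (q - p)) (η * R) (indHG H L)
  have hlower : ∀ G : Finset (Finset V), IsLowerSet
      ((Finset.univ.filter fun I => IndepIn G I : Finset (Finset V)) : Set (Finset V)) := by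
    intro G X X' hle hX
    simp only [Finset.coe_filter, Finset.mem_univ, true_and, Set.mem_ofPred_eq] at hX ⊢
    exact fun E hE hEX => hX E hE (hEX.trans hle)
  obtain ⟨g₁, F₁, h₁⟩ := exists_stable hq hq1 hα.le hα1.le _ (hlower J)
  have h₂ : ∀ T : Finset V, _ := fun T =>
    exists_stable hp hp1 hδ0.le (by linarith : δ ≤ 1) _ (hlower (H.filter (· ∉ F₁ T)))
  choose g₂ F₂ h₂ using h₂
  refine ⟨(Finset.univ.filter fun I => IndepIn J I).image fun I => (g₂ (g₁ I) I, g₁ I),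
    fun I => (g₂ (g₁ I) I, g₁ I),
    fun ST => Finset.univ.filter fun v => {v} ∈ F₂ ST.2 ST.1, ?_⟩
  have main : ∀ I, IndepIn J I → ((g₂ (g₁ I) I ∪ g₁ I ⊆ I ∧
      I ⊆ Finset.univ.filter fun v => {v} ∈ F₂ (g₁ I) (g₂ (g₁ I) I)) ∧
      (((g₂ (g₁ I) I).card : ℝ) ≤ 2 ^ 11 * p * (s : ℝ) ^ 2 * (n : ℝ) ∧
        ((g₁ I).card : ℝ) ≤ q * (n : ℝ) / α)) ∧
      ¬ IsJanson p R (indHG H (Finset.univ.filter fun v => {v} ∈ F₂ (g₁ I) (g₂ (g₁ I) I))) := by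
    intro I hI
    obtain ⟨gI, IF, FJ, Flow, Fst, Fmass, Feq⟩ := h₁ I (by simpa using hI)
    have Feq' : F₁ (g₁ I) = F₁ I := Feq _ subset_rfl gI
    obtain ⟨gI', IF', FJ', Flow', Fst', Fmass', Feq''⟩ := h₂ (g₁ I) I (by
      refine Finset.mem_filter.2 ⟨Finset.mem_univ _, fun E hE hEI => ?_⟩
      rw [Feq', Finset.mem_filter] at hE
      exact hE.2 (Flow hEI IF))
    rw [Feq'' _ subset_rfl gI']
    have hempty := Flow (Finset.empty_subset I) IF
    have hempty' := Flow' (Finset.empty_subset I) IF'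
    have hpow := pow_card_le_binMass hq.le hq1 hempty
    have hpow' := pow_card_le_binMass hp.le hp1 hempty'
    rw [hn] at hpow hpow'
    refine ⟨⟨⟨Finset.union_subset gI' gI, fun v hv => ?_⟩, ?_, ?_⟩, ?_⟩
    · exact Finset.mem_filter.2 ⟨Finset.mem_univ _,
        Flow' (Finset.singleton_subset_iff.2 hv) IF'⟩
    · have h := card_le_of_pow_le (n := n) (k := (g₂ (g₁ I) I).card) hp hp' (by linarith)
        ((hpow'.trans Fmass').trans (mul_le_of_le_one_right
          (pow_nonneg (by linarith) _) (binMass_le_one hp.le hp1 _)))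
      refine h.trans_eq ?_
      rw [hδ]
      field_simp
    · exact card_le_of_pow_le hq hqα hα1
        ((hpow.trans Fmass).trans (mul_le_of_le_one_right
          (pow_nonneg (by linarith) _) (binMass_le_one hq.le hq1 _)))
    intro hJ
    obtain ⟨ν, ⟨hν, -⟩, hlt⟩ := hJ hR
    set C := Finset.univ.filter fun v => {v} ∈ F₂ (g₁ I) I
    set G := indHG H C
    have hGH : ∀ E ∈ G, E ∈ H ∧ ∀ v ∈ E, {v} ∈ F₂ (g₁ I) I := fun E hE =>
      ⟨(Finset.mem_filter.1 hE).1, fun v hv =>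
        (Finset.mem_filter.1 ((Finset.mem_filter.1 hE).2 hv)).2⟩
    have hb1 : 4 * eMass (G.filter (· ∈ F₁ I)) ν ^ 2 / R ≤ lamP p G ν := by
      have hnon : ∀ X ∈ F₁ I, eMass (indHG (G.filter (· ∈ F₁ I)) X) ν ^ 2 / (η * R) ≤
          lamP (p / (q - p)) (indHG (G.filter (· ∈ F₁ I)) X) ν := by
        intro X hX
        refine le_lamP_of_not_isJanson (H := indHG H X) (fun hXJ => ?_) hν fun E hE => ?_
        · exact (Finset.mem_filter.1 (FJ hX)).2 X
            (Finset.mem_filter.2 ⟨Finset.mem_univ _, hXJ⟩) subset_rfl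
        · rw [indHG, Finset.mem_filter, Finset.mem_filter] at hE
          exact Finset.mem_filter.2 ⟨(hGH E hE.1.1).1, hE.2⟩
      have h := sq_eMass_le_lamP_of_mem (s := s) hp hpq' hq1 hα1.le (mul_pos hη hR) Flow
        (lt_of_lt_of_le (pow_pos (by linarith) _) hpow) Fst
        (fun E hE => hunif E (hGH E (Finset.mem_filter.1 hE).1).1)
        (fun E hE => (Finset.mem_filter.1 hE).2) hν hnon
      refine le_trans ?_ (h.trans (lamP_mono hp.le hν (Finset.filter_subset _ _)))
      rw [div_le_div_iff₀ hR (by positivity)]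
      have h4 : 4 * η ≤ (1 - α) ^ (2 * s) := by linarith
      calc _ = 4 * η * (eMass (G.filter (· ∈ F₁ I)) ν ^ 2 * R) := by ring
        _ ≤ (1 - α) ^ (2 * s) * (eMass (G.filter (· ∈ F₁ I)) ν ^ 2 * R) := by gcongr
        _ = _ := by ring
    have hb2 : 4 * eMass (G.filter (· ∉ F₁ I)) ν ^ 2 / R ≤ lamP p G ν := by
      have h := sq_eMass_le_lamP_of_notMem (G := G.filter (· ∉ F₁ I)) (s := s) hp hp1 hδ0.le hδ8
        hδs Flow' hempty' (lt_of_lt_of_le (pow_pos (by linarith) _) hpow') Fst'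
        (fun E hE => hunif E (hGH E (Finset.mem_filter.1 hE).1).1)
        (fun E hE hEF => by
          rw [Finset.mem_filter] at hE
          refine (Finset.mem_filter.1 (FJ' hEF)).2 E ?_ subset_rfl
          rw [Feq']
          exact Finset.mem_filter.2 ⟨(hGH E hE.1).1, hE.2⟩)
        (fun E hE => (hGH E (Finset.mem_filter.1 hE).1).2) hν
      rw [hn] at h
      have hmono := lamP_mono (p := p) hp.le hν (Finset.filter_subset (· ∉ F₁ I) G)
      have hΛ : 0 ≤ lamP p G ν := Finset.sum_nonneg fun L _ => by positivity
      rw [div_le_iff₀ hR]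
      have h2 := mul_le_mul_of_nonneg_left hmono (by positivity : 0 ≤ p * n)
      have h3 := mul_le_mul_of_nonneg_left hRn hΛ
      linarith [sq_nonneg (eMass (G.filter (· ∉ F₁ I)) ν)]
    have hsplit : eMass G ν = eMass (G.filter (· ∈ F₁ I)) ν + eMass (G.filter (· ∉ F₁ I)) ν :=
      (Finset.sum_filter_add_sum_filter_not G _ _).symm
    rw [div_le_iff₀ hR] at hb1 hb2
    rw [lt_div_iff₀ hR, hsplit] at hlt
    nlinarith [sq_nonneg (eMass (G.filter (· ∈ F₁ I)) ν - eMass (G.filter (· ∉ F₁ I)) ν)]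
  refine ⟨fun I hI => ⟨Finset.mem_image_of_mem _ (by simpa using hI), (main I hI).1.1⟩,
    fun ST hST => ?_, fun ST hST => ?_⟩
  all_goals
    obtain ⟨I, hI, rfl⟩ := Finset.mem_image.1 hST
    have h := main I (by simpa using hI)
  · exact h.1.2
  · exact h.2

end
end

section
/- Let s, r, n ∈ ℕ with n ≥ s and r ≥ 2, and let p, q, R, R′, η ∈ ℝ satisfy 0 < q < 1/8, 0 < p ≤ q/(2^{10}r²s²), R = 2^{−6}pn, 0 ≤ R′ ≤ R/16 and η = p⁴(q/2)^{4s}. Let 𝓕 be an (s+1)-uniform hypergraph on a vertex set U that is (p, R′)-Janson, let ℋ be an s-uniform hypergraph on an n-element vertex set V, let π : V → U satisfy |π(L)| ≥ |L|/2 for every L ⊆ V and |π(E)| = |E| for every E ∈ ℋ, and let v be a vertex not in U. Then there exists a family 𝒳 of subsets of V with |𝒳| ≤ 4·(2/q)^{4qn} such that: (1) for every I ⊆ V such that the hypergraph π_v(ℋ[I]) ∪ 𝓕 (a hypergraph on U ∪ {v}) is not (p, R′ + ηR)-Janson, there is X ∈ 𝒳 with I ⊆ X; and (2) for every X ∈ 𝒳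 with |X| ≥ n/(8r) there exists Y ⊆ X with |Y| ≥ |X| − 2^{−8}r^{−1}n such that π(ℋ[Y]) is not (p, R)-Janson. -/
open scoped Classical

noncomputable section

/-- The image hypergraph `π(𝒢) = {π(E) : E ∈ 𝒢}`. -/
def pushHG {V U : Type*} [DecidableEq U] (π : V → U) (G : Finset (Finset V)) :
    Finset (Finset U) :=
  G.image fun E => E.image π

/-- `π_v(𝒢) = {π(E) ∪ {v} : E ∈ 𝒢}`, a hypergraph on `U ∪ {v}` where the new vertex `v ∉ U`
is modelled as `none : Option U`. -/
def pushvHG {V U : Type*} [DecidableEq U] (π : V → U) (G : Finset (Finset V)) :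
    Finset (Finset (Option U)) :=
  G.image fun E => insert (none : Option U) ((E.image π).image some)

/-- A hypergraph on `U` viewed as a hypergraph on `U ∪ {v} = Option U`. -/
def liftHG {U : Type*} [DecidableEq U] (F : Finset (Finset U)) : Finset (Finset (Option U)) :=
  F.image fun E => E.image (some : U → Option U)

/-- Expectation of `g` at a `p`-random subset of `W`. -/
def bernSum {V : Type*} (p : ℝ) (W : Finset V) (g : Finset V → ℝ) : ℝ :=
  ∑ A ∈ W.powerset, p ^ A.card * (1 - p) ^ (W.card - A.card) * g A

section Bernoulli

variable {V : Type*} {p : ℝ} {W : Finset V}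

lemma bernSum_empty (g : Finset V → ℝ) : bernSum p ∅ g = g ∅ := by
  simp [bernSum]

lemma bernSum_insert {v : V} (hv : v ∉ W) (g : Finset V → ℝ) :
    bernSum p (insert v W) g =
      p * bernSum p W (fun A => g (insert v A)) + (1 - p) * bernSum p W g := by
  unfold bernSum
  rw [Finset.sum_powerset_insert hv, add_comm, Finset.mul_sum, Finset.mul_sum]
  congr 1
  · refine Finset.sum_congr rfl fun A hA => ?_
    have hvA : v ∉ A := fun h => hv (Finset.mem_powerset.1 hA h)
    rw [Finset.card_insert_of_notMem hv, Finset.card_insert_of_notMem hvA,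
      Nat.add_sub_add_right, pow_succ]
    ring
  · refine Finset.sum_congr rfl fun A hA => ?_
    have hc := Finset.card_le_card (Finset.mem_powerset.1 hA)
    rw [Finset.card_insert_of_notMem hv, Nat.sub_add_comm hc, pow_succ]
    ring

lemma bernSum_congr {g h : Finset V → ℝ} (H : ∀ A ⊆ W, g A = h A) :
    bernSum p W g = bernSum p W h :=
  Finset.sum_congr rfl fun A hA => by rw [H A (Finset.mem_powerset.1 hA)]

lemma bernSum_mono (hp0 : 0 ≤ p) (hp1 : p ≤ 1) {g h : Finset V → ℝ} (H : ∀ A ⊆ W, g A ≤ h A) :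
    bernSum p W g ≤ bernSum p W h := by
  refine Finset.sum_le_sum fun A hA => ?_
  have h1 : 0 ≤ 1 - p := by linarith
  have := H A (Finset.mem_powerset.1 hA)
  gcongr

lemma bernSum_const (c : ℝ) : bernSum p W (fun _ => c) = c := by
  induction W using Finset.induction_on with
  | empty => exact bernSum_empty _
  | insert v W hv ih => rw [bernSum_insert hv, ih]; ring

lemma bernSum_add (g h : Finset V → ℝ) :
    bernSum p W (fun A => g A + h A) = bernSum p W g + bernSum p W h := by
  simp [bernSum, mul_add, Finset.sum_add_distrib]

lemma bernSum_const_mul (c : ℝ) (g : Finset V → ℝ) :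
    bernSum p W (fun A => c * g A) = c * bernSum p W g := by
  unfold bernSum
  rw [Finset.mul_sum]
  exact Finset.sum_congr rfl fun A _ => by ring

lemma bernSum_sum {ι : Type*} (S : Finset ι) (g : ι → Finset V → ℝ) :
    bernSum p W (fun A => ∑ i ∈ S, g i A) = ∑ i ∈ S, bernSum p W (g i) := by
  unfold bernSum
  rw [Finset.sum_comm]
  exact Finset.sum_congr rfl fun A _ => by rw [Finset.mul_sum]

lemma bernSum_nonneg (hp0 : 0 ≤ p) (hp1 : p ≤ 1) {g : Finset V → ℝ} (H : ∀ A ⊆ W, 0 ≤ g A) :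
    0 ≤ bernSum p W g := by
  have := bernSum_mono hp0 hp1 (W := W) (g := fun _ => 0) H
  rwa [bernSum_const] at this

lemma bernSum_pos (hp0 : 0 ≤ p) (hp1 : p ≤ 1) {g : Finset V → ℝ} (H : ∀ A, 0 < g A) :
    0 < bernSum p W g := by
  induction W using Finset.induction_on generalizing g with
  | empty => rw [bernSum_empty]; exact H _
  | insert v W hv ih =>
    rw [bernSum_insert hv]
    have h1 := ih (g := fun A => g (insert v A)) fun A => H _
    have h2 := ih H
    rcases hp0.eq_or_lt with h | h
    · subst h; simpa using h2
    · have : 0 ≤ (1 - p) * bernSum p W g := mul_nonneg (by linarith) h2.le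
      positivity

/-- Harris' inequality for two decreasing functions. -/
lemma bernSum_mul_ge_of_antitone (hp0 : 0 ≤ p) (hp1 : p ≤ 1) {g h : Finset V → ℝ}
    (hg : Antitone g) (hh : Antitone h) :
    bernSum p W g * bernSum p W h ≤ bernSum p W (fun A => g A * h A) := by
  induction W using Finset.induction_on generalizing g h with
  | empty => simp [bernSum_empty]
  | insert v W hv ih =>
    simp only [bernSum_insert hv]
    have hi : Monotone (fun A : Finset V => insert v A) :=
      fun A B hAB => Finset.insert_subset_insert v hAB
    have h1 := ih (hg.comp_monotone hi) (hh.comp_monotone hi)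
    have h0 := ih hg hh
    have hg' : bernSum p W (fun A => g (insert v A)) ≤ bernSum p W g :=
      bernSum_mono hp0 hp1 fun A _ => hg (Finset.subset_insert v A)
    have hh' : bernSum p W (fun A => h (insert v A)) ≤ bernSum p W h :=
      bernSum_mono hp0 hp1 fun A _ => hh (Finset.subset_insert v A)
    simp only [Function.comp_def] at h1
    set g1 := bernSum p W (fun A => g (insert v A))
    set h1' := bernSum p W (fun A => h (insert v A))
    have e1 := mul_le_mul_of_nonneg_left h1 hp0
    have e2 := mul_le_mul_of_nonneg_left h0 (sub_nonneg.2 hp1)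
    have e3 := mul_nonneg (mul_nonneg hp0 (sub_nonneg.2 hp1))
      (mul_nonneg (sub_nonneg.2 hg') (sub_nonneg.2 hh'))
    nlinarith

lemma bernSum_ite_mem {v : V} (hv : v ∈ W) (g : Finset V → ℝ) :
    bernSum p W (fun A => if v ∈ A then g A else 0) =
      p * bernSum p W (fun A => g (insert v A)) := by
  obtain ⟨W', hv', rfl⟩ : ∃ W', v ∉ W' ∧ insert v W' = W :=
    ⟨W.erase v, by simp, Finset.insert_erase hv⟩
  rw [bernSum_insert hv', bernSum_insert hv']
  have : bernSum p W' (fun A => if v ∈ A then g A else 0) = 0 := by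
    rw [bernSum_congr (h := fun _ => 0), bernSum_const]
    intro A hA
    rw [if_neg fun h => hv' (hA h)]
  rw [this]
  simp only [Finset.mem_insert_self, if_true, Finset.insert_idem]
  ring

lemma bernSum_ite_subset {E : Finset V} (hE : E ⊆ W) (g : Finset V → ℝ) :
    bernSum p W (fun A => if E ⊆ A then g A else 0) =
      p ^ E.card * bernSum p W (fun A => g (A ∪ E)) := by
  induction E using Finset.induction_on generalizing g with
  | empty => simp
  | insert v E hv ih =>
    have h1 : bernSum p W (fun A => if insert v E ⊆ A then g A else 0) =
        bernSum p W (fun A => if v ∈ A then (if E ⊆ A then g A else 0) else 0) := by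
      refine bernSum_congr fun A _ => ?_
      simp only [Finset.insert_subset_iff, ite_and]
    rw [h1, bernSum_ite_mem (hE (Finset.mem_insert_self _ _))]
    have h2 : bernSum p W (fun A => if E ⊆ insert v A then g (insert v A) else 0) =
        bernSum p W (fun A => if E ⊆ A then g (insert v A) else 0) := by
      refine bernSum_congr fun A _ => ?_
      simp only [Finset.subset_insert_iff_of_notMem hv]
    rw [h2, ih (fun x hx => hE (Finset.mem_insert_of_mem hx)) (fun A => g (insert v A)),
      Finset.card_insert_of_notMem hv, pow_succ]
    simp only [Finset.union_insert]
    ring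

end Bernoulli

/-- The weighted number of edges inside `A`, each edge weighted by `ν E / p ^ |E|`. -/
def edgeCount {V : Type*} (p : ℝ) (G : Finset (Finset V)) (ν : Finset V → ℝ) (A : Finset V) : ℝ :=
  ∑ E ∈ G, if E ⊆ A then ν E / p ^ E.card else 0

section Janson

variable {V : Type*} {p : ℝ} {W : Finset V} {G : Finset (Finset V)} {ν : Finset V → ℝ}

lemma edgeCount_mono (hp : 0 ≤ p) (hν : ∀ E, 0 ≤ ν E) : Monotone (edgeCount p G ν) := by
  intro A B hAB
  refine Finset.sum_le_sum fun E _ => ?_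
  have : 0 ≤ ν E / p ^ E.card := div_nonneg (hν E) (by positivity)
  split_ifs with h1 h2 h2
  · rfl
  · exact absurd (h1.trans hAB) h2
  · exact this
  · rfl

lemma edgeCount_union_le (hp : 0 ≤ p) (hν : ∀ E, 0 ≤ ν E) (A E : Finset V) :
    edgeCount p G ν (A ∪ E) ≤ edgeCount p G ν A +
      edgeCount p (G.filter fun E' => ¬ Disjoint E' E) ν (A ∪ E) := by
  unfold edgeCount
  rw [Finset.sum_filter, ← Finset.sum_add_distrib]
  refine Finset.sum_le_sum fun E' _ => ?_
  have h0 : 0 ≤ ν E' / p ^ E'.card := div_nonneg (hν E') (by positivity)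
  by_cases hd : Disjoint E' E
  · have h : E' ⊆ A ∪ E ↔ E' ⊆ A :=
      ⟨fun h x hx => (Finset.mem_union.1 (h hx)).resolve_right (Finset.disjoint_left.1 hd hx),
        fun h => h.trans Finset.subset_union_left⟩
    simp [hd, h]
  · simp only [hd, not_false_eq_true, if_true]
    split_ifs <;> simp [h0]

lemma bernSum_edgeCount_union (hp : 0 < p) (hG : ∀ E ∈ G, E ⊆ W) (E : Finset V) :
    bernSum p W (fun A => edgeCount p G ν (A ∪ E)) =
      ∑ E' ∈ G, ν E' / p ^ (E' ∩ E).card := by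
  unfold edgeCount
  rw [bernSum_sum]
  refine Finset.sum_congr rfl fun E' hE' => ?_
  have h1 : bernSum p W (fun A => if E' ⊆ A ∪ E then ν E' / p ^ E'.card else 0) =
      bernSum p W (fun A => if E' \ E ⊆ A then ν E' / p ^ E'.card else 0) := by
    refine bernSum_congr fun A _ => ?_
    have : E' ⊆ A ∪ E ↔ E' \ E ⊆ A := by
      rw [Finset.union_comm]; exact sdiff_le_iff.symm
    simp only [this]
  rw [h1, bernSum_ite_subset (Finset.sdiff_subset.trans (hG E' hE')), bernSum_const,
    ← Finset.card_sdiff_add_card_inter E' E, pow_add]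
  have : p ^ (E' \ E).card ≠ 0 := by positivity
  field_simp

lemma hasDerivAt_bernSum_exp (f : Finset V → ℝ) (t : ℝ) :
    HasDerivAt (fun t => bernSum p W fun A => Real.exp (-t * f A))
      (bernSum p W fun A => -(f A * Real.exp (-t * f A))) t := by
  unfold bernSum
  refine HasDerivAt.fun_sum fun A _ => HasDerivAt.const_mul _ ?_
  have h := ((hasDerivAt_neg t).mul_const (f A)).exp
  exact h.congr_deriv (by ring)

lemma bernSum_edgeCount_mul_exp_ge (hp : 0 < p) (hp1 : p ≤ 1) (hG : ∀ E ∈ G, E ⊆ W)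
    (hν : ∀ E, 0 ≤ ν E) (hν1 : ∑ E ∈ G, ν E = 1) {Δ : ℝ}
    (hΔ : ∑ E ∈ G, ∑ E' ∈ G.filter (fun E' => ¬ Disjoint E' E),
      ν E * ν E' / p ^ (E' ∩ E).card ≤ Δ) {t : ℝ} (ht : 0 ≤ t) :
    bernSum p W (fun A => Real.exp (-t * edgeCount p G ν A)) * (1 - t * Δ) ≤
      bernSum p W (fun A => edgeCount p G ν A * Real.exp (-t * edgeCount p G ν A)) := by
  set f := edgeCount p G ν with hf
  set g := bernSum p W (fun A => Real.exp (-t * f A)) with hg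
  have hg0 : 0 ≤ g := bernSum_nonneg hp.le hp1 fun A _ => (Real.exp_pos _).le
  have hfm : Monotone f := edgeCount_mono hp.le hν
  have h1 : bernSum p W (fun A => f A * Real.exp (-t * f A)) =
      ∑ E ∈ G, ν E * bernSum p W (fun A => Real.exp (-t * f (A ∪ E))) := by
    have : (fun A => f A * Real.exp (-t * f A)) = fun A => ∑ E ∈ G,
        ν E / p ^ E.card * (if E ⊆ A then Real.exp (-t * f A) else 0) := by
      funext A
      nth_rewrite 1 [hf]
      unfold edgeCount
      rw [Finset.sum_mul]
      exact Finset.sum_congr rfl fun E _ => by split_ifs <;> simp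
    rw [this, bernSum_sum]
    refine Finset.sum_congr rfl fun E hE => ?_
    rw [bernSum_const_mul, bernSum_ite_subset (hG E hE) fun A => Real.exp (-t * f A)]
    have : p ^ E.card ≠ 0 := by positivity
    field_simp
  have h2 : ∀ E ∈ G, g * (1 - t * ∑ E' ∈ G.filter (fun E' => ¬ Disjoint E' E),
      ν E' / p ^ (E' ∩ E).card) ≤ bernSum p W (fun A => Real.exp (-t * f (A ∪ E))) := by
    intro E hE
    set fE := edgeCount p (G.filter fun E' => ¬ Disjoint E' E) ν with hfE
    have hfEm : Monotone fE := edgeCount_mono hp.le hν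
    calc _ = g * bernSum p W (fun A => 1 + -t * fE (A ∪ E)) := by
          rw [bernSum_add, bernSum_const, bernSum_const_mul, hfE,
            bernSum_edgeCount_union hp fun E' hE' => hG E' (Finset.mem_filter.1 hE').1]
          ring
      _ ≤ g * bernSum p W (fun A => Real.exp (-t * fE (A ∪ E))) := by
          refine mul_le_mul_of_nonneg_left (bernSum_mono hp.le hp1 fun A _ => ?_) hg0
          have := Real.add_one_le_exp (-t * fE (A ∪ E))
          linarith
      _ ≤ bernSum p W (fun A => Real.exp (-t * f A) * Real.exp (-t * fE (A ∪ E))) := by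
          refine bernSum_mul_ge_of_antitone hp.le hp1 ?_ ?_
          · intro A B hAB
            have := mul_le_mul_of_nonneg_left (hfm hAB) ht
            exact Real.exp_le_exp.2 (by linarith)
          · intro A B hAB
            have := mul_le_mul_of_nonneg_left
              (hfEm (Finset.union_subset_union_left hAB (t := E))) ht
            exact Real.exp_le_exp.2 (by linarith)
      _ ≤ _ := by
          refine bernSum_mono hp.le hp1 fun A _ => ?_
          rw [← Real.exp_add]
          have := mul_le_mul_of_nonneg_left
            (edgeCount_union_le (G := G) hp.le hν A E) ht
          exact Real.exp_le_exp.2 (by simp only [hf, hfE]; linarith)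
  rw [h1]
  calc g * (1 - t * Δ) ≤ g * (1 - t * ∑ E ∈ G, ∑ E' ∈ G.filter (fun E' => ¬ Disjoint E' E),
          ν E * ν E' / p ^ (E' ∩ E).card) := by
        have := mul_le_mul_of_nonneg_left hΔ ht
        exact mul_le_mul_of_nonneg_left (by linarith) hg0
    _ = ∑ E ∈ G, ν E * (g * (1 - t * ∑ E' ∈ G.filter (fun E' => ¬ Disjoint E' E),
          ν E' / p ^ (E' ∩ E).card)) := by
        nth_rewrite 1 [← hν1]
        rw [Finset.mul_sum, ← Finset.sum_sub_distrib, Finset.mul_sum]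
        refine Finset.sum_congr rfl fun E _ => ?_
        simp only [mul_div_assoc, ← Finset.mul_sum]
        ring
    _ ≤ _ := Finset.sum_le_sum fun E hE => mul_le_mul_of_nonneg_left (h2 E hE) (hν E)

/-- The exponential-moment form of Janson's inequality. -/
lemma bernSum_exp_edgeCount_le (hp : 0 < p) (hp1 : p ≤ 1) (hG : ∀ E ∈ G, E ⊆ W)
    (hν : ∀ E, 0 ≤ ν E) (hν1 : ∑ E ∈ G, ν E = 1) {Δ : ℝ}
    (hΔ : ∑ E ∈ G, ∑ E' ∈ G.filter (fun E' => ¬ Disjoint E' E),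
      ν E * ν E' / p ^ (E' ∩ E).card ≤ Δ) {t : ℝ} (ht : 0 ≤ t) :
    bernSum p W (fun A => Real.exp (-t * edgeCount p G ν A)) ≤ Real.exp (-t + t ^ 2 * Δ / 2) := by
  set f := edgeCount p G ν with hf
  set F : ℝ → ℝ := fun t => bernSum p W (fun A => Real.exp (-t * f A)) *
    Real.exp (t - t ^ 2 * Δ / 2) with hF
  have hd : ∀ x, HasDerivAt F (bernSum p W (fun A => -(f A * Real.exp (-x * f A))) *
      Real.exp (x - x ^ 2 * Δ / 2) + bernSum p W (fun A => Real.exp (-x * f A)) *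
      (Real.exp (x - x ^ 2 * Δ / 2) * (1 - x * Δ))) x := by
    intro x
    refine (hasDerivAt_bernSum_exp f x).mul ?_
    have h := ((hasDerivAt_id' x).sub (((hasDerivAt_pow 2 x).mul_const Δ).div_const 2)).exp
    exact h.congr_deriv (by simp only [Pi.sub_apply]; norm_num; ring)
  have hanti : AntitoneOn F (Set.Ici 0) := by
    refine antitoneOn_of_deriv_nonpos (convex_Ici 0)
      (fun x _ => (hd x).continuousAt.continuousWithinAt)
      (fun x _ => (hd x).differentiableAt.differentiableWithinAt) fun x hx => ?_
    rw [interior_Ici] at hx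
    rw [(hd x).deriv]
    have h1 := bernSum_edgeCount_mul_exp_ge hp hp1 hG hν hν1 hΔ (le_of_lt hx)
    have h2 : bernSum p W (fun A => -(f A * Real.exp (-x * f A))) =
        - bernSum p W (fun A => f A * Real.exp (-x * f A)) := by
      rw [neg_eq_neg_one_mul (bernSum _ _ _), ← bernSum_const_mul]
      simp
    rw [h2]
    have := mul_le_mul_of_nonneg_right h1 (Real.exp_pos (x - x ^ 2 * Δ / 2)).le
    linarith
  have h := hanti (Set.mem_Ici.2 le_rfl) (Set.mem_Ici.2 ht) ht
  simp only [hF] at h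
  have h3 : bernSum p W (fun A => Real.exp (-0 * f A)) = 1 := by
    simp [bernSum_const]
  rw [h3] at h
  have h4 : Real.exp (-t + t ^ 2 * Δ / 2) * Real.exp (t - t ^ 2 * Δ / 2) = 1 := by
    rw [← Real.exp_add]; simp
  have h5 := Real.exp_pos (t - t ^ 2 * Δ / 2)
  refine le_of_mul_le_mul_right ?_ h5
  rw [h4]
  simpa using h

end Janson

section Entropy

lemma negMulLog_add_sub_le {a b : ℝ} (ha : 0 < a) (hb : 0 ≤ b) :
    Real.negMulLog a + Real.negMulLog b - Real.negMulLog (a + b) ≤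
      a * (1 + Real.log ((a + b) / a)) := by
  unfold Real.negMulLog
  have hab : 0 < a + b := by linarith
  rw [Real.log_div hab.ne' ha.ne']
  rcases hb.eq_or_lt with rfl | hb
  · simp only [add_zero, zero_mul, neg_zero, sub_self, mul_one]
    linarith
  · have h := Real.log_le_sub_one_of_pos (div_pos hab hb)
    rw [Real.log_div hab.ne' hb.ne'] at h
    have h2 := mul_le_mul_of_nonneg_left h hb.le
    have h3 : b * ((a + b) / b - 1) = a := by field_simp; ring
    rw [h3] at h2
    linarith

lemma mul_one_add_log_div_le {q a m : ℝ} (hq0 : 0 < q) (hq1 : q ≤ 1) (hm : 0 < m) (ha : 0 < a)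
    (haq : a ≤ q * m) :
    a * (1 + Real.log (m / a)) ≤ m * (q * (Real.log (1 / q) + 1)) := by
  have h := Real.log_le_sub_one_of_pos (div_pos (mul_pos hq0 hm) ha)
  have h1 : Real.log (m / a) = Real.log (q * m / a) + Real.log (1 / q) := by
    rw [← Real.log_mul (by positivity) (by positivity)]
    congr 1
    field_simp
  have h2 := mul_le_mul_of_nonneg_left h ha.le
  have h3 : a * (q * m / a - 1) = q * m - a := by field_simp
  rw [h1]
  rw [h3] at h2
  have := mul_le_mul_of_nonneg_right haq (Real.log_nonneg ((one_le_div hq0).2 hq1))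
  nlinarith

end Entropy

section Induction

variable {V : Type*}

/-- The members of `L` whose trace on `T` is `S`. -/
def slice (L : Finset (Finset V)) (T S : Finset V) : Finset (Finset V) :=
  L.filter fun I => I ∩ T = S

/-- The entropy-type potential of a slice. -/
def slicePot (M b : ℝ) (L : Finset (Finset V)) (T S : Finset V) : ℝ :=
  (slice L T S).card * (M - b * T.card) + Real.negMulLog (slice L T S).card

/-- The weighted count of edges compatible with `A` outside `l` and with `I` inside `l`. -/
def liveWeight (p q : ℝ) (G : Finset (Finset V)) (ν : Finset V → ℝ) (l I A : Finset V) : ℝ :=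
  ∑ E ∈ G, if E \ l ⊆ A ∧ E ∩ l ⊆ I then ν E / p ^ E.card * (p / q) ^ (E ∩ l).card else 0

/-- Logarithm of the moment generating function, conditioned on `A`. -/
def logMGF (p τ : ℝ) (f : Finset V → ℝ) (l A : Finset V) : ℝ :=
  Real.log (bernSum p l fun B => Real.exp (-τ * f (A ∪ B)))

lemma mem_slice {L : Finset (Finset V)} {T S I : Finset V} :
    I ∈ slice L T S ↔ I ∈ L ∧ I ∩ T = S := by
  simp [slice]

lemma slice_insert_insert {L : Finset (Finset V)} {T S : Finset V} {v : V} (hv : v ∉ T)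
    (hST : S ⊆ T) :
    slice L (insert v T) (insert v S) = (slice L T S).filter fun I => v ∈ I := by
  ext I
  simp only [mem_slice, Finset.mem_filter, and_assoc, and_congr_right_iff]
  intro _
  constructor
  · intro h
    have hvI : v ∈ I := (Finset.mem_inter.1 (h ▸ Finset.mem_insert_self v S)).1
    refine ⟨?_, hvI⟩
    rw [Finset.inter_insert_of_mem hvI] at h
    have h2 := congrArg (fun X => X.erase v) h
    rwa [Finset.erase_insert fun h' => hv (Finset.mem_inter.1 h').2,
      Finset.erase_insert fun h' => hv (hST h')] at h2
  · rintro ⟨h, hvI⟩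
    rw [Finset.inter_insert_of_mem hvI, h]

lemma slice_insert {L : Finset (Finset V)} {T S : Finset V} {v : V} (hv : v ∉ T)
    (hST : S ⊆ T) :
    slice L (insert v T) S = (slice L T S).filter fun I => ¬ v ∈ I := by
  ext I
  simp only [mem_slice, Finset.mem_filter, and_assoc, and_congr_right_iff]
  intro _
  constructor
  · intro h
    have hvI : v ∉ I := fun hvI =>
      hv (hST (h ▸ Finset.mem_inter.2 ⟨hvI, Finset.mem_insert_self v T⟩))
    rw [Finset.inter_insert_of_notMem hvI] at h
    exact ⟨h, hvI⟩
  · rintro ⟨h, hvI⟩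
    rw [Finset.inter_insert_of_notMem hvI, h]

lemma liveWeight_insert_ge {p q : ℝ} (hp : 0 < p) (hq : 0 < q) {G : Finset (Finset V)}
    {ν : Finset V → ℝ} (hν : ∀ E, 0 ≤ ν E) {l I A : Finset V} {v : V} (hvl : v ∉ l) (hvA : v ∉ A)
    {θ : ℝ} (hθ0 : 0 ≤ θ) (hθ : θ ≤ p / q) (hvI : v ∈ I ∨ θ = 0) :
    θ * liveWeight p q G ν l I (insert v A) + (1 - θ) * liveWeight p q G ν l I A ≤
      liveWeight p q G ν (insert v l) I A := by
  unfold liveWeight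
  rw [Finset.mul_sum, Finset.mul_sum, ← Finset.sum_add_distrib]
  refine Finset.sum_le_sum fun E _ => ?_
  have hw : 0 ≤ ν E / p ^ E.card := div_nonneg (hν E) (by positivity)
  set w := ν E / p ^ E.card
  have hk : 0 ≤ (p / q) ^ (E ∩ l).card := by positivity
  by_cases hvE : v ∈ E
  · have h1 : ¬ (E \ l ⊆ A) := fun h => hvA (h (Finset.mem_sdiff.2 ⟨hvE, hvl⟩))
    have h2 : E \ l ⊆ insert v A ↔ E \ insert v l ⊆ A := by
      simp only [Finset.subset_iff, Finset.mem_sdiff, Finset.mem_insert]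
      grind
    have h3 : E ∩ insert v l = insert v (E ∩ l) := Finset.inter_insert_of_mem hvE
    have h4 : v ∉ E ∩ l := fun h => hvl (Finset.mem_inter.1 h).2
    simp only [h1, false_and, if_false, mul_zero, add_zero, h2, h3, Finset.insert_subset_iff,
      Finset.card_insert_of_notMem h4, pow_succ]
    rcases hvI with hvI | rfl
    · simp only [hvI, true_and]
      split_ifs
      · have := mul_le_mul_of_nonneg_right hθ (mul_nonneg hw hk)
        linarith
      · simp
    · rw [zero_mul]
      split_ifs
      · positivity
      · rfl
  · have h2 : E \ l ⊆ insert v A ↔ E \ l ⊆ A :=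
      Finset.subset_insert_iff_of_notMem fun h => hvE (Finset.mem_sdiff.1 h).1
    have h3 : E ∩ insert v l = E ∩ l := Finset.inter_insert_of_notMem hvE
    have h5 : E \ insert v l = E \ l := by
      rw [Finset.sdiff_insert]
      exact Finset.erase_eq_of_notMem fun h => hvE (Finset.mem_sdiff.1 h).1
    simp only [h2, h3, h5]
    apply le_of_eq
    ring

lemma bernSum_insert_exp {p τ : ℝ} {f : Finset V → ℝ} {l A : Finset V} {v : V} (hv : v ∉ l) :
    bernSum p (insert v l) (fun B => Real.exp (-τ * f (A ∪ B))) =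
      p * bernSum p l (fun B => Real.exp (-τ * f (insert v A ∪ B))) +
        (1 - p) * bernSum p l (fun B => Real.exp (-τ * f (A ∪ B))) := by
  rw [bernSum_insert hv]
  simp only [Finset.union_insert, Finset.insert_union]

lemma logMGF_insert_ge_convex {p τ : ℝ} (hp0 : 0 ≤ p) (hp1 : p ≤ 1) {f : Finset V → ℝ}
    {l A : Finset V} {v : V} (hv : v ∉ l) :
    p * logMGF p τ f l (insert v A) + (1 - p) * logMGF p τ f l A ≤ logMGF p τ f (insert v l) A := by
  unfold logMGF
  rw [bernSum_insert_exp hv]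
  exact strictConcaveOn_log_Ioi.concaveOn.2
    (Set.mem_Ioi.2 (bernSum_pos hp0 hp1 fun _ => Real.exp_pos _))
    (Set.mem_Ioi.2 (bernSum_pos hp0 hp1 fun _ => Real.exp_pos _)) hp0 (sub_nonneg.2 hp1)
    (by ring)

lemma logMGF_insert_ge {p τ : ℝ} (hp0 : 0 ≤ p) (hp1 : p < 1) {f : Finset V → ℝ}
    {l A : Finset V} {v : V} (hv : v ∉ l) :
    Real.log (1 - p) + logMGF p τ f l A ≤ logMGF p τ f (insert v l) A := by
  unfold logMGF
  have h1 := bernSum_pos (W := l) hp0 hp1.le fun B => Real.exp_pos (-τ * f (insert v A ∪ B))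
  have h2 := bernSum_pos (W := l) hp0 hp1.le fun B => Real.exp_pos (-τ * f (A ∪ B))
  have hp : 0 < 1 - p := sub_pos.2 hp1
  rw [bernSum_insert_exp hv, ← Real.log_mul hp.ne' h2.ne']
  exact Real.log_le_log (by positivity) (le_add_of_nonneg_left (by positivity))

set_option maxHeartbeats 1000000 in
/-- The potential of a slice dominates the conditional log-moment generating function, up to the
expected count of live edges and an entropy loss. -/
lemma slicePot_ge {p q τ b c M : ℝ} (hp0 : 0 < p) (hpq : p ≤ q) (hq1 : q ≤ 1) (hp1 : p < 1)
    (hτ : 0 ≤ τ) (hb : 0 ≤ b) (hc : 0 ≤ c)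
    (hbc : c * (-Real.log (1 - p)) + q * (Real.log (1 / q) + 1) ≤ b)
    {G : Finset (Finset V)} {ν : Finset V → ℝ} (hν : ∀ E, 0 ≤ ν E) (L : Finset (Finset V))
    (hY : ∀ T S, 0 ≤ slicePot M b L T S) (l : Finset V) :
    ∀ T S A : Finset V, Disjoint A l → S ⊆ T → (∀ u ∈ l, u ∈ T → u ∈ S) →
      (slice L T S).card * c * (-logMGF p τ (edgeCount p G ν) l A) -
        c * τ * ∑ I ∈ slice L T S, liveWeight p q G ν l I A -
        (slice L T S).card * p * l.card * (Real.log (1 / q) + 1) ≤ slicePot M b L T S := by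
  have hq0 : 0 < q := hp0.trans_le hpq
  have hℓ : 0 ≤ Real.log (1 / q) := Real.log_nonneg ((one_le_div hq0).2 hq1)
  induction l using Finset.induction_on with
  | empty =>
    intro T S A _ _ _
    have h1 : logMGF p τ (edgeCount p G ν) ∅ A = -τ * edgeCount p G ν A := by
      simp [logMGF, bernSum_empty]
    have h2 : ∀ I, liveWeight p q G ν ∅ I A = edgeCount p G ν A := by
      intro I
      simp [liveWeight, edgeCount]
    simp only [h1, h2, Finset.sum_const, nsmul_eq_mul, Finset.card_empty, Nat.cast_zero]
    have := hY T S
    linarith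
  | insert v l hv ih =>
    intro T S A hAl hST hTS
    obtain ⟨hvA, hAl'⟩ : v ∉ A ∧ Disjoint A l := Finset.disjoint_insert_right.1 hAl
    have hAv : Disjoint (insert v A) l := Finset.disjoint_insert_left.2 ⟨hv, hAl'⟩
    have hTS' : ∀ u ∈ l, u ∈ T → u ∈ S := fun u hu => hTS u (Finset.mem_insert_of_mem hu)
    have hJ := logMGF_insert_ge_convex (τ := τ) (f := edgeCount p G ν) (A := A) hp0.le hp1.le hv
    have hL := logMGF_insert_ge (τ := τ) (f := edgeCount p G ν) (A := A) hp0.le hp1 hv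
    have i0 := ih T S A hAl' hST hTS'
    set Φ := logMGF p τ (edgeCount p G ν) (insert v l) A
    set Φ0 := logMGF p τ (edgeCount p G ν) l A with hΦ0
    set Φ1 := logMGF p τ (edgeCount p G ν) l (insert v A) with hΦ1
    rw [Finset.card_insert_of_notMem hv]
    push_cast
    have hcτ : 0 ≤ c * τ := mul_nonneg hc hτ
    have hppq : p ≤ p / q := le_div_self hp0.le hq0 hq1
    by_cases hvT : v ∈ T
    · have i1 := ih T S (insert v A) hAv hST hTS'
      have hvS := hTS v (Finset.mem_insert_self _ _) hvT
      have hK : p * ∑ I ∈ slice L T S, liveWeight p q G ν l I (insert v A) +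
          (1 - p) * ∑ I ∈ slice L T S, liveWeight p q G ν l I A ≤
          ∑ I ∈ slice L T S, liveWeight p q G ν (insert v l) I A := by
        rw [Finset.mul_sum, Finset.mul_sum, ← Finset.sum_add_distrib]
        refine Finset.sum_le_sum fun I hI => liveWeight_insert_ge hp0 hq0 hν hv hvA hp0.le hppq ?_
        left
        exact (Finset.mem_inter.1 ((mem_slice.1 hI).2.symm ▸ hvS)).1
      set K := ∑ I ∈ slice L T S, liveWeight p q G ν (insert v l) I A
      set K0 := ∑ I ∈ slice L T S, liveWeight p q G ν l I A
      set K1 := ∑ I ∈ slice L T S, liveWeight p q G ν l I (insert v A)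
      set m : ℝ := ((slice L T S).card : ℝ)
      have hm : 0 ≤ m := Nat.cast_nonneg _
      have e1 := mul_le_mul_of_nonneg_left hJ (mul_nonneg hm hc)
      have e2 := mul_le_mul_of_nonneg_left hK hcτ
      have e3 := mul_le_mul_of_nonneg_left i1 hp0.le
      have e4 := mul_le_mul_of_nonneg_left i0 (sub_nonneg.2 hp1.le)
      have e5 : 0 ≤ m * p * (Real.log (1 / q) + 1) := by positivity
      linear_combination e1 + e2 + e3 + e4 + e5
    · by_cases hemp : slice L T S = ∅
      · have := hY T S
        simpa [hemp] using this
      have hm : 0 < ((slice L T S).card : ℝ) :=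
        Nat.cast_pos.2 (Finset.card_pos.2 (Finset.nonempty_iff_ne_empty.2 hemp))
      have hvl' : ∀ u ∈ l, u ∈ insert v T → u ∈ T := fun u hu h =>
        (Finset.mem_insert.1 h).resolve_left (ne_of_mem_of_not_mem hu hv)
      have j0 : ∀ A', Disjoint A' l → _ := fun A' hA' => ih (insert v T) S A' hA'
        (hST.trans (Finset.subset_insert _ _)) fun u hu h => hTS' u hu (hvl' u hu h)
      have j1 : ∀ A', Disjoint A' l → _ := fun A' hA' => ih (insert v T) (insert v S) A' hA'
        (Finset.insert_subset_insert _ hST) fun u hu h =>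
          Finset.mem_insert_of_mem (hTS' u hu (hvl' u hu h))
      have hcard : ((slice L T S).card : ℝ) = (slice L (insert v T) (insert v S)).card +
          (slice L (insert v T) S).card := by
        rw [slice_insert_insert hvT hST, slice_insert hvT hST]
        exact_mod_cast (Finset.card_filter_add_card_filter_not _).symm
      have hsum : ∀ g : Finset V → ℝ, ∑ I ∈ slice L T S, g I =
          ∑ I ∈ slice L (insert v T) (insert v S), g I + ∑ I ∈ slice L (insert v T) S, g I := by
        intro g
        rw [slice_insert_insert hvT hST, slice_insert hvT hST]
        exact (Finset.sum_filter_add_sum_filter_not _ _ _).symm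
      have hmem : ∀ I ∈ slice L (insert v T) (insert v S), v ∈ I := by
        intro I hI
        rw [slice_insert_insert hvT hST] at hI
        exact (Finset.mem_filter.1 hI).2
      have hKle : ∀ I : Finset V, liveWeight p q G ν l I A ≤ liveWeight p q G ν (insert v l) I A := by
        intro I
        have := liveWeight_insert_ge hp0 hq0 hν hv hvA (G := G) (I := I) le_rfl
          (div_nonneg hp0.le hq0.le) (Or.inr rfl)
        linarith
      have hK00 : ∑ I ∈ slice L (insert v T) S, liveWeight p q G ν l I A ≤
          ∑ I ∈ slice L (insert v T) S, liveWeight p q G ν (insert v l) I A :=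
        Finset.sum_le_sum fun I _ => hKle I
      have hK10 : ∑ I ∈ slice L (insert v T) (insert v S), liveWeight p q G ν l I A ≤
          ∑ I ∈ slice L (insert v T) (insert v S), liveWeight p q G ν (insert v l) I A :=
        Finset.sum_le_sum fun I _ => hKle I
      have hK11 : ∀ θ : ℝ, 0 ≤ θ → θ ≤ p / q →
          θ * ∑ I ∈ slice L (insert v T) (insert v S), liveWeight p q G ν l I (insert v A) +
          (1 - θ) * ∑ I ∈ slice L (insert v T) (insert v S), liveWeight p q G ν l I A ≤
          ∑ I ∈ slice L (insert v T) (insert v S), liveWeight p q G ν (insert v l) I A := by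
        intro θ h0 h1
        rw [Finset.mul_sum, Finset.mul_sum, ← Finset.sum_add_distrib]
        exact Finset.sum_le_sum fun I hI =>
          liveWeight_insert_ge hp0 hq0 hν hv hvA h0 h1 (Or.inl (hmem I hI))
      have j00 := j0 A hAl'
      have j10 := j1 A hAl'
      have j11 := j1 (insert v A) hAv
      rw [← hΦ0] at j00 j10
      rw [← hΦ1] at j11
      clear j0 j1 hKle hmem ih
      rw [hsum] at i0 ⊢
      clear hsum
      have hYTS : slicePot M b L T S = slicePot M b L (insert v T) (insert v S) +
          slicePot M b L (insert v T) S + b * (slice L T S).card -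
          (Real.negMulLog (slice L (insert v T) (insert v S)).card +
            Real.negMulLog (slice L (insert v T) S).card - Real.negMulLog (slice L T S).card) := by
        unfold slicePot
        rw [Finset.card_insert_of_notMem hvT, hcard]
        push_cast
        ring
      have hY0 := hY T S
      set K1 := ∑ I ∈ slice L (insert v T) (insert v S), liveWeight p q G ν (insert v l) I A
      set K0 := ∑ I ∈ slice L (insert v T) S, liveWeight p q G ν (insert v l) I A
      set K10 := ∑ I ∈ slice L (insert v T) (insert v S), liveWeight p q G ν l I A
      set K11 := ∑ I ∈ slice L (insert v T) (insert v S), liveWeight p q G ν l I (insert v A)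
      set K00 := ∑ I ∈ slice L (insert v T) S, liveWeight p q G ν l I A
      set m : ℝ := ((slice L T S).card : ℝ)
      set m1 : ℝ := ((slice L (insert v T) (insert v S)).card : ℝ)
      set m0 : ℝ := ((slice L (insert v T) S).card : ℝ)
      set Y := slicePot M b L T S
      set Y1 := slicePot M b L (insert v T) (insert v S)
      set Y0 := slicePot M b L (insert v T) S
      set ℓ := Real.log (1 / q)
      set k : ℝ := (l.card : ℝ)
      have hm1 : 0 ≤ m1 := Nat.cast_nonneg _
      have hm0 : 0 ≤ m0 := Nat.cast_nonneg _
      have hk : 0 ≤ k := Nat.cast_nonneg _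
      by_cases hqm : q * m ≤ m1
      · have hm1' : 0 < m1 := (mul_pos hq0 hm).trans_le hqm
        have hent := negMulLog_add_sub_le hm1' hm0
        rw [← hcard] at hent
        have hlog : Real.log (m / m1) ≤ ℓ := by
          refine Real.log_le_log (by positivity) ?_
          rw [div_le_div_iff₀ hm1' hq0]
          linarith
        set θ := p * m / m1 with hθ
        have hθm : θ * m1 = p * m := by rw [hθ]; field_simp
        have hθ0 : 0 ≤ θ := by positivity
        have hθ1 : θ ≤ p / q := by
          rw [hθ, div_le_div_iff₀ hm1' hq0]
          have := mul_le_mul_of_nonneg_left hqm hp0.le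
          linarith
        have hθ1' : θ ≤ 1 := hθ1.trans ((div_le_one hq0).2 hpq)
        have hK := hK11 θ hθ0 hθ1
        have e1 := mul_le_mul_of_nonneg_left j11 hθ0
        have e2 := mul_le_mul_of_nonneg_left j00 hθ0
        have e3 := mul_le_mul_of_nonneg_left i0 (sub_nonneg.2 hθ1')
        have e4 : θ * (m1 * (1 + Real.log (m / m1))) ≤ p * m * (ℓ + 1) := by
          rw [← mul_assoc, hθm]
          have : 0 ≤ p * m := by positivity
          nlinarith
        have e5 := mul_le_mul_of_nonneg_left hent hθ0
        have e6 := mul_le_mul_of_nonneg_left hK hcτ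
        have e7 := mul_le_mul_of_nonneg_left hK00 hcτ
        have e8 := mul_le_mul_of_nonneg_left hJ (mul_nonneg hm.le hc)
        have e9 : 0 ≤ θ * (b * m) := by positivity
        linear_combination e1 + e2 + e3 + e4 + e5 + e6 + e7 + e8 + e9 - θ * hYTS +
          c * (Φ1 - Φ0) * hθm - θ * (c * Φ0 + p * k * (ℓ + 1)) * hcard
      · push Not at hqm
        have hent : Real.negMulLog m1 + Real.negMulLog m0 - Real.negMulLog (m1 + m0) ≤
            m * (q * (ℓ + 1)) := by
          rcases hm1.eq_or_lt with h | h
          · rw [← h]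
            simp only [Real.negMulLog_zero, zero_add, sub_self]
            positivity
          · refine (negMulLog_add_sub_le h hm0).trans ?_
            rw [← hcard]
            exact mul_one_add_log_div_le hq0 hq1 hm h hqm.le
        rw [← hcard] at hent
        have e1 := mul_le_mul_of_nonneg_left hL (mul_nonneg hm.le hc)
        have e2 := mul_le_mul_of_nonneg_left hbc hm.le
        have e6 := mul_le_mul_of_nonneg_left hK10 hcτ
        have e7 := mul_le_mul_of_nonneg_left hK00 hcτ
        have e8 : 0 ≤ m * p * (ℓ + 1) := by positivity
        linear_combination j10 + j00 + hent + e1 + e2 + e6 + e7 + e8 - hYTS -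
          (c * Φ0 + p * k * (ℓ + 1)) * hcard

end Induction

section Cover

variable {V : Type*}

/-- A nonempty family either has a large subfamily contained in one set satisfying `P`, or some set
carries a spread measure with few edges inside members of the family. -/
lemma exists_set_capturing [Fintype V] {p q τ b c κ Δ : ℝ} {s : ℕ} (hp0 : 0 < p) (hpq : p ≤ q) (hq1 : q ≤ 1)
    (hp1 : p < 1) (hτ : 0 ≤ τ) (hb : 0 ≤ b) (hc : 0 ≤ c)
    (hbc : c * (-Real.log (1 - p)) + q * (Real.log (1 / q) + 1) ≤ b)
    (hnum : p * Fintype.card V * (Real.log (1 / q) + 1) <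
      c * (τ - τ ^ 2 * Δ / 2) - c * τ * (κ / q ^ s))
    (L : Finset (Finset V)) (hL : L.Nonempty) (P : Finset V → Prop)
    (hP : ∀ C, ¬ P C → ∃ (G : Finset (Finset V)) (ν : Finset V → ℝ), (∀ E, 0 ≤ ν E) ∧
      (∀ E ∈ G, E ⊆ C ∧ E.card = s) ∧ ∑ E ∈ G, ν E = 1 ∧
      ∑ E ∈ G, ∑ E' ∈ G.filter (fun E' => ¬ Disjoint E' E),
        ν E * ν E' / p ^ (E' ∩ E).card ≤ Δ ∧
      ∀ I ∈ L, ∑ E ∈ G.filter (fun E => E ⊆ I), ν E ≤ κ) :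
    ∃ C, P C ∧ L.card * Real.exp (-(b * Fintype.card V)) ≤ (L.filter fun I => I ⊆ C).card := by
  have hq0 : 0 < q := hp0.trans_le hpq
  have hℓ : 0 ≤ Real.log (1 / q) := Real.log_nonneg ((one_le_div hq0).2 hq1)
  obtain ⟨⟨T, S⟩, -, hmax⟩ := Finset.exists_max_image
    (Finset.univ : Finset (Finset V × Finset V))
    (fun x => ((slice L x.1 x.2).card : ℝ) * Real.exp (b * x.1.card)) ⟨(∅, ∅), Finset.mem_univ _⟩
  simp only [Finset.mem_univ, forall_const, Prod.forall] at hmax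
  set m : ℝ := ((slice L T S).card : ℝ) with hm
  have hLm : (L.card : ℝ) ≤ m * Real.exp (b * T.card) := by
    have := hmax ∅ ∅
    simpa [slice] using this
  have hL0 : 0 < (L.card : ℝ) := Nat.cast_pos.2 hL.card_pos
  have hm0 : 0 < m := by
    have := hL0.trans_le hLm
    exact pos_of_mul_pos_left this (Real.exp_pos _).le
  have hpot : ∀ T' S', slicePot (Real.log (m * Real.exp (b * T.card))) b L T' S' =
      (slice L T' S').card * (Real.log (m * Real.exp (b * T.card)) -
        Real.log ((slice L T' S').card * Real.exp (b * T'.card))) := by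
    intro T' S'
    unfold slicePot Real.negMulLog
    rcases (Nat.cast_nonneg (α := ℝ) (slice L T' S').card).eq_or_lt with h | h
    · rw [← h]; ring
    · rw [Real.log_mul h.ne' (Real.exp_pos _).ne', Real.log_exp]; ring
  have hY : ∀ T' S', 0 ≤ slicePot (Real.log (m * Real.exp (b * T.card))) b L T' S' := by
    intro T' S'
    rw [hpot]
    rcases (Nat.cast_nonneg (α := ℝ) (slice L T' S').card).eq_or_lt with h | h
    · rw [← h, zero_mul]
    · exact mul_nonneg h.le (sub_nonneg.2 (Real.log_le_log (by positivity) (hmax T' S')))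
  have hY0 : slicePot (Real.log (m * Real.exp (b * T.card))) b L T S = 0 := by
    rw [hpot, ← hm, sub_self, mul_zero]
  obtain ⟨I₀, hI₀⟩ : (slice L T S).Nonempty := Finset.card_pos.1 (Nat.cast_pos.1 hm0)
  have hST : S ⊆ T := by
    rw [← (mem_slice.1 hI₀).2]
    exact Finset.inter_subset_right
  refine ⟨Finset.univ \ (T \ S), ?_, ?_⟩
  · by_contra hC
    obtain ⟨G, ν, hν, hG, hν1, hΔ, hκ⟩ := hP _ hC
    set C := Finset.univ \ (T \ S) with hCdef
    have h := slicePot_ge hp0 hpq hq1 hp1 hτ hb hc hbc (G := G) hν L hY C T S ∅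
      (Finset.disjoint_empty_left _) hST (fun u hu huT => by
        by_contra hS
        simp [hCdef, huT, hS] at hu)
    rw [hY0, ← hm] at h
    have h1 : logMGF p τ (edgeCount p G ν) C ∅ ≤ -τ + τ ^ 2 * Δ / 2 := by
      unfold logMGF
      rw [← Real.log_exp (-τ + τ ^ 2 * Δ / 2)]
      refine Real.log_le_log (bernSum_pos hp0.le hp1.le fun _ => Real.exp_pos _) ?_
      simp only [Finset.empty_union]
      exact bernSum_exp_edgeCount_le hp0 hp1.le (fun E hE => (hG E hE).1) hν hν1 hΔ hτ
    have h2 : ∀ I ∈ slice L T S, liveWeight p q G ν C I ∅ ≤ κ / q ^ s := by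
      intro I hI
      refine le_trans (le_of_eq ?_)
        (div_le_div_of_nonneg_right (hκ I (mem_slice.1 hI).1) (by positivity))
      unfold liveWeight
      rw [Finset.sum_filter, Finset.sum_div]
      refine Finset.sum_congr rfl fun E hE => ?_
      obtain ⟨hEC, hEs⟩ := hG E hE
      have e1 : E \ C = ∅ := Finset.sdiff_eq_empty_iff_subset.2 hEC
      have e2 : E ∩ C = E := Finset.inter_eq_left.2 hEC
      simp only [e1, e2, Finset.Subset.refl, true_and, hEs]
      split_ifs
      · rw [div_pow]; field_simp
      · simp
    have h3 : ∑ I ∈ slice L T S, liveWeight p q G ν C I ∅ ≤ m * (κ / q ^ s) := by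
      rw [hm, ← nsmul_eq_mul]
      exact Finset.sum_le_card_nsmul _ _ _ h2
    have h4 : (C.card : ℝ) ≤ Fintype.card V := Nat.cast_le.2 (Finset.card_le_univ C)
    have e1 := mul_le_mul_of_nonneg_left h1 (mul_nonneg hm0.le hc)
    have e2 := mul_le_mul_of_nonneg_left h3 (mul_nonneg hc hτ)
    have e3 := mul_le_mul_of_nonneg_left h4
      (show 0 ≤ m * p * (Real.log (1 / q) + 1) by positivity)
    have e4 := mul_lt_mul_of_pos_left hnum hm0
    linarith
  · have hT : (T.card : ℝ) ≤ Fintype.card V := Nat.cast_le.2 (Finset.card_le_univ T)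
    have hsub : slice L T S ⊆ L.filter fun I => I ⊆ Finset.univ \ (T \ S) := by
      intro I hI
      obtain ⟨hIL, hIT⟩ := mem_slice.1 hI
      refine Finset.mem_filter.2 ⟨hIL, fun x hx => ?_⟩
      simp only [Finset.mem_sdiff, Finset.mem_univ, true_and, not_and, not_not]
      intro hxT
      rw [← hIT]
      exact Finset.mem_inter.2 ⟨hx, hxT⟩
    refine le_trans ?_ (Nat.cast_le.2 (Finset.card_le_card hsub))
    rw [← hm]
    calc (L.card : ℝ) * Real.exp (-(b * Fintype.card V))
        ≤ m * Real.exp (b * T.card) * Real.exp (-(b * Fintype.card V)) := by gcongr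
      _ = m * Real.exp (b * T.card + -(b * Fintype.card V)) := by rw [mul_assoc, Real.exp_add]
      _ ≤ m * Real.exp 0 := by
          have := mul_le_mul_of_nonneg_left hT hb
          gcongr
          linarith
      _ = m := by simp

/-- Greedy covering by sets satisfying `P`. -/
lemma exists_cover_card_le {β : ℝ} (hβ : 0 < β) (P : Finset V → Prop) (L : Finset (Finset V))
    (h : ∀ M ⊆ L, M.Nonempty →
      ∃ C, P C ∧ M.card * β ≤ ((M.filter fun I => I ⊆ C).card : ℝ)) :
    ∃ X : Finset (Finset V), (∀ C ∈ X, P C) ∧ (∀ I ∈ L, ∃ C ∈ X, I ⊆ C) ∧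
      (L.Nonempty → (X.card : ℝ) ≤ 1 + Real.log L.card / β) ∧ (L = ∅ → X = ∅) := by
  induction hk : L.card using Nat.strong_induction_on generalizing L with
  | _ k ih =>
    rcases L.eq_empty_or_nonempty with rfl | hne
    · exact ⟨∅, by simp, by simp, by simp, by simp⟩
    · obtain ⟨C, hPC, hC⟩ := h L subset_rfl hne
      set L' := L.filter fun I => ¬ I ⊆ C with hL'
      have hL0 : 0 < (L.card : ℝ) := Nat.cast_pos.2 hne.card_pos
      have hsplit : ((L.filter fun I => I ⊆ C).card : ℝ) + L'.card = L.card := by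
        exact_mod_cast Finset.card_filter_add_card_filter_not _
      have hlt : (L'.card : ℝ) < L.card := by
        have := mul_pos hL0 hβ
        linarith
      obtain ⟨X, hX1, hX2, hX3, hX4⟩ := ih L'.card (hk ▸ Nat.cast_lt.1 hlt) L'
        (fun M hM => h M (hM.trans (Finset.filter_subset _ _))) rfl
      refine ⟨insert C X, ?_, ?_, ?_, fun h0 => absurd h0 hne.ne_empty⟩
      · intro D hD
        rcases Finset.mem_insert.1 hD with rfl | hD
        · exact hPC
        · exact hX1 D hD
      · intro I hI
        by_cases hIC : I ⊆ C
        · exact ⟨C, Finset.mem_insert_self _ _, hIC⟩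
        · obtain ⟨D, hD, hID⟩ := hX2 I (Finset.mem_filter.2 ⟨hI, hIC⟩)
          exact ⟨D, Finset.mem_insert_of_mem hD, hID⟩
      · intro _
        have hins : ((insert C X).card : ℝ) ≤ X.card + 1 := by
          exact_mod_cast Finset.card_insert_le C X
        refine hins.trans ?_
        rw [← hk]
        rcases L'.eq_empty_or_nonempty with he | he
        · rw [hX4 he]
          have : 0 ≤ Real.log L.card / β :=
            div_nonneg (Real.log_natCast_nonneg _) hβ.le
          simpa using this
        · have h1 := hX3 he
          have hL'0 : 0 < (L'.card : ℝ) := Nat.cast_pos.2 he.card_pos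
          have h2 : Real.log L'.card ≤ Real.log L.card - β := by
            have e := Real.log_le_sub_one_of_pos (div_pos hL'0 hL0)
            rw [Real.log_div hL'0.ne' hL0.ne'] at e
            have : (L'.card : ℝ) / L.card ≤ 1 - β := by
              rw [div_le_iff₀ hL0]
              linarith
            linarith
          have h3 : Real.log L'.card / β ≤ Real.log L.card / β - 1 := by
            rw [div_le_iff₀ hβ, sub_mul, div_mul_cancel₀ _ hβ.ne']
            linarith
          linarith

end Cover

section Degrees

variable {V U W : Type*}

/-- Degree of `L` in the image of the weighted hypergraph `(G, ν)` under `φ`. -/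
def pushDeg (G : Finset (Finset V)) (ν : Finset V → ℝ) (φ : Finset V → Finset W)
    (L : Finset W) : ℝ :=
  ∑ E ∈ G.filter (fun E => L ⊆ φ E), ν E

/-- The weighted inner product of two degree functions, over sets of size at least two. -/
def degInner [Fintype W] (p : ℝ) (a b : Finset W → ℝ) : ℝ :=
  ∑ L ∈ (Finset.univ : Finset (Finset W)).filter (fun L => 2 ≤ L.card), a L * b L / p ^ L.card

/-- The image of a weighted hypergraph under `φ`. -/
def pushMeas (G : Finset (Finset V)) (ν : Finset V → ℝ) (φ : Finset V → Finset W)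
    (D : Finset W) : ℝ :=
  ∑ E ∈ G.filter (fun E => φ E = D), ν E

lemma lamP_eq_degInner [Fintype W] (p : ℝ) (G : Finset (Finset W)) (ν : Finset W → ℝ) :
    lamP p G ν = degInner p (dMass G ν) (dMass G ν) := by
  simp only [lamP, degInner, sq]

lemma degInner_self_nonneg [Fintype W] {p : ℝ} (hp : 0 ≤ p) (a : Finset W → ℝ) :
    0 ≤ degInner p a a :=
  Finset.sum_nonneg fun L _ => div_nonneg (mul_self_nonneg _) (by positivity)

lemma degInner_mul_sq_le [Fintype W] {p : ℝ} (hp : 0 ≤ p) (a b : Finset W → ℝ) :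
    degInner p a b ^ 2 ≤ degInner p a a * degInner p b b := by
  refine Finset.sum_sq_le_sum_mul_sum_of_sq_le_mul _ ?_ ?_ ?_
  · exact fun L _ => div_nonneg (mul_self_nonneg _) (by positivity)
  · exact fun L _ => div_nonneg (mul_self_nonneg _) (by positivity)
  · intro L _
    exact le_of_eq (by ring)

lemma degInner_self_mono [Fintype W] {p : ℝ} (hp : 0 ≤ p) {a b : Finset W → ℝ}
    (ha : ∀ L, 0 ≤ a L) (hab : ∀ L, a L ≤ b L) : degInner p a a ≤ degInner p b b := by
  refine Finset.sum_le_sum fun L _ => ?_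
  have h1 := ha L
  have h2 := hab L
  have h3 := h1.trans h2
  gcongr

lemma degInner_self_smul [Fintype W] (p : ℝ) (c : ℝ) (a : Finset W → ℝ) :
    degInner p (fun L => c * a L) (fun L => c * a L) = c ^ 2 * degInner p a a := by
  unfold degInner
  rw [Finset.mul_sum]
  exact Finset.sum_congr rfl fun L _ => by ring

lemma pushDeg_nonneg {G : Finset (Finset V)} {ν : Finset V → ℝ} (hν : ∀ E, 0 ≤ ν E)
    (φ : Finset V → Finset W) (L : Finset W) : 0 ≤ pushDeg G ν φ L :=
  Finset.sum_nonneg fun E _ => hν E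

lemma pushDeg_mono {G G' : Finset (Finset V)} (h : G ⊆ G') {ν : Finset V → ℝ}
    (hν : ∀ E, 0 ≤ ν E) (φ : Finset V → Finset W) (L : Finset W) :
    pushDeg G ν φ L ≤ pushDeg G' ν φ L :=
  Finset.sum_le_sum_of_subset_of_nonneg (Finset.filter_subset_filter _ h) fun E _ _ => hν E

lemma pushDeg_smul (G : Finset (Finset V)) (ν : Finset V → ℝ) (c : ℝ) (φ : Finset V → Finset W)
    (L : Finset W) : pushDeg G (fun E => c * ν E) φ L = c * pushDeg G ν φ L := by
  unfold pushDeg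
  rw [Finset.mul_sum]

lemma pushDeg_add (G : Finset (Finset V)) (ν μ : Finset V → ℝ) (φ : Finset V → Finset W)
    (L : Finset W) : pushDeg G (fun E => ν E + μ E) φ L = pushDeg G ν φ L + pushDeg G μ φ L :=
  Finset.sum_add_distrib

lemma degInner_pushDeg [Fintype W] (p : ℝ) (a : Finset W → ℝ) (G : Finset (Finset V))
    (ν : Finset V → ℝ) (φ : Finset V → Finset W) :
    degInner p a (pushDeg G ν φ) = ∑ E ∈ G, ν E *
      ∑ L ∈ (Finset.univ : Finset (Finset W)).filter (fun L => 2 ≤ L.card),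
        if L ⊆ φ E then a L / p ^ L.card else 0 := by
  unfold degInner pushDeg
  simp only [Finset.mul_sum]
  rw [Finset.sum_comm]
  refine Finset.sum_congr rfl fun L _ => ?_
  rw [Finset.sum_filter, Finset.sum_div]
  refine Finset.sum_congr rfl fun E _ => ?_
  split_ifs
  · ring
  · simp

lemma pushMeas_nonneg {G : Finset (Finset V)} {ν : Finset V → ℝ} (hν : ∀ E, 0 ≤ ν E)
    (φ : Finset V → Finset W) (D : Finset W) : 0 ≤ pushMeas G ν φ D :=
  Finset.sum_nonneg fun E _ => hν E

lemma isMeasureOn_pushMeas {G : Finset (Finset V)} {G' : Finset (Finset W)} {ν : Finset V → ℝ}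
    (hν : ∀ E, 0 ≤ ν E) {φ : Finset V → Finset W} (h : ∀ E ∈ G, φ E ∈ G') :
    IsMeasureOn G' (pushMeas G ν φ) := by
  refine ⟨pushMeas_nonneg hν φ, fun D hD => Finset.sum_eq_zero fun E hE => ?_⟩
  obtain ⟨hEG, rfl⟩ := Finset.mem_filter.1 hE
  exact absurd (h E hEG) hD

lemma eMass_pushMeas {G : Finset (Finset V)} {G' : Finset (Finset W)} (ν : Finset V → ℝ)
    {φ : Finset V → Finset W} (h : ∀ E ∈ G, φ E ∈ G') :
    eMass G' (pushMeas G ν φ) = ∑ E ∈ G, ν E := by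
  unfold eMass pushMeas
  convert Finset.sum_fiberwise_of_maps_to h ν

lemma dMass_pushMeas {G : Finset (Finset V)} {G' : Finset (Finset W)} (ν : Finset V → ℝ)
    {φ : Finset V → Finset W} (h : ∀ E ∈ G, φ E ∈ G') (L : Finset W) :
    dMass G' (pushMeas G ν φ) L = pushDeg G ν φ L := by
  unfold dMass pushMeas pushDeg
  rw [← Finset.sum_fiberwise_of_maps_to
    (s := G.filter fun E => L ⊆ φ E) (t := G'.filter fun D => L ⊆ D) (g := φ)]
  · refine Finset.sum_congr rfl fun D hD => Finset.sum_congr ?_ fun _ _ => rfl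
    ext E
    simp only [Finset.mem_filter]
    constructor
    · rintro ⟨hE, rfl⟩
      exact ⟨⟨hE, (Finset.mem_filter.1 hD).2⟩, rfl⟩
    · rintro ⟨⟨hE, -⟩, rfl⟩
      exact ⟨hE, rfl⟩
  · intro E hE
    obtain ⟨hE, hL⟩ := Finset.mem_filter.1 hE
    exact Finset.mem_filter.2 ⟨h E hE, hL⟩

end Degrees

section Robust

variable {V W : Type*} [Fintype W]

/-- The weight of an edge `E` measuring its interaction with the degree function `a`. -/
def crossWeight (p c : ℝ) (a : Finset W → ℝ) (φ : Finset V → Finset W) (E : Finset V) : ℝ :=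
  c * ∑ L ∈ (Finset.univ : Finset (Finset W)).filter (fun L => 2 ≤ L.card),
    if L ⊆ φ E then a L / p ^ L.card else 0

lemma crossWeight_nonneg {p c : ℝ} (hp : 0 ≤ p) (hc : 0 ≤ c) {a : Finset W → ℝ}
    (ha : ∀ L, 0 ≤ a L) (φ : Finset V → Finset W) (E : Finset V) :
    0 ≤ crossWeight p c a φ E := by
  refine mul_nonneg hc (Finset.sum_nonneg fun L _ => ?_)
  split_ifs
  · exact div_nonneg (ha L) (by positivity)
  · rfl

lemma sum_mul_crossWeight (p c : ℝ) (a : Finset W → ℝ) (φ : Finset V → Finset W)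
    (G : Finset (Finset V)) (ν : Finset V → ℝ) :
    ∑ E ∈ G, ν E * crossWeight p c a φ E = c * degInner p a (pushDeg G ν φ) := by
  rw [degInner_pushDeg, Finset.mul_sum]
  exact Finset.sum_congr rfl fun E _ => by unfold crossWeight; ring

/-- A measure on the image hypergraph lifts to a normalized measure on the edges of small
cross weight. -/
lemma exists_normalized_lift {p R R' : ℝ} (hp : 0 < p) (hR : 0 < R) (hR'0 : 0 ≤ R')
    (hR' : R' ≤ R / 16) (φ : Finset V → Finset W) {G : Finset (Finset V)}
    {GW : Finset (Finset W)} (hGW : ∀ D ∈ GW, ∃ E ∈ G, φ E = D)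
    {ν₀ : Finset W → ℝ} (hν₀ : IsMeasureOn GW ν₀)
    (hJ : lamP p GW ν₀ < eMass GW ν₀ ^ 2 / R)
    {a : Finset W → ℝ} (ha0 : ∀ L, 0 ≤ a L) (ha : R' * degInner p a a ≤ 1) :
    ∃ ν : Finset V → ℝ, IsMeasureOn (G.filter fun E => crossWeight p R' a φ E ≤ 1 / 2) ν ∧
      ∑ E ∈ G.filter (fun E => crossWeight p R' a φ E ≤ 1 / 2), ν E = 1 ∧
      degInner p (pushDeg (G.filter fun E => crossWeight p R' a φ E ≤ 1 / 2) ν φ)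
        (pushDeg (G.filter fun E => crossWeight p R' a φ E ≤ 1 / 2) ν φ) ≤ 4 / R := by
  set e := eMass GW ν₀ with he
  have he0 : 0 < e := by
    have h1 : 0 ≤ e := Finset.sum_nonneg fun E _ => hν₀.1 E
    refine h1.lt_of_ne fun h => ?_
    rw [← h, lamP_eq_degInner] at hJ
    have := degInner_self_nonneg hp.le (dMass GW ν₀)
    simp at hJ
    linarith
  obtain ⟨G₁, hG₁G, hinj, himg⟩ := Finset.exists_subset_injOn_image_eq_of_surjOn
    (f := φ) (G : Set (Finset V)) GW (by
      intro D hD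
      obtain ⟨E, hE, rfl⟩ := hGW D hD
      exact ⟨E, hE, rfl⟩)
  have hG₁G : G₁ ⊆ G := hG₁G
  set ν₁ : Finset V → ℝ := fun E => ν₀ (φ E) / e with hν₁
  have hν₁0 : ∀ E, 0 ≤ ν₁ E := fun E => div_nonneg (hν₀.1 _) he0.le
  have hdeg : pushDeg G₁ ν₁ φ = fun L => e⁻¹ * dMass GW ν₀ L := by
    funext L
    unfold pushDeg dMass
    rw [← himg, Finset.filter_image, Finset.sum_image, Finset.mul_sum]
    · exact Finset.sum_congr rfl fun E _ => by simp only [hν₁]; ring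
    · exact hinj.mono (Finset.coe_subset.2 (Finset.filter_subset _ _))
  have hmass : ∑ E ∈ G₁, ν₁ E = 1 := by
    simp only [hν₁]
    rw [← Finset.sum_div, div_eq_one_iff_eq he0.ne', he]
    unfold eMass
    rw [← himg, Finset.sum_image hinj]
  have hip : degInner p (pushDeg G₁ ν₁ φ) (pushDeg G₁ ν₁ φ) ≤ 1 / R := by
    rw [hdeg, degInner_self_smul, ← lamP_eq_degInner, inv_pow, inv_mul_eq_div,
      div_le_iff₀ (by positivity), one_div_mul_eq_div]
    exact hJ.le
  have hcross : ∑ E ∈ G₁, ν₁ E * crossWeight p R' a φ E ≤ 1 / 4 := by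
    rw [sum_mul_crossWeight]
    refine abs_le_of_sq_le_sq' (b := 1 / 4) ?_ (by norm_num) |>.2
    have h1 := degInner_mul_sq_le hp.le a (pushDeg G₁ ν₁ φ)
    have h2 := degInner_self_nonneg hp.le a
    have h3 := degInner_self_nonneg hp.le (pushDeg G₁ ν₁ φ)
    calc (R' * degInner p a (pushDeg G₁ ν₁ φ)) ^ 2
        = R' ^ 2 * degInner p a (pushDeg G₁ ν₁ φ) ^ 2 := by ring
      _ ≤ R' ^ 2 * (degInner p a a * degInner p (pushDeg G₁ ν₁ φ) (pushDeg G₁ ν₁ φ)) := by gcongr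
      _ = R' * (R' * degInner p a a) * degInner p (pushDeg G₁ ν₁ φ) (pushDeg G₁ ν₁ φ) := by ring
      _ ≤ R / 16 * 1 * (1 / R) := by gcongr
      _ = (1 / 4) ^ 2 := by field_simp; norm_num
  set G₂ := G₁.filter fun E => crossWeight p R' a φ E ≤ 1 / 2 with hG₂
  set μ := ∑ E ∈ G₂, ν₁ E with hμ
  have hμ2 : 1 / 2 ≤ μ := by
    have h1 : ∑ E ∈ G₁.filter (fun E => ¬ crossWeight p R' a φ E ≤ 1 / 2), ν₁ E * (1 / 2) ≤
        1 / 4 := by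
      refine le_trans (Finset.sum_le_sum fun E hE => ?_) (le_trans
        (Finset.sum_le_sum_of_subset_of_nonneg (Finset.filter_subset _ _) fun E _ _ => ?_) hcross)
      · exact mul_le_mul_of_nonneg_left (not_le.1 (Finset.mem_filter.1 hE).2).le (hν₁0 E)
      · exact mul_nonneg (hν₁0 E) (crossWeight_nonneg hp.le hR'0 ha0 φ E)
    rw [← Finset.sum_mul] at h1
    have h2 := Finset.sum_filter_add_sum_filter_not G₁
      (fun E => crossWeight p R' a φ E ≤ 1 / 2) ν₁
    rw [hmass] at h2
    linarith
  have hμ0 : 0 < μ := by linarith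
  set G' := G.filter fun E => crossWeight p R' a φ E ≤ 1 / 2 with hG'
  have hG₂G' : G₂ ⊆ G' := Finset.filter_subset_filter _ hG₁G
  set ν : Finset V → ℝ := fun E => if E ∈ G₂ then μ⁻¹ * ν₁ E else 0 with hν
  have hsum : ∀ Q : Finset V → Prop, ∑ E ∈ G'.filter Q, ν E = μ⁻¹ * ∑ E ∈ G₂.filter Q, ν₁ E := by
    intro Q
    rw [Finset.mul_sum]
    have h1 : ∑ E ∈ G₂.filter Q, μ⁻¹ * ν₁ E = ∑ E ∈ G₂.filter Q, ν E :=
      Finset.sum_congr rfl fun E hE => by simp only [hν, (Finset.mem_filter.1 hE).1, if_true]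
    rw [h1]
    refine (Finset.sum_subset (Finset.filter_subset_filter _ hG₂G') fun E hE hE2 => ?_).symm
    have : E ∉ G₂ := fun h => hE2 (Finset.mem_filter.2 ⟨h, (Finset.mem_filter.1 hE).2⟩)
    simp only [hν, this, if_false]
  refine ⟨ν, ⟨fun E => ?_, fun E hE => ?_⟩, ?_, ?_⟩
  · simp only [hν]
    split_ifs
    · exact mul_nonneg (by positivity) (hν₁0 E)
    · rfl
  · exact if_neg fun h => hE (hG₂G' h)
  · have := hsum fun _ => True
    simp only [Finset.filter_true] at this
    rw [this, ← hμ, inv_mul_cancel₀ hμ0.ne']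
  · have hle : ∀ L, pushDeg G' ν φ L ≤ 2 * pushDeg G₁ ν₁ φ L := by
      intro L
      have h1 : pushDeg G' ν φ L = μ⁻¹ * pushDeg G₂ ν₁ φ L := by
        unfold pushDeg
        convert hsum fun E => L ⊆ φ E
      rw [h1]
      have h2 := pushDeg_mono (Finset.filter_subset _ _ : G₂ ⊆ G₁) hν₁0 φ L
      have h3 := pushDeg_nonneg (G := G₂) hν₁0 φ L
      have h4 : μ⁻¹ ≤ 2 := by
        rw [inv_le_comm₀ hμ0 two_pos]
        linarith
      gcongr
    have hν0 : ∀ E, 0 ≤ ν E := fun E => by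
      simp only [hν]
      split_ifs
      · exact mul_nonneg (by positivity) (hν₁0 E)
      · rfl
    refine (degInner_self_mono hp.le (fun L => pushDeg_nonneg hν0 φ L) hle).trans ?_
    rw [degInner_self_smul]
    calc _ ≤ 2 ^ 2 * (1 / R) := by gcongr
      _ = 4 / R := by ring

end Robust

section Spread

variable {V W : Type*}

/-- Degree of a vertex in the weighted hypergraph `(G, ν)`. -/
def vertexDeg (G : Finset (Finset V)) (ν : Finset V → ℝ) (v : V) : ℝ :=
  ∑ E ∈ G.filter (fun E => v ∈ E), ν E

lemma vertexDeg_nonneg {G : Finset (Finset V)} {ν : Finset V → ℝ} (hν : ∀ E, 0 ≤ ν E) (v : V) :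
    0 ≤ vertexDeg G ν v :=
  Finset.sum_nonneg fun E _ => hν E

lemma sum_mul_vertexDeg [Fintype V] (G : Finset (Finset V)) (ν : Finset V → ℝ) (x : V → ℝ) :
    ∑ v, x v * vertexDeg G ν v = ∑ E ∈ G, ν E * ∑ v ∈ E, x v := by
  unfold vertexDeg
  simp only [Finset.mul_sum, Finset.sum_filter]
  rw [Finset.sum_comm]
  refine Finset.sum_congr rfl fun E _ => ?_
  simp only [mul_ite, mul_zero]
  rw [← Finset.sum_filter, Finset.filter_mem_eq_inter, Finset.univ_inter]
  exact Finset.sum_congr rfl fun v _ => mul_comm _ _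

lemma sum_sq_le_sum_mul_of_isMin {ι : Type*} (S : Finset ι) (x y : ι → ℝ)
    (h : ∀ t : ℝ, 0 ≤ t → t ≤ 1 → ∑ i ∈ S, x i ^ 2 ≤ ∑ i ∈ S, ((1 - t) * x i + t * y i) ^ 2) :
    ∑ i ∈ S, x i ^ 2 ≤ ∑ i ∈ S, x i * y i := by
  set a := ∑ i ∈ S, x i ^ 2 with ha
  set b := ∑ i ∈ S, x i * y i with hb
  set D := ∑ i ∈ S, (x i - y i) ^ 2 with hD
  have hD0 : 0 ≤ D := Finset.sum_nonneg fun i _ => sq_nonneg _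
  have hexp : ∀ t : ℝ, ∑ i ∈ S, ((1 - t) * x i + t * y i) ^ 2 =
      a - 2 * t * (a - b) + t ^ 2 * D := by
    intro t
    rw [ha, hb, hD, ← Finset.sum_sub_distrib, Finset.mul_sum, Finset.mul_sum,
      ← Finset.sum_sub_distrib, ← Finset.sum_add_distrib]
    exact Finset.sum_congr rfl fun i _ => by ring
  by_contra hlt
  push Not at hlt
  have hA : 0 < a - b := by linarith
  have hden : 0 < (a - b) + D + 1 := by linarith
  have h1 := h ((a - b) / ((a - b) + D + 1)) (by positivity) (by
    rw [div_le_one hden]; linarith)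
  rw [hexp] at h1
  set t := (a - b) / ((a - b) + D + 1) with ht
  have ht0 : 0 < t := div_pos hA hden
  have h2 : t * ((a - b) + D + 1) = a - b := div_mul_cancel₀ _ hden.ne'
  nlinarith [mul_pos ht0 hA, mul_pos ht0 ht0]

lemma degInner_self_convex [Fintype W] {p : ℝ} (hp : 0 ≤ p) {a b : Finset W → ℝ} {Λ t : ℝ}
    (ht0 : 0 ≤ t) (ht1 : t ≤ 1) (ha : degInner p a a ≤ Λ) (hb : degInner p b b ≤ Λ) :
    degInner p (fun L => (1 - t) * a L + t * b L) (fun L => (1 - t) * a L + t * b L) ≤ Λ := by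
  have h1 : degInner p (fun L => (1 - t) * a L + t * b L) (fun L => (1 - t) * a L + t * b L) ≤
      (1 - t) * degInner p a a + t * degInner p b b := by
    unfold degInner
    rw [Finset.mul_sum, Finset.mul_sum, ← Finset.sum_add_distrib]
    refine Finset.sum_le_sum fun L _ => ?_
    rw [← mul_div_assoc, ← mul_div_assoc, ← add_div]
    have : 0 ≤ t * (1 - t) * (a L - b L) ^ 2 :=
      mul_nonneg (mul_nonneg ht0 (by linarith)) (sq_nonneg _)
    gcongr
    nlinarith
  have h2 : 0 ≤ 1 - t := by linarith
  calc _ ≤ (1 - t) * degInner p a a + t * degInner p b b := h1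
    _ ≤ (1 - t) * Λ + t * Λ := by gcongr
    _ = Λ := by ring

/-- If every large vertex subset carries a normalized measure of small energy, then there is
such a measure which is also spread out over the vertices. -/
lemma exists_spread_measure [Fintype V] [Fintype W] {p Λ θ : ℝ} (hp : 0 ≤ p) (hθ : 0 < θ) {s : ℕ}
    {C : Finset V} {G : Finset (Finset V)} (hG : ∀ E ∈ G, E ⊆ C ∧ E.card = s)
    (φ : Finset V → Finset W)
    (h : ∀ Y ⊆ C, (C.card : ℝ) - s / θ ≤ Y.card → ∃ ν : Finset V → ℝ,
      IsMeasureOn (G.filter fun E => E ⊆ Y) ν ∧ ∑ E ∈ G, ν E = 1 ∧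
      degInner p (pushDeg G ν φ) (pushDeg G ν φ) ≤ Λ) :
    ∃ ν : Finset V → ℝ, IsMeasureOn G ν ∧ ∑ E ∈ G, ν E = 1 ∧
      degInner p (pushDeg G ν φ) (pushDeg G ν φ) ≤ Λ ∧
      ∑ v, vertexDeg G ν v ^ 2 ≤ θ * s := by
  set M : Set (Finset V → ℝ) := {ν | IsMeasureOn G ν ∧ ∑ E ∈ G, ν E = 1 ∧
    degInner p (pushDeg G ν φ) (pushDeg G ν φ) ≤ Λ} with hM
  have hMIcc : M ⊆ Set.Icc 0 1 := by
    rintro ν ⟨⟨h0, hs⟩, h1, -⟩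
    refine ⟨h0, fun E => ?_⟩
    by_cases hE : E ∈ G
    · rw [Pi.one_apply, ← h1]
      exact Finset.single_le_sum (fun E _ => h0 E) hE
    · rw [hs E hE]
      exact zero_le_one
  have hMclosed : IsClosed M := by
    have h1 : IsClosed {ν : Finset V → ℝ | ∀ E, 0 ≤ ν E} := by
      rw [Set.ofPred_forall]
      exact isClosed_iInter fun E => isClosed_le continuous_const (continuous_apply E)
    have h2 : IsClosed {ν : Finset V → ℝ | ∀ E, E ∉ G → ν E = 0} := by
      simp only [Set.ofPred_forall]
      exact isClosed_iInter fun E => isClosed_iInter fun _ =>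
        isClosed_eq (continuous_apply E) continuous_const
    have h3 : IsClosed {ν : Finset V → ℝ | ∑ E ∈ G, ν E = 1} :=
      isClosed_eq (by fun_prop) continuous_const
    have h4 : IsClosed {ν : Finset V → ℝ | degInner p (pushDeg G ν φ) (pushDeg G ν φ) ≤ Λ} := by
      refine isClosed_le ?_ continuous_const
      unfold degInner pushDeg
      fun_prop
    exact (h1.inter h2).inter (h3.inter h4)
  have hMcompact : IsCompact M := IsCompact.of_isClosed_subset isCompact_Icc hMclosed hMIcc
  have hsub : ∀ Y ν, IsMeasureOn (G.filter fun E => E ⊆ Y) ν → IsMeasureOn G ν :=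
    fun Y ν hν => ⟨hν.1, fun E hE => hν.2 E fun h => hE (Finset.mem_filter.1 h).1⟩
  have hMne : M.Nonempty := by
    obtain ⟨ν, hν, h1, h2⟩ := h C subset_rfl (by
      have : 0 ≤ (s : ℝ) / θ := by positivity
      linarith)
    exact ⟨ν, hsub _ _ hν, h1, h2⟩
  obtain ⟨ν, ⟨hν, hν1, hνΛ⟩, hmin⟩ := hMcompact.exists_isMinOn hMne
    (f := fun ν => ∑ v, vertexDeg G ν v ^ 2) (by
      unfold vertexDeg
      exact Continuous.continuousOn (by fun_prop))
  refine ⟨ν, hν, hν1, hνΛ, ?_⟩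
  set Y := C.filter fun v => vertexDeg G ν v ≤ θ with hY
  have hYC : Y ⊆ C := Finset.filter_subset _ _
  have hdeg : ∑ v, vertexDeg G ν v = s := by
    have := sum_mul_vertexDeg G ν fun _ => 1
    simp only [one_mul, Finset.sum_const, nsmul_eq_mul, mul_one] at this
    rw [this, ← one_mul (s : ℝ), ← hν1, Finset.sum_mul]
    exact Finset.sum_congr rfl fun E hE => by rw [(hG E hE).2]
  have hcard : (C.card : ℝ) - s / θ ≤ Y.card := by
    have h1 : ((C.filter fun v => ¬ vertexDeg G ν v ≤ θ).card : ℝ) * θ ≤ s := by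
      rw [← hdeg, ← nsmul_eq_mul, ← Finset.sum_const]
      refine le_trans (Finset.sum_le_sum fun v hv => ?_) (Finset.sum_le_sum_of_subset_of_nonneg
        (Finset.subset_univ _) fun v _ _ => vertexDeg_nonneg hν.1 v)
      exact (not_le.1 (Finset.mem_filter.1 hv).2).le
    rw [← le_div_iff₀ hθ] at h1
    have h2 : (Y.card : ℝ) + (C.filter fun v => ¬ vertexDeg G ν v ≤ θ).card = C.card := by
      exact_mod_cast Finset.card_filter_add_card_filter_not (s := C)
        (fun v => vertexDeg G ν v ≤ θ)
    linarith
  obtain ⟨ν', hν', hν'1, hν'Λ⟩ := h Y hYC hcard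
  have hle : ∑ v, vertexDeg G ν v ^ 2 ≤ ∑ v, vertexDeg G ν v * vertexDeg G ν' v := by
    refine sum_sq_le_sum_mul_of_isMin _ _ _ fun t ht0 ht1 => ?_
    have hmem : (fun E => (1 - t) * ν E + t * ν' E) ∈ M := by
      have ht2 : 0 ≤ 1 - t := by linarith
      refine ⟨⟨fun E => ?_, fun E hE => ?_⟩, ?_, ?_⟩
      · have h1 := hν.1 E
        have h2 := hν'.1 E
        positivity
      · beta_reduce
        rw [hν.2 E hE, (hsub _ _ hν').2 E hE]
        ring
      · rw [Finset.sum_add_distrib, ← Finset.mul_sum, ← Finset.mul_sum, hν1, hν'1]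
        ring
      · have : pushDeg G (fun E => (1 - t) * ν E + t * ν' E) φ =
            fun L => (1 - t) * pushDeg G ν φ L + t * pushDeg G ν' φ L := by
          funext L
          rw [pushDeg_add, pushDeg_smul, pushDeg_smul]
        rw [this]
        exact degInner_self_convex hp ht0 ht1 hνΛ hν'Λ
    refine (hmin hmem).trans (le_of_eq (Finset.sum_congr rfl fun v _ => ?_))
    unfold vertexDeg
    rw [Finset.sum_add_distrib, ← Finset.mul_sum, ← Finset.mul_sum]
  refine hle.trans ?_
  rw [sum_mul_vertexDeg]
  calc ∑ E ∈ G, ν' E * ∑ v ∈ E, vertexDeg G ν v ≤ ∑ E ∈ G, ν' E * (θ * s) := by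
        refine Finset.sum_le_sum fun E hE => ?_
        by_cases hEY : E ⊆ Y
        · refine mul_le_mul_of_nonneg_left ?_ (hν'.1 E)
          rw [← (hG E hE).2, mul_comm, ← nsmul_eq_mul]
          exact Finset.sum_le_card_nsmul _ _ _ fun v hv => (Finset.mem_filter.1 (hEY hv)).2
        · rw [hν'.2 E fun h => hEY (Finset.mem_filter.1 h).2]
          simp
    _ = θ * s := by rw [← Finset.sum_mul, hν'1, one_mul]

end Spread

section Overlap

variable {V U : Type*} [Fintype V] [Fintype U]

/-- The weighted count of intersecting pairs of edges is controlled by the vertex degrees and the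
energy of the image measure. -/
lemma sum_overlap_le {p : ℝ} (hp : 0 < p) {G : Finset (Finset V)} {ν : Finset V → ℝ}
    (hν : ∀ E, 0 ≤ ν E) {φ : Finset V → Finset U}
    (hφ : ∀ E ∈ G, ∀ L ⊆ E, (φ L).card = L.card)
    (hφm : Monotone φ) :
    ∑ E ∈ G, ∑ E' ∈ G.filter (fun E' => ¬ Disjoint E' E), ν E * ν E' / p ^ (E' ∩ E).card ≤
      (∑ v, vertexDeg G ν v ^ 2) / p + degInner p (pushDeg G ν φ) (pushDeg G ν φ) := by
  have hfix : ∀ E ∈ G, ∑ E' ∈ G.filter (fun E' => ¬ Disjoint E' E), ν E' / p ^ (E' ∩ E).card ≤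
      (∑ v ∈ E, vertexDeg G ν v) / p +
        ∑ L ∈ (Finset.univ : Finset (Finset U)).filter (fun L => 2 ≤ L.card),
          if L ⊆ φ E then pushDeg G ν φ L / p ^ L.card else 0 := by
    intro E hE
    have h1 : ∑ v ∈ E, vertexDeg G ν v =
        ∑ E' ∈ G, ν E' * ∑ v ∈ E', if v ∈ E then 1 else 0 := by
      rw [← sum_mul_vertexDeg]
      simp
    have h2 : (∑ L ∈ (Finset.univ : Finset (Finset U)).filter (fun L => 2 ≤ L.card),
          if L ⊆ φ E then pushDeg G ν φ L / p ^ L.card else 0) =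
        ∑ E' ∈ G, ν E' * ∑ L ∈ (Finset.univ : Finset (Finset U)).filter (fun L => 2 ≤ L.card),
          if L ⊆ φ E' then (if L ⊆ φ E then 1 else 0) / p ^ L.card else 0 := by
      rw [← degInner_pushDeg]
      unfold degInner
      refine Finset.sum_congr rfl fun L _ => ?_
      by_cases hL : L ⊆ φ E <;> simp [hL]
    rw [h1, h2, Finset.sum_div, ← Finset.sum_add_distrib, Finset.sum_filter]
    refine Finset.sum_le_sum fun E' hE' => ?_
    have hA : 0 ≤ ∑ v ∈ E', (if v ∈ E then 1 else 0 : ℝ) :=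
      Finset.sum_nonneg fun v _ => by split_ifs <;> simp
    have hterm : ∀ L ∈ (Finset.univ : Finset (Finset U)).filter (fun L => 2 ≤ L.card),
        0 ≤ if L ⊆ φ E' then (if L ⊆ φ E then 1 else 0) / p ^ L.card else 0 := fun L _ => by
      split_ifs <;> positivity
    have hB := Finset.sum_nonneg hterm
    have hE0 := hν E'
    by_cases hd : Disjoint E' E
    · rw [if_neg (not_not.2 hd)]
      have := mul_nonneg hE0 hB
      have := div_nonneg (mul_nonneg hE0 hA) hp.le
      linarith
    · rw [if_pos hd]
      have hne : (E' ∩ E).Nonempty := Finset.not_disjoint_iff_nonempty_inter.1 hd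
      rcases (Nat.succ_le_of_lt hne.card_pos).eq_or_lt with hc | hc
      · have h3 : ∑ v ∈ E', (if v ∈ E then 1 else 0 : ℝ) = 1 := by
          rw [← Finset.sum_filter, Finset.filter_mem_eq_inter]
          simp [← hc]
        rw [h3, ← hc, mul_one]
        simp only [Nat.succ_eq_add_one, zero_add, pow_one]
        have := mul_nonneg hE0 hB
        linarith
      · have hcard : (φ (E' ∩ E)).card = (E' ∩ E).card :=
          hφ E hE _ Finset.inter_subset_right
        have h4 := Finset.single_le_sum hterm
          (Finset.mem_filter.2 ⟨Finset.mem_univ (φ (E' ∩ E)), by rw [hcard]; omega⟩)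
        rw [if_pos (hφm Finset.inter_subset_left), if_pos (hφm Finset.inter_subset_right),
          hcard] at h4
        have h5 := mul_le_mul_of_nonneg_left h4 hE0
        have h6 := div_nonneg (mul_nonneg hE0 hA) hp.le
        rw [mul_one_div] at h5
        linarith
  have h3 : ∑ v, vertexDeg G ν v ^ 2 = ∑ E ∈ G, ν E * ∑ v ∈ E, vertexDeg G ν v := by
    rw [← sum_mul_vertexDeg]
    exact Finset.sum_congr rfl fun v _ => sq _
  rw [degInner_pushDeg, h3, Finset.sum_div, ← Finset.sum_add_distrib]
  refine Finset.sum_le_sum fun E hE => ?_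
  calc _ = ν E * ∑ E' ∈ G.filter (fun E' => ¬ Disjoint E' E), ν E' / p ^ (E' ∩ E).card := by
        rw [Finset.mul_sum]
        exact Finset.sum_congr rfl fun E' _ => by ring
    _ ≤ ν E * _ := mul_le_mul_of_nonneg_left (hfix E hE) (hν E)
    _ = _ := by ring

end Overlap

section Glue

variable {V U : Type*} [Fintype U]

lemma sum_finset_option (g : Finset (Option U) → ℝ) :
    ∑ L, g L = ∑ L : Finset U, g (L.map Function.Embedding.some) +
      ∑ L : Finset U, g (Finset.insertNone L) := by
  rw [← Finset.sum_filter_not_add_sum_filter Finset.univ (fun L : Finset (Option U) => none ∈ L)]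
  congr 1
  · refine Finset.sum_nbij' Finset.eraseNone (fun L => L.map Function.Embedding.some) ?_ ?_ ?_ ?_ ?_
    · simp
    · simp
    · intro L hL
      rw [Finset.map_some_eraseNone, Finset.erase_eq_of_notMem (Finset.mem_filter.1 hL).2]
    · intro L _
      exact Finset.eraseNone_map_some L
    · intro L hL
      rw [Finset.map_some_eraseNone, Finset.erase_eq_of_notMem (Finset.mem_filter.1 hL).2]
  · refine Finset.sum_nbij' Finset.eraseNone (fun L => Finset.insertNone L) ?_ ?_ ?_ ?_ ?_
    · simp
    · simp
    · intro L hL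
      rw [Finset.insertNone_eraseNone, Finset.insert_eq_of_mem (Finset.mem_filter.1 hL).2]
    · intro L _
      exact Finset.eraseNone_insertNone L
    · intro L hL
      rw [Finset.insertNone_eraseNone, Finset.insert_eq_of_mem (Finset.mem_filter.1 hL).2]

lemma sum_card_eq_one (g : Finset U → ℝ) :
    ∑ L ∈ (Finset.univ : Finset (Finset U)).filter (fun L => L.card = 1), g L = ∑ u, g {u} := by
  symm
  refine Finset.sum_nbij (fun u => {u}) (by simp)
    (fun u _ v _ h => Finset.singleton_injective h) ?_ (by simp)
  intro L hL
  obtain ⟨u, rfl⟩ := Finset.card_eq_one.1 (Finset.mem_filter.1 (Finset.mem_coe.1 hL)).2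
  exact ⟨u, by simp, rfl⟩

lemma pushDeg_congr {W W' : Type*} (G : Finset (Finset V)) (ν : Finset V → ℝ)
    {φ : Finset V → Finset W} {φ' : Finset V → Finset W'} {L : Finset W} {L' : Finset W'}
    (h : ∀ E, L ⊆ φ E ↔ L' ⊆ φ' E) : pushDeg G ν φ L = pushDeg G ν φ' L' :=
  Finset.sum_congr (Finset.filter_congr fun E _ => h E) fun _ _ => rfl

lemma pushDeg_eq_zero {W : Type*} (G : Finset (Finset V)) (ν : Finset V → ℝ)
    {φ : Finset V → Finset W} {L : Finset W} (h : ∀ E, ¬ L ⊆ φ E) : pushDeg G ν φ L = 0 :=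
  Finset.sum_eq_zero fun E hE => absurd (Finset.mem_filter.1 hE).2 (h E)

/-- Gluing a measure on `F` with a measure on the link of the new vertex. -/
lemma isJanson_union [DecidableEq U] {p R' δ : ℝ} (hp : 0 < p) (hR' : 0 ≤ R') (hδ : 0 < δ)
    (π : V → U) {F : Finset (Finset U)} {νF : Finset U → ℝ} (hνF : IsMeasureOn F νF)
    (heF : R' * eMass F νF = R') (hΛF : R' * lamP p F νF ≤ 1)
    {G : Finset (Finset V)} {ν : Finset V → ℝ} (hν : ∀ E, 0 ≤ ν E) (hν1 : ∑ E ∈ G, ν E = 1)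
    (hcross : R' * degInner p (dMass F νF) (pushDeg G ν fun E => E.image π) ≤ 1 / 2)
    (hsmall : 16 * δ * (degInner p (pushDeg G ν fun E => E.image π)
        (pushDeg G ν fun E => E.image π) * (1 + 1 / p) +
      (∑ u, pushDeg G ν (fun E => E.image π) {u} ^ 2) / p ^ 2) ≤ 1) :
    IsJanson p (R' + δ) (pushvHG π G ∪ liftHG F) := by
  intro _
  set d := pushDeg G ν fun E => E.image π with hd
  set a := dMass F νF with ha
  set lift : Finset U → Finset (Option U) := fun E => E.image some with hlift
  set ψ : Finset V → Finset (Option U) :=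
    fun E => insert (none : Option U) ((E.image π).image some) with hψ
  set G' := pushvHG π G ∪ liftHG F with hG'
  have hF' : ∀ E ∈ F, lift E ∈ G' := fun E hE =>
    Finset.mem_union_right _ (Finset.mem_image_of_mem _ hE)
  have hG1 : ∀ E ∈ G, ψ E ∈ G' := fun E hE =>
    Finset.mem_union_left _ (Finset.mem_image_of_mem _ hE)
  set ε := 4 * δ with hε
  have hε0 : 0 < ε := by positivity
  set μ : Finset (Option U) → ℝ := fun D => R' * pushMeas F νF lift D + ε * pushMeas G ν ψ D
    with hμ
  have hμmeas : IsMeasureOn G' μ := by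
    have h1 := isMeasureOn_pushMeas hνF.1 hF'
    have h2 := isMeasureOn_pushMeas hν hG1
    refine ⟨fun D => ?_, fun D hD => ?_⟩
    · exact add_nonneg (mul_nonneg hR' (h1.1 D)) (mul_nonneg hε0.le (h2.1 D))
    · simp only [hμ, h1.2 D hD, h2.2 D hD, mul_zero, add_zero]
  have hμe : eMass G' μ = R' + ε := by
    have h1 := eMass_pushMeas νF hF'
    have h2 := eMass_pushMeas ν hG1
    unfold eMass at h1 h2 ⊢
    simp only [hμ, Finset.sum_add_distrib, ← Finset.mul_sum]
    rw [h1, h2, hν1, mul_one]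
    congr 1
  have hμd : ∀ L, dMass G' μ L = R' * pushDeg F νF lift L + ε * pushDeg G ν ψ L := by
    intro L
    rw [← dMass_pushMeas νF hF', ← dMass_pushMeas ν hG1]
    unfold dMass
    simp only [hμ, Finset.sum_add_distrib, ← Finset.mul_sum]
  have hsome : ∀ L : Finset U, dMass G' μ (L.map Function.Embedding.some) =
      R' * a L + ε * d L := by
    intro L
    rw [hμd]
    congr 2
    · refine pushDeg_congr (φ' := id) F νF fun E => ?_
      simp only [hlift, Finset.subset_iff]
      simp
    · refine pushDeg_congr G ν fun E => ?_
      simp only [hψ, Finset.subset_iff]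
      simp
  have hnone : ∀ L : Finset U, dMass G' μ (Finset.insertNone L) = ε * d L := by
    intro L
    rw [hμd]
    have h1 : pushDeg F νF lift (Finset.insertNone L) = 0 := by
      refine pushDeg_eq_zero F νF fun E hE => ?_
      have := hE Finset.none_mem_insertNone
      simp [hlift] at this
    rw [h1, mul_zero, zero_add]
    congr 1
    refine pushDeg_congr G ν fun E => ?_
    simp only [hψ, Finset.subset_iff, Option.forall]
    simp
  have hlam : lamP p G' μ = degInner p (fun L => R' * a L + ε * d L) (fun L => R' * a L + ε * d L) +
      ε ^ 2 * (degInner p d d / p + (∑ u, d {u} ^ 2) / p ^ 2) := by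
    unfold lamP
    rw [Finset.sum_filter, sum_finset_option]
    congr 1
    · unfold degInner
      rw [Finset.sum_filter]
      refine Finset.sum_congr rfl fun L _ => ?_
      rw [hsome, Finset.card_map, sq]
    · rw [← sum_card_eq_one fun L => d L ^ 2]
      unfold degInner
      simp only [Finset.sum_div, Finset.sum_filter, Finset.mul_sum, mul_add]
      rw [← Finset.sum_add_distrib]
      refine Finset.sum_congr rfl fun L _ => ?_
      rw [hnone, Finset.card_insertNone]
      rcases lt_trichotomy L.card 1 with h | h | h
      · have : L.card = 0 := by omega
        simp [this]
      · simp [h]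
        ring
      · have h2 : 2 ≤ L.card := h
        have h3 : 2 ≤ L.card + 1 := by omega
        have h4 : L.card ≠ 1 := by omega
        simp only [h2, h3, h4, if_true, if_false]
        rw [pow_succ]
        field_simp
        ring
  have hexp : degInner p (fun L => R' * a L + ε * d L) (fun L => R' * a L + ε * d L) =
      R' ^ 2 * lamP p F νF + 2 * ε * (R' * degInner p a d) + ε ^ 2 * degInner p d d := by
    rw [lamP_eq_degInner]
    unfold degInner
    simp only [Finset.mul_sum]
    rw [← Finset.sum_add_distrib, ← Finset.sum_add_distrib]
    exact Finset.sum_congr rfl fun L _ => by ring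
  refine ⟨μ, hμmeas, ?_⟩
  rw [lt_div_iff₀ (by linarith), hμe, hlam, hexp]
  set Λ := degInner p d d * (1 + 1 / p) + (∑ u, d {u} ^ 2) / p ^ 2 with hΛ
  have h1 : R' ^ 2 * lamP p F νF ≤ R' := by nlinarith
  have h2 : 2 * ε * (R' * degInner p a d) ≤ ε := by nlinarith
  have h3 : ε ^ 2 * Λ ≤ ε / 4 := by
    have : ε ^ 2 * Λ = ε / 4 * (16 * δ * Λ) := by rw [hε]; ring
    rw [this]
    nlinarith
  have h4 : R' ^ 2 * lamP p F νF + 2 * ε * (R' * degInner p a d) + ε ^ 2 * degInner p d d +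
      ε ^ 2 * (degInner p d d / p + (∑ u, d {u} ^ 2) / p ^ 2) ≤ R' + ε + ε / 4 := by
    have : ε ^ 2 * degInner p d d +
      ε ^ 2 * (degInner p d d / p + (∑ u, d {u} ^ 2) / p ^ 2) = ε ^ 2 * Λ := by rw [hΛ]; ring
    linarith
  have h5 : δ = ε / 4 := by rw [hε]; ring
  rw [h5]
  nlinarith [mul_nonneg hR' hε0.le, mul_pos hε0 hε0,
    mul_le_mul_of_nonneg_right h4 (by positivity : 0 ≤ R' + ε / 4)]

end Glue

section Bad

variable {V U : Type*} [Fintype V] [Fintype U] [DecidableEq U]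

lemma sum_pushDeg_singleton_sq_le {π : V → U}
    (hπ : ∀ u, ((Finset.univ.filter fun v => π v = u).card : ℝ) ≤ 2) (G : Finset (Finset V))
    {ν : Finset V → ℝ} (hν : ∀ E, 0 ≤ ν E) :
    ∑ u, pushDeg G ν (fun E => E.image π) {u} ^ 2 ≤ 2 * ∑ v, vertexDeg G ν v ^ 2 := by
  have h1 : ∀ u, pushDeg G ν (fun E => E.image π) {u} ≤
      ∑ v ∈ Finset.univ.filter (fun v => π v = u), vertexDeg G ν v := by
    intro u
    unfold pushDeg vertexDeg
    simp only [Finset.sum_filter (s := G)]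
    rw [Finset.sum_comm]
    refine Finset.sum_le_sum fun E _ => ?_
    have hnn : ∀ v ∈ Finset.univ.filter (fun v => π v = u), 0 ≤ if v ∈ E then ν E else 0 :=
      fun v _ => by
        split_ifs
        · exact hν E
        · rfl
    split_ifs with h
    · obtain ⟨v, hv, hvu⟩ := Finset.mem_image.1 (Finset.singleton_subset_iff.1 h)
      refine le_trans ?_ (Finset.single_le_sum hnn
        (Finset.mem_filter.2 ⟨Finset.mem_univ v, hvu⟩))
      rw [if_pos hv]
    · exact Finset.sum_nonneg hnn
  have h2 : ∀ u, pushDeg G ν (fun E => E.image π) {u} ^ 2 ≤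
      2 * ∑ v ∈ Finset.univ.filter (fun v => π v = u), vertexDeg G ν v ^ 2 := by
    intro u
    calc _ ≤ (∑ v ∈ Finset.univ.filter (fun v => π v = u), vertexDeg G ν v) ^ 2 :=
          pow_le_pow_left₀ (pushDeg_nonneg hν _ _) (h1 u) 2
      _ ≤ _ := sq_sum_le_card_mul_sum_sq
      _ ≤ _ := mul_le_mul_of_nonneg_right (hπ u) (Finset.sum_nonneg fun v _ => sq_nonneg _)
  refine (Finset.sum_le_sum fun u _ => h2 u).trans (le_of_eq ?_)
  rw [← Finset.mul_sum, Finset.sum_fiberwise]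

/-- A well spread measure of low energy gives little mass to each set `I` whose glued hypergraph
fails to be Janson. -/
lemma sum_filter_le_of_not_isJanson {p R' δ Λ Q κ : ℝ} (hp : 0 < p) (hR' : 0 ≤ R') (hδ : 0 < δ)
    {π : V → U} (hπ : ∀ u, ((Finset.univ.filter fun v => π v = u).card : ℝ) ≤ 2)
    {F : Finset (Finset U)} {νF : Finset U → ℝ} (hνF : IsMeasureOn F νF)
    (heF : R' * eMass F νF = R') (hΛF : R' * lamP p F νF ≤ 1)
    {H G : Finset (Finset V)} (hGH : G ⊆ H)
    (hGcross : ∀ E ∈ G, crossWeight p R' (dMass F νF) (fun E => E.image π) E ≤ 1 / 2)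
    {ν : Finset V → ℝ} (hν : ∀ E, 0 ≤ ν E)
    (hΛ : degInner p (pushDeg G ν fun E => E.image π) (pushDeg G ν fun E => E.image π) ≤ Λ)
    (hQ : ∑ v, vertexDeg G ν v ^ 2 ≤ Q) (hκ : 0 < κ)
    (hsmall : 16 * δ * (Λ * (1 + 1 / p) + 2 * Q / p ^ 2) ≤ κ ^ 2) {I : Finset V}
    (hI : ¬ IsJanson p (R' + δ) (pushvHG π (indHG H I) ∪ liftHG F)) :
    ∑ E ∈ G.filter (fun E => E ⊆ I), ν E ≤ κ := by
  by_contra hlt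
  push Not at hlt
  refine hI ?_
  set G₁ := G.filter fun E => E ⊆ I with hG₁
  set μ := ∑ E ∈ G₁, ν E with hμ
  have hμ0 : 0 < μ := hκ.trans hlt
  have hG₁H : G₁ ⊆ indHG H I := Finset.filter_subset_filter _ hGH
  set ν₁ : Finset V → ℝ := fun E => if E ∈ G₁ then μ⁻¹ * ν E else 0 with hν₁
  have hν₁0 : ∀ E, 0 ≤ ν₁ E := fun E => by
    simp only [hν₁]
    split_ifs
    · exact mul_nonneg (by positivity) (hν E)
    · rfl
  have hsum : ∀ f : Finset V → ℝ, ∑ E ∈ indHG H I, ν₁ E * f E = μ⁻¹ * ∑ E ∈ G₁, ν E * f E := by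
    intro f
    rw [Finset.mul_sum, ← Finset.sum_subset hG₁H]
    · exact Finset.sum_congr rfl fun E hE => by simp only [hν₁, hE, if_true]; ring
    · intro E _ hE
      simp only [hν₁, hE, if_false, zero_mul]
  have hsum1 : ∑ E ∈ indHG H I, ν₁ E = 1 := by
    have := hsum fun _ => 1
    simp only [mul_one] at this
    rw [this, ← hμ, inv_mul_cancel₀ hμ0.ne']
  set φ : Finset V → Finset U := fun E => E.image π with hφ
  have hd : ∀ L, pushDeg (indHG H I) ν₁ φ L ≤ κ⁻¹ * pushDeg G ν φ L := by
    intro L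
    have h1 : pushDeg (indHG H I) ν₁ φ L = μ⁻¹ * pushDeg G₁ ν φ L := by
      have := hsum fun E => if L ⊆ φ E then 1 else 0
      simp only [mul_ite, mul_one, mul_zero, ← Finset.sum_filter] at this
      unfold pushDeg
      convert this
    rw [h1]
    have h2 := pushDeg_mono (Finset.filter_subset _ _ : G₁ ⊆ G) hν φ L
    have h3 := pushDeg_nonneg (G := G₁) hν φ L
    gcongr
  have hd0 : ∀ L, 0 ≤ pushDeg (indHG H I) ν₁ φ L := pushDeg_nonneg hν₁0 φ
  refine isJanson_union hp hR' hδ π hνF heF hΛF hν₁0 hsum1 ?_ ?_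
  · rw [← sum_mul_crossWeight, hsum]
    calc _ ≤ μ⁻¹ * ∑ E ∈ G₁, ν E * (1 / 2) := by
          refine mul_le_mul_of_nonneg_left (Finset.sum_le_sum fun E hE => ?_) (by positivity)
          exact mul_le_mul_of_nonneg_left (hGcross E (Finset.mem_filter.1 hE).1) (hν E)
      _ = 1 / 2 := by
          rw [← Finset.sum_mul, ← hμ, ← mul_assoc, inv_mul_cancel₀ hμ0.ne', one_mul]
  · have h1 : degInner p (pushDeg (indHG H I) ν₁ φ) (pushDeg (indHG H I) ν₁ φ) ≤
        (κ⁻¹) ^ 2 * Λ := by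
      refine (degInner_self_mono hp.le hd0 hd).trans ?_
      rw [degInner_self_smul]
      gcongr
    have h2 : ∑ u, pushDeg (indHG H I) ν₁ φ {u} ^ 2 ≤ (κ⁻¹) ^ 2 * (2 * Q) := by
      calc _ ≤ ∑ u, (κ⁻¹ * pushDeg G ν φ {u}) ^ 2 :=
            Finset.sum_le_sum fun u _ => pow_le_pow_left₀ (hd0 _) (hd _) 2
        _ = (κ⁻¹) ^ 2 * ∑ u, pushDeg G ν φ {u} ^ 2 := by
            rw [Finset.mul_sum]
            exact Finset.sum_congr rfl fun u _ => by ring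
        _ ≤ _ := by
            have := sum_pushDeg_singleton_sq_le hπ G hν
            gcongr
            linarith
    calc _ ≤ 16 * δ * ((κ⁻¹) ^ 2 * Λ * (1 + 1 / p) + (κ⁻¹) ^ 2 * (2 * Q) / p ^ 2) := by gcongr
      _ = (κ⁻¹) ^ 2 * (16 * δ * (Λ * (1 + 1 / p) + 2 * Q / p ^ 2)) := by ring
      _ ≤ (κ⁻¹) ^ 2 * κ ^ 2 := by gcongr
      _ = 1 := by rw [← mul_pow, inv_mul_cancel₀ hκ.ne', one_pow]

end Bad

section Numerics

lemma two_lt_log_inv {q : ℝ} (hq0 : 0 < q) (hq : q < 1 / 8) : 2 < Real.log (1 / q) := by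
  have h1 : Real.log 8 < Real.log (1 / q) := by
    refine Real.log_lt_log (by norm_num) ?_
    rw [lt_div_iff₀ hq0]
    linarith
  have h2 : Real.log 8 = 3 * Real.log 2 := by
    rw [show (8 : ℝ) = 2 ^ 3 by norm_num, Real.log_pow]
    norm_num
  have := Real.log_two_gt_d9
  linarith

lemma neg_log_one_sub_le {p : ℝ} (hp0 : 0 ≤ p) (hp : p ≤ 1 / 2) : -Real.log (1 - p) ≤ 2 * p := by
  have h1 := Real.one_sub_inv_le_log_of_pos (x := 1 - p) (by linarith)
  have h2 : (1 - p)⁻¹ ≤ 1 + 2 * p := by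
    rw [inv_le_iff_one_le_mul₀ (by linarith)]
    nlinarith
  linarith

/-- The number of containers produced by the greedy cover is small. -/
lemma one_add_mul_exp_le {q N : ℝ} (hq0 : 0 < q) (hq : q < 1 / 8) (hqN : 1 ≤ q * N) :
    1 + N * Real.exp (2 * q * (Real.log (1 / q) + 1) * N) ≤ 4 * (2 / q) ^ (4 * q * N) := by
  set ℓ := Real.log (1 / q) with hℓ
  have hℓ2 : 2 < ℓ := two_lt_log_inv hq0 hq
  set y := q * N with hy
  have hN : N ≤ Real.exp (y + ℓ) := by
    have h1 : N = y * (1 / q) := by rw [hy]; field_simp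
    have h2 : Real.exp ℓ = 1 / q := Real.exp_log (by positivity)
    rw [h1, Real.exp_add, h2]
    have := Real.add_one_le_exp y
    gcongr
    linarith
  have hrhs : (2 / q) ^ (4 * q * N) = Real.exp ((Real.log 2 + ℓ) * (4 * y)) := by
    rw [Real.rpow_def_of_pos (by positivity), show (2 : ℝ) / q = 2 * (1 / q) by ring,
      Real.log_mul two_ne_zero (by positivity), ← hℓ, hy]
    ring_nf
  have hlog := Real.log_two_gt_d9
  have h1 : N * Real.exp (2 * q * (ℓ + 1) * N) ≤ Real.exp ((Real.log 2 + ℓ) * (4 * y)) := by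
    calc _ ≤ Real.exp (y + ℓ) * Real.exp (2 * q * (ℓ + 1) * N) := by gcongr
      _ = Real.exp (y + ℓ + 2 * y * (ℓ + 1)) := by
        rw [← Real.exp_add, hy]
        ring_nf
      _ ≤ _ := by
        refine Real.exp_le_exp.2 ?_
        nlinarith [mul_le_mul_of_nonneg_left hqN (by linarith : 0 ≤ ℓ),
          mul_le_mul_of_nonneg_left hℓ2.le (by linarith : 0 ≤ y),
          mul_le_mul_of_nonneg_left hlog.le (by linarith : 0 ≤ y)]
  have h2 : 1 ≤ Real.exp ((Real.log 2 + ℓ) * (4 * y)) :=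
    Real.one_le_exp (by positivity)
  rw [hrhs]
  linarith

variable {p q ρ σ N : ℝ}

lemma mul_le_of_density (hρ : 2 ≤ ρ) (hσ : 1 ≤ σ)
    (hp : p ≤ q / (2 ^ 10 * ρ ^ 2 * σ ^ 2)) : 2 ^ 10 * ρ ^ 2 * σ ^ 2 * p ≤ q := by
  rw [le_div_iff₀ (by positivity)] at hp
  linarith

lemma mass_threshold_le {s : ℕ} (hs : 1 ≤ s) (hq0 : 0 < q) (hq : q < 1 / 8) :
    (q / 2) ^ (2 * s) / q ^ s ≤ 1 / 32 := by
  have h1 : (q / 2) ^ (2 * s) / q ^ s = (q / 4) ^ s := by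
    rw [pow_mul, ← div_pow]
    congr 1
    field_simp
    norm_num
  rw [h1]
  refine (pow_le_of_le_one (by positivity) (by linarith) (by omega)).trans ?_
  linarith

lemma glue_error_le {k R θ : ℝ} (hp0 : 0 < p) (hp1 : p ≤ 1 / 2 ^ 15) (hρ : 2 ≤ ρ) (hσ : 1 ≤ σ)
    (hρσ : ρ * σ ^ 2 * p ≤ 1) (hN : 0 < N) (hR : R = p * N / 2 ^ 6)
    (hθ : θ = 2 ^ 8 * ρ * σ / N) :
    16 * (p ^ 4 * k ^ 2 * R) * (4 / R * (1 + 1 / p) + 2 * (θ * σ) / p ^ 2) ≤ k ^ 2 := by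
  have h2 : 16 * (p ^ 4 * k ^ 2 * R) * (4 / R * (1 + 1 / p) + 2 * (θ * σ) / p ^ 2) =
      k ^ 2 * (64 * p ^ 4 + 64 * p ^ 3 + 128 * p ^ 2 * (ρ * σ ^ 2 * p)) := by
    rw [hθ, hR]
    field_simp
    ring
  rw [h2]
  refine mul_le_of_le_one_right (by positivity) ?_
  have h4 : p ^ 2 ≤ 1 / 2 ^ 15 := by nlinarith
  have h5 : p ^ 3 ≤ 1 / 2 ^ 15 := by
    have : p ^ 3 = p ^ 2 * p := by ring
    nlinarith
  have h6 : p ^ 4 ≤ 1 / 2 ^ 15 := by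
    have : p ^ 4 = p ^ 3 * p := by ring
    have : 0 ≤ p ^ 3 := by positivity
    nlinarith
  have h7 : p ^ 2 * (ρ * σ ^ 2 * p) ≤ 1 / 2 ^ 15 * 1 := by
    gcongr
  linarith

lemma cost_le (hq0 : 0 < q) (hq : q < 1 / 8) (hp0 : 0 < p) (hρ : 2 ≤ ρ)
    (hσ : 1 ≤ σ) (hp : 2 ^ 10 * ρ ^ 2 * σ ^ 2 * p ≤ q) (hp2 : p ≤ 1 / 2) :
    2 ^ 10 * ρ * σ ^ 2 * (Real.log (1 / q) + 1) * (-Real.log (1 - p)) +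
      q * (Real.log (1 / q) + 1) ≤ 2 * q * (Real.log (1 / q) + 1) := by
  have hℓ := two_lt_log_inv hq0 hq
  set ℓ := Real.log (1 / q) with hℓdef
  have h1 := neg_log_one_sub_le hp0.le hp2
  have h2 : 2 ^ 10 * ρ * σ ^ 2 * (2 * p) ≤ q := by
    have : 0 ≤ 2 ^ 10 * ρ * σ ^ 2 * p := by positivity
    nlinarith
  calc _ ≤ 2 ^ 10 * ρ * σ ^ 2 * (ℓ + 1) * (2 * p) + q * (ℓ + 1) := by gcongr
    _ = 2 ^ 10 * ρ * σ ^ 2 * (2 * p) * (ℓ + 1) + q * (ℓ + 1) := by ring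
    _ ≤ q * (ℓ + 1) + q * (ℓ + 1) := by gcongr
    _ = _ := by ring

lemma gain_gt {ℓ Δ x : ℝ} (hρ : 2 ≤ ρ) (hσ : 1 ≤ σ) (hℓ : 0 < ℓ + 1) (hpN : 0 < p * N)
    (hΔ : Δ = 2 ^ 8 * (ρ * σ ^ 2 + 1) / (p * N)) (hx : x ≤ 1 / 32) :
    p * N * (ℓ + 1) < 2 ^ 10 * ρ * σ ^ 2 * (ℓ + 1) * (1 / Δ - (1 / Δ) ^ 2 * Δ / 2) -
      2 ^ 10 * ρ * σ ^ 2 * (ℓ + 1) * (1 / Δ) * x := by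
  have hΔ0 : 0 < Δ := by rw [hΔ]; positivity
  set m := ρ * σ ^ 2 with hm
  have hm2 : 2 ≤ m := by nlinarith
  have h1 : (1 / Δ) ^ 2 * Δ = 1 / Δ := by field_simp
  have h2 : 8 / 3 * (p * N) ≤ 2 ^ 10 * m * (1 / Δ) := by
    rw [hΔ, one_div_div, mul_div_assoc', le_div_iff₀ (by positivity)]
    nlinarith
  have h3 : 0 < 2 ^ 10 * m * (1 / Δ) := by positivity
  rw [h1]
  calc p * N * (ℓ + 1) < 8 / 3 * (p * N) * (15 / 32) * (ℓ + 1) := by nlinarith [mul_pos hpN hℓ]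
    _ ≤ 2 ^ 10 * m * (1 / Δ) * (1 / 2 - x) * (ℓ + 1) := by
      gcongr
      linarith
    _ = _ := by rw [hm]; ring

end Numerics

section Large

variable {V U : Type*}

lemma pushDeg_eq_of_support {W : Type*} {G G' : Finset (Finset V)} (h : G' ⊆ G)
    {ν : Finset V → ℝ} (hν : IsMeasureOn G' ν) (φ : Finset V → Finset W) :
    pushDeg G ν φ = pushDeg G' ν φ := by
  funext L
  refine (Finset.sum_subset (Finset.filter_subset_filter _ h) fun E hE hE' => ?_).symm
  exact hν.2 E fun hEG' => hE' (Finset.mem_filter.2 ⟨hEG', (Finset.mem_filter.1 hE).2⟩)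

lemma exists_normalized_of_isJanson [Fintype U] {p R : ℝ} (hp : 0 < p) (hR : 0 ≤ R)
    {F : Finset (Finset U)} (hF : IsJanson p R F) :
    ∃ ν, IsMeasureOn F ν ∧ R * eMass F ν = R ∧ R * lamP p F ν ≤ 1 := by
  rcases hR.eq_or_lt with rfl | hR
  · exact ⟨fun _ => 0, ⟨fun _ => le_rfl, fun _ _ => rfl⟩, by simp, by simp⟩
  · obtain ⟨ν, hν, hJ⟩ := hF hR
    have hlam : 0 ≤ lamP p F ν := by
      rw [lamP_eq_degInner]
      exact degInner_self_nonneg hp.le _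
    have he : 0 < eMass F ν := by
      refine (Finset.sum_nonneg fun E _ => hν.1 E).lt_of_ne fun h => ?_
      rw [eMass, ← h] at hJ
      simp at hJ
      linarith
    set e := eMass F ν with hedef
    refine ⟨fun E => e⁻¹ * ν E, ⟨fun E => mul_nonneg (by positivity) (hν.1 E), fun E hE => ?_⟩,
      ?_, ?_⟩
    · simp only [hν.2 E hE, mul_zero]
    · have : eMass F (fun E => e⁻¹ * ν E) = 1 := by
        unfold eMass
        rw [← Finset.mul_sum]
        exact inv_mul_cancel₀ he.ne'
      rw [this, mul_one]
    · have h1 : dMass F (fun E => e⁻¹ * ν E) = fun L => e⁻¹ * dMass F ν L := by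
        funext L
        unfold dMass
        rw [Finset.mul_sum]
      rw [lamP_eq_degInner, h1, degInner_self_smul, ← lamP_eq_degInner]
      rw [lt_div_iff₀ hR] at hJ
      rw [inv_pow, inv_mul_eq_div, mul_div_assoc', div_le_one (by positivity)]
      linarith

lemma card_fiber_le_two [Fintype V] [DecidableEq U] {π : V → U}
    (hπ : ∀ L : Finset V, (L.card : ℝ) / 2 ≤ ((L.image π).card : ℝ)) (u : U) :
    ((Finset.univ.filter fun v => π v = u).card : ℝ) ≤ 2 := by
  have h1 := hπ (Finset.univ.filter fun v => π v = u)
  have h2 : ((Finset.univ.filter fun v => π v = u).image π).card ≤ 1 := by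
    refine (Finset.card_le_card (t := {u}) fun x hx => ?_).trans (Finset.card_singleton u).le
    obtain ⟨v, hv, rfl⟩ := Finset.mem_image.1 hx
    exact Finset.mem_singleton.2 (Finset.mem_filter.1 hv).2
  have h3 : (((Finset.univ.filter fun v => π v = u).image π).card : ℝ) ≤ 1 := by exact_mod_cast h2
  linarith

/-- If `π(H[Y])` is Janson for each large subset `Y` of `C`, then `H[C]` carries a spread
normalized measure of low energy on edges of small cross weight. -/
lemma exists_spread_measure_of_isJanson [Fintype V] [Fintype U] [DecidableEq U] {p R R' θ : ℝ}
    (hp : 0 < p) (hR : 0 < R) (hR'0 : 0 ≤ R') (hR' : R' ≤ R / 16) (hθ : 0 < θ) {s : ℕ}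
    {H : Finset (Finset V)} (hH : ∀ E ∈ H, E.card = s) (π : V → U)
    {a : Finset U → ℝ} (ha0 : ∀ L, 0 ≤ a L) (ha : R' * degInner p a a ≤ 1) {C : Finset V}
    (hC : ∀ Y ⊆ C, (C.card : ℝ) - s / θ ≤ Y.card → IsJanson p R (pushHG π (indHG H Y))) :
    ∃ ν : Finset V → ℝ,
      (∀ E, 0 ≤ ν E) ∧
      ∑ E ∈ (indHG H C).filter (fun E => crossWeight p R' a (fun E => E.image π) E ≤ 1 / 2),
        ν E = 1 ∧
      degInner p
        (pushDeg ((indHG H C).filter fun E => crossWeight p R' a (fun E => E.image π) E ≤ 1 / 2) ν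
          fun E => E.image π)
        (pushDeg ((indHG H C).filter fun E => crossWeight p R' a (fun E => E.image π) E ≤ 1 / 2) ν
          fun E => E.image π) ≤ 4 / R ∧
      ∑ v, vertexDeg ((indHG H C).filter fun E =>
        crossWeight p R' a (fun E => E.image π) E ≤ 1 / 2) ν v ^ 2 ≤ θ * s := by
  set φ : Finset V → Finset U := fun E => E.image π with hφ
  set G := (indHG H C).filter fun E => crossWeight p R' a φ E ≤ 1 / 2 with hG
  have hGC : ∀ E ∈ G, E ⊆ C ∧ E.card = s := by
    intro E hE
    obtain ⟨hEH, hEC⟩ := Finset.mem_filter.1 (Finset.mem_filter.1 hE).1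
    exact ⟨hEC, hH E hEH⟩
  obtain ⟨ν, hν, h1, h2, h3⟩ := exists_spread_measure (Λ := 4 / R) hp.le hθ hGC φ (by
    intro Y hY hcard
    obtain ⟨ν₀, hν₀, hJ⟩ := hC Y hY hcard hR
    obtain ⟨ν, hν, hν1, hνΛ⟩ := exists_normalized_lift (G := indHG H Y) hp hR hR'0 hR' φ
      (fun D hD => Finset.mem_image.1 hD) hν₀ hJ ha0 ha
    have heq : (indHG H Y).filter (fun E => crossWeight p R' a φ E ≤ 1 / 2) =
        G.filter fun E => E ⊆ Y := by
      ext E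
      simp only [hG, indHG, Finset.mem_filter]
      constructor
      · rintro ⟨⟨h1, h2⟩, h3⟩
        exact ⟨⟨⟨h1, h2.trans hY⟩, h3⟩, h2⟩
      · rintro ⟨⟨⟨h1, -⟩, h3⟩, h2⟩
        exact ⟨⟨h1, h2⟩, h3⟩
    rw [heq] at hν hν1 hνΛ
    refine ⟨ν, hν, ?_, ?_⟩
    · rw [← hν1]
      exact (Finset.sum_subset (Finset.filter_subset _ _) fun E _ hE => hν.2 E hE).symm
    · rw [pushDeg_eq_of_support (Finset.filter_subset _ _) hν]
      exact hνΛ)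
  exact ⟨ν, hν.1, h1, h2, h3⟩

end Large

section Container

variable {V U : Type*} [Fintype V] [Fintype U] [DecidableEq U]

lemma exists_containers_of_large {s r n : ℕ} (hs : 1 ≤ s) (hr : 2 ≤ r)
    (hn : Fintype.card V = n) {p q R R' η : ℝ} (hq0 : 0 < q) (hq : q < 1 / 8)
    (hp0 : 0 < p) (hp : 2 ^ 10 * (r : ℝ) ^ 2 * (s : ℝ) ^ 2 * p ≤ q) (hpn : 1 / 64 ≤ p * n)
    (hR : R = p * (n : ℝ) / 2 ^ 6) (hR'0 : 0 ≤ R') (hR' : R' ≤ R / 16)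
    (hη : η = p ^ 4 * (q / 2) ^ (4 * s))
    {F : Finset (Finset U)} (hF : IsJanson p R' F)
    {H : Finset (Finset V)} (hH : ∀ E ∈ H, E.card = s) {π : V → U}
    (hπ1 : ∀ L : Finset V, (L.card : ℝ) / 2 ≤ ((L.image π).card : ℝ))
    (hπ2 : ∀ E ∈ H, (E.image π).card = E.card) :
    ∃ X : Finset (Finset V),
      (X.card : ℝ) ≤ 4 * (2 / q) ^ (4 * q * (n : ℝ)) ∧
      (∀ I : Finset V, ¬ IsJanson p (R' + η * R) (pushvHG π (indHG H I) ∪ liftHG F) →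
        ∃ x ∈ X, I ⊆ x) ∧
      ∀ x ∈ X, ∃ Y ⊆ x, (x.card : ℝ) - (n : ℝ) / (2 ^ 8 * r) ≤ (Y.card : ℝ) ∧
        ¬ IsJanson p R (pushHG π (indHG H Y)) := by
  have hρ : (2 : ℝ) ≤ r := by exact_mod_cast hr
  have hσ : (1 : ℝ) ≤ s := by exact_mod_cast hs
  have hpn0 : 0 < p * n := by linarith
  have hN0 : (0 : ℝ) < n := pos_of_mul_pos_right hpn0 hp0.le
  have hR0 : 0 < R := by rw [hR]; positivity
  have hη0 : 0 < η := by rw [hη]; positivity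
  have hrs : 2 * 1 ≤ (r : ℝ) * (s : ℝ) ^ 2 := by
    have : (1 : ℝ) ≤ (s : ℝ) ^ 2 := one_le_pow₀ hσ
    gcongr
  have hprs : 2 ^ 11 * ((r : ℝ) * (s : ℝ) ^ 2 * p) ≤ q := by
    refine le_trans ?_ hp
    have : 0 ≤ (r : ℝ) * (s : ℝ) ^ 2 * p := by positivity
    nlinarith
  have hpq : 2 ^ 12 * p ≤ q := by nlinarith
  have hp1 : p ≤ 1 / 2 ^ 15 := by linarith
  set ℓ := Real.log (1 / q) with hℓ
  have hℓ2 : 2 < ℓ := two_lt_log_inv hq0 hq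
  obtain ⟨νF, hνF, heF, hΛF⟩ := exists_normalized_of_isJanson hp0 hR'0 hF
  set φ : Finset V → Finset U := fun E => E.image π with hφ
  set P : Finset V → Prop := fun C => ∃ Y ⊆ C, (C.card : ℝ) - (n : ℝ) / (2 ^ 8 * r) ≤ Y.card ∧
    ¬ IsJanson p R (pushHG π (indHG H Y)) with hP
  set bad : Finset V → Prop := fun I =>
    ¬ IsJanson p (R' + η * R) (pushvHG π (indHG H I) ∪ liftHG F) with hbad
  set Δ : ℝ := 2 ^ 8 * (r * (s : ℝ) ^ 2 + 1) / (p * n) with hΔ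
  have hΔ0 : 0 < Δ := by positivity
  set θ : ℝ := 2 ^ 8 * r * s / n with hθ
  have hθ0 : 0 < θ := by positivity
  have hsθ : (s : ℝ) / θ = n / (2 ^ 8 * r) := by
    rw [hθ]
    field_simp
  set κ : ℝ := (q / 2) ^ (2 * s) with hκ
  have hκ0 : 0 < κ := by positivity
  have hη2 : η = p ^ 4 * κ ^ 2 := by
    rw [hη, hκ, ← pow_mul]
    congr 2
    ring
  have hsmall : 16 * (η * R) * (4 / R * (1 + 1 / p) + 2 * (θ * s) / p ^ 2) ≤ κ ^ 2 := by
    rw [hη2]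
    exact glue_error_le hp0 hp1 hρ hσ (by linarith) hN0 hR hθ
  have hstep : ∀ L : Finset (Finset V), (∀ I ∈ L, bad I) → L.Nonempty → ∃ C, P C ∧
      L.card * Real.exp (-(2 * q * (ℓ + 1) * n)) ≤ (L.filter fun I => I ⊆ C).card := by
    intro L hL hLne
    rw [← hn]
    refine exists_set_capturing (c := 2 ^ 10 * r * (s : ℝ) ^ 2 * (ℓ + 1)) (τ := 1 / Δ)
      (Δ := Δ) (κ := κ) (s := s) hp0 (by linarith) (by linarith) (by linarith) (by positivity)
      (by positivity) (by positivity) (cost_le hq0 hq hp0 hρ hσ hp (by linarith)) ?_ L hLne P ?_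
    · rw [hn]
      exact gain_gt hρ hσ (by linarith) hpn0 hΔ (mass_threshold_le hs hq0 hq)
    · intro C hC
      have hC' : ∀ Y ⊆ C, (C.card : ℝ) - s / θ ≤ Y.card → IsJanson p R (pushHG π (indHG H Y)) := by
        intro Y hY hcard
        by_contra hnot
        exact hC ⟨Y, hY, hsθ ▸ hcard, hnot⟩
      obtain ⟨ν, hν, hν1, hνΛ, hνQ⟩ := exists_spread_measure_of_isJanson hp0 hR0 hR'0 hR' hθ0 hH π
        (a := dMass F νF) (fun L => Finset.sum_nonneg fun E _ => hνF.1 E)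
        (by rwa [← lamP_eq_degInner]) hC'
      set G := (indHG H C).filter fun E => crossWeight p R' (dMass F νF) φ E ≤ 1 / 2 with hG
      have hGH : G ⊆ H := (Finset.filter_subset _ _).trans (Finset.filter_subset _ _)
      refine ⟨G, ν, hν, fun E hE => ⟨?_, hH E (hGH hE)⟩, hν1, ?_, fun I hI => ?_⟩
      · exact (Finset.mem_filter.1 (Finset.mem_filter.1 hE).1).2
      · refine (sum_overlap_le hp0 (φ := φ) hν (fun E hE L hLE => ?_)
          (fun A B hAB => Finset.image_subset_image hAB)).trans ?_
        · refine Finset.card_image_of_injOn (Set.InjOn.mono (Finset.coe_subset.2 hLE) ?_)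
          exact Finset.card_image_iff.1 (hπ2 E (hGH hE))
        · calc _ ≤ θ * s / p + 4 / R := by gcongr
            _ = Δ := by
              rw [hθ, hR, hΔ]
              field_simp
              ring
      · exact sum_filter_le_of_not_isJanson hp0 hR'0 (by positivity) (card_fiber_le_two hπ1) hνF
          heF hΛF hGH (fun E hE => (Finset.mem_filter.1 hE).2) hν hνΛ hνQ hκ0 hsmall (hL I hI)
  set L : Finset (Finset V) := Finset.univ.filter bad with hL
  obtain ⟨X, hX1, hX2, hX3, hX4⟩ := exists_cover_card_le
    (β := Real.exp (-(2 * q * (ℓ + 1) * n))) (Real.exp_pos _) P L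
    fun M hM => hstep M fun I hI => (Finset.mem_filter.1 (hM hI)).2
  refine ⟨X, ?_, fun I hI => hX2 I (Finset.mem_filter.2 ⟨Finset.mem_univ I, hI⟩), hX1⟩
  have hqn : 1 ≤ q * n := by nlinarith
  rcases L.eq_empty_or_nonempty with hLe | hLne
  · rw [hX4 hLe]
    simp only [Finset.card_empty, Nat.cast_zero]
    positivity
  · refine (hX3 hLne).trans (le_trans ?_ (one_add_mul_exp_le hq0 hq hqn))
    rw [Real.exp_neg, div_inv_eq_mul]
    have hlog : Real.log L.card ≤ n := by
      have h1 : (L.card : ℝ) ≤ 2 ^ n := by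
        have := Finset.card_le_univ L
        rw [Fintype.card_finset, hn] at this
        exact_mod_cast this
      have h2 := Real.log_le_log (Nat.cast_pos.2 hLne.card_pos) h1
      rw [Real.log_pow] at h2
      have := Real.log_two_lt_d9
      nlinarith
    gcongr

end Container

section Small

variable {V U : Type*} [Fintype U]

/-- Hypergraphs all of whose edges have two vertices in a small set are not Janson. -/
lemma not_isJanson_of_card_le {p R : ℝ} (hp : 0 < p) (hR : 0 < R) {G : Finset (Finset U)}
    (S : Finset U) (hG : ∀ D ∈ G, D ⊆ S ∧ 2 ≤ D.card) (hS : (p * S.card) ^ 2 ≤ R) :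
    ¬ IsJanson p R G := by
  intro hJ
  obtain ⟨ν, hν, hlt⟩ := hJ hR
  set pairs := S.powersetCard 2 with hpairs
  have hcard : (pairs.card : ℝ) ≤ (S.card : ℝ) ^ 2 := by
    rw [hpairs, Finset.card_powersetCard]
    exact_mod_cast Nat.choose_le_pow S.card 2
  have h1 : eMass G ν ≤ ∑ L ∈ pairs, dMass G ν L := by
    unfold eMass dMass
    simp only [Finset.sum_filter]
    rw [Finset.sum_comm]
    refine Finset.sum_le_sum fun D hD => ?_
    obtain ⟨L, hLD, hL⟩ := Finset.exists_subset_card_eq (hG D hD).2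
    have hnn : ∀ L ∈ pairs, 0 ≤ if L ⊆ D then ν D else 0 := fun L _ => by
      split_ifs
      · exact hν.1 D
      · rfl
    refine le_trans ?_ (Finset.single_le_sum hnn
      (Finset.mem_powersetCard.2 ⟨hLD.trans (hG D hD).1, hL⟩))
    rw [if_pos hLD]
  have h2 : ∑ L ∈ pairs, dMass G ν L ^ 2 / p ^ 2 ≤ lamP p G ν := by
    unfold lamP
    calc _ = ∑ L ∈ pairs, dMass G ν L ^ 2 / p ^ L.card :=
          Finset.sum_congr rfl fun L hL => by rw [(Finset.mem_powersetCard.1 hL).2]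
      _ ≤ _ := Finset.sum_le_sum_of_subset_of_nonneg
          (fun L hL => Finset.mem_filter.2
            ⟨Finset.mem_univ L, (Finset.mem_powersetCard.1 hL).2.ge⟩)
          fun L _ _ => by positivity
  have h0 : 0 ≤ eMass G ν := Finset.sum_nonneg fun E _ => hν.1 E
  have h3 : eMass G ν ^ 2 ≤ (S.card : ℝ) ^ 2 * ∑ L ∈ pairs, dMass G ν L ^ 2 :=
    calc _ ≤ (∑ L ∈ pairs, dMass G ν L) ^ 2 := pow_le_pow_left₀ h0 h1 2
      _ ≤ pairs.card * ∑ L ∈ pairs, dMass G ν L ^ 2 := sq_sum_le_card_mul_sum_sq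
      _ ≤ _ := by gcongr
  rw [lt_div_iff₀ hR] at hlt
  rw [← Finset.sum_div] at h2
  set t := ∑ L ∈ pairs, dMass G ν L ^ 2 with ht
  have ht0 : 0 ≤ t := Finset.sum_nonneg fun _ _ => sq_nonneg _
  have h4 : (S.card : ℝ) ^ 2 * t ≤ lamP p G ν * R := by
    calc (S.card : ℝ) ^ 2 * t = t / p ^ 2 * (p * S.card) ^ 2 := by field_simp
      _ ≤ lamP p G ν * R := by
        refine mul_le_mul h2 hS (sq_nonneg _) ?_
        exact le_trans (by positivity) h2
  linarith

lemma not_isJanson_empty {p R : ℝ} (hR : 0 < R) : ¬ IsJanson p R (∅ : Finset (Finset U)) := by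
  intro hJ
  obtain ⟨ν, -, hlt⟩ := hJ hR
  simp [lamP, eMass, dMass] at hlt

/-- A singleton edge of `H` inside `I` makes the glued hypergraph Janson. -/
lemma isJanson_union_of_singleton [DecidableEq U] {p R' δ : ℝ} (hp : 0 < p) (hR' : 0 ≤ R') (hδ : 0 < δ)
    (hδp : 32 * δ ≤ p ^ 2) {π : V → U} {F : Finset (Finset U)} (hF : IsJanson p R' F)
    {G : Finset (Finset V)} {v : V} (hv : {v} ∈ G) :
    IsJanson p (R' + δ) (pushvHG π G ∪ liftHG F) := by
  obtain ⟨νF, hνF, heF, hΛF⟩ := exists_normalized_of_isJanson hp hR' hF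
  set ν : Finset V → ℝ := fun E => if E = {v} then 1 else 0 with hν
  have hsum : ∀ Q : Finset V → Prop, ∑ E ∈ G.filter Q, ν E = if Q {v} then 1 else 0 := by
    intro Q
    simp [hν, Finset.sum_ite_eq', hv]
  have hdeg : ∀ L : Finset U, pushDeg G ν (fun E => E.image π) L = if L ⊆ {π v} then 1 else 0 := by
    intro L
    have := hsum fun E => L ⊆ E.image π
    rw [Finset.image_singleton] at this
    unfold pushDeg
    convert this
  have hdeg2 : ∀ L ∈ (Finset.univ : Finset (Finset U)).filter (fun L => 2 ≤ L.card),
      pushDeg G ν (fun E => E.image π) L = 0 := by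
    intro L hL
    rw [hdeg, if_neg]
    intro h
    have h1 := Finset.card_le_card h
    have h2 := (Finset.mem_filter.1 hL).2
    rw [Finset.card_singleton] at h1
    omega
  have hinner : ∀ a : Finset U → ℝ, degInner p a (pushDeg G ν fun E => E.image π) = 0 := by
    intro a
    exact Finset.sum_eq_zero fun L hL => by rw [hdeg2 L hL, mul_zero, zero_div]
  refine isJanson_union hp hR' hδ π hνF heF hΛF (ν := ν) (fun E => ?_) ?_ ?_ ?_
  · simp only [hν]
    split_ifs <;> norm_num
  · have := hsum fun _ => True
    simpa using this
  · rw [hinner, mul_zero]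
    norm_num
  · rw [hinner]
    have : ∑ u, pushDeg G ν (fun E => E.image π) {u} ^ 2 = 1 := by
      simp [hdeg]
    rw [this, zero_mul, zero_add, mul_one_div, div_le_one (by positivity)]
    linarith

lemma exists_containers_of_small [Fintype V] [DecidableEq U] {s n : ℕ} (hs : 1 ≤ s) (hn0 : 1 ≤ n)
    (hn : Fintype.card V = n) {p q R R' η : ℝ} (hq0 : 0 < q) (hq : q < 1 / 8)
    (hp0 : 0 < p) (hp1 : p ≤ 1) (hpn : p * n ≤ 1 / 64)
    (hR : R = p * (n : ℝ) / 2 ^ 6) (hR'0 : 0 ≤ R')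
    (hη : η = p ^ 4 * (q / 2) ^ (4 * s))
    {F : Finset (Finset U)} (hF : IsJanson p R' F)
    {H : Finset (Finset V)} (hH : ∀ E ∈ H, E.card = s) {π : V → U}
    (hπ2 : ∀ E ∈ H, (E.image π).card = E.card) :
    ∃ x : Finset V,
      (∀ I : Finset V, ¬ IsJanson p (R' + η * R) (pushvHG π (indHG H I) ∪ liftHG F) → I ⊆ x) ∧
      ¬ IsJanson p R (pushHG π (indHG H x)) := by
  have hN0 : (1 : ℝ) ≤ n := by exact_mod_cast hn0
  have hR0 : 0 < R := by rw [hR]; positivity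
  rcases hs.eq_or_lt with hs1 | hs2
  · refine ⟨Finset.univ.filter fun v => {v} ∉ H, fun I hI v hv => ?_, ?_⟩
    · refine Finset.mem_filter.2 ⟨Finset.mem_univ v, fun hvH => hI ?_⟩
      have hqk : (q / 2) ^ (4 * s) ≤ 1 := pow_le_one₀ (by positivity) (by linarith)
      refine isJanson_union_of_singleton hp0 hR'0 (by rw [hη]; positivity) ?_ hF
        (Finset.mem_filter.2 ⟨hvH, Finset.singleton_subset_iff.2 hv⟩)
      calc 32 * (η * R) = p ^ 2 * (p ^ 2 * (q / 2) ^ (4 * s) * (p * n / 2)) := by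
            rw [hη, hR]; ring
        _ ≤ p ^ 2 * (1 * 1 * 1) := by
            have : p ^ 2 ≤ 1 := pow_le_one₀ hp0.le hp1
            gcongr
            linarith
        _ = p ^ 2 := by ring
    · have : indHG H (Finset.univ.filter fun v => {v} ∉ H) = ∅ := by
        refine Finset.filter_eq_empty_iff.2 fun E hE hsub => ?_
        obtain ⟨v, rfl⟩ := Finset.card_eq_one.1 ((hH E hE).trans hs1.symm)
        exact (Finset.mem_filter.1 (hsub (Finset.mem_singleton_self v))).2 hE
      rw [this]
      exact not_isJanson_empty hR0
  · refine ⟨Finset.univ, fun I _ => Finset.subset_univ I, ?_⟩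
    refine not_isJanson_of_card_le hp0 hR0 (Finset.univ.image π) (fun D hD => ?_) ?_
    · obtain ⟨E, hE, rfl⟩ := Finset.mem_image.1 hD
      have hEH := (Finset.mem_filter.1 hE).1
      refine ⟨Finset.image_subset_image (Finset.subset_univ E), ?_⟩
      rw [hπ2 E hEH, hH E hEH]
      exact hs2
    · have hcard : ((Finset.univ.image π).card : ℝ) ≤ n := by
        rw [← hn]
        exact_mod_cast Finset.card_image_le
      calc (p * ((Finset.univ.image π).card : ℝ)) ^ 2 ≤ (p * n) ^ 2 := by gcongr
        _ = p * n * (p * n) := sq _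
        _ ≤ p * n * (1 / 64) := by gcongr
        _ = R := by rw [hR]; ring

end Small

/-- **Theorem 5.2 (container theorem for non-Janson sets).**
Let `n ≥ s`, `r ≥ 2`, `0 < q < 1/8`, `0 < p ≤ q/(2^{10}r²s²)`, `R = 2^{-6}pn`,
`0 ≤ R' ≤ R/16`, `η = p⁴(q/2)^{4s}`.  Let `𝓕` be an `(s+1)`-uniform `(p,R')`-Janson
hypergraph on `U`, `ℋ` an `s`-uniform hypergraph on an `n`-element set `V`, `π : V → U`
with `|π(L)| ≥ |L|/2` for all `L ⊆ V` and `|π(E)| = |E|` for all `E ∈ ℋ`, and `v ∉ U` a new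
vertex.  Then there is a family `𝒳` of at most `4(2/q)^{4qn}` subsets of `V` such that:
(1) every `I ⊆ V` for which `π_v(ℋ[I]) ∪ 𝓕` is not `(p, R'+ηR)`-Janson satisfies `I ⊆ X`
for some `X ∈ 𝒳`; and (2) every `X ∈ 𝒳` with `|X| ≥ n/(8r)` admits `Y ⊆ X` with
`|Y| ≥ |X| - 2^{-8}r^{-1}n` such that `π(ℋ[Y])` is not `(p,R)`-Janson. -/
theorem containers_for_non_janson
    {V U : Type*} [Fintype V] [Fintype U] [DecidableEq U]
    (s r n : ℕ) (hns : s ≤ n) (hr : 2 ≤ r) (hn : Fintype.card V = n)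
    (p q R R' η : ℝ)
    (hq0 : 0 < q) (hq : q < 1 / 8)
    (hp0 : 0 < p) (hp : p ≤ q / (2 ^ 10 * (r : ℝ) ^ 2 * (s : ℝ) ^ 2))
    (hR : R = p * (n : ℝ) / 2 ^ 6) (hR'0 : 0 ≤ R') (hR' : R' ≤ R / 16)
    (hη : η = p ^ 4 * (q / 2) ^ (4 * s))
    (F : Finset (Finset U)) (hFunif : ∀ E ∈ F, E.card = s + 1)
    (hFJanson : IsJanson p R' F)
    (H : Finset (Finset V)) (hHunif : ∀ E ∈ H, E.card = s)
    (π : V → U)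
    (hπ1 : ∀ L : Finset V, (L.card : ℝ) / 2 ≤ ((L.image π).card : ℝ))
    (hπ2 : ∀ E ∈ H, (E.image π).card = E.card) :
    ∃ X : Finset (Finset V),
      (X.card : ℝ) ≤ 4 * (2 / q) ^ (4 * q * (n : ℝ)) ∧
      (∀ I : Finset V,
        ¬ IsJanson p (R' + η * R) (pushvHG π (indHG H I) ∪ liftHG F) →
          ∃ x ∈ X, I ⊆ x) ∧
      (∀ x ∈ X, (n : ℝ) / (8 * r) ≤ (x.card : ℝ) →
        ∃ Y ⊆ x, (x.card : ℝ) - (n : ℝ) / (2 ^ 8 * r) ≤ (Y.card : ℝ) ∧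
          ¬ IsJanson p R (pushHG π (indHG H Y))) := by
  have hρ : (2 : ℝ) ≤ r := by exact_mod_cast hr
  have hs : 1 ≤ s := by
    by_contra h
    have : s = 0 := by omega
    simp only [this, Nat.cast_zero, ne_eq, OfNat.ofNat_ne_zero, not_false_eq_true, zero_pow,
      mul_zero, div_zero] at hp
    linarith
  have hσ : (1 : ℝ) ≤ s := by exact_mod_cast hs
  have hp' := mul_le_of_density hρ hσ hp
  rcases le_total (1 / 64) (p * n) with hpn | hpn
  · obtain ⟨X, h1, h2, h3⟩ := exists_containers_of_large hs hr hn hq0 hq hp0 hp' hpn hR hR'0 hR' hη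
      hFJanson hHunif hπ1 hπ2
    exact ⟨X, h1, h2, fun x hx _ => h3 x hx⟩
  · have hp1 : p ≤ 1 := by
      have : (1 : ℝ) ≤ 2 ^ 10 * (r : ℝ) ^ 2 * (s : ℝ) ^ 2 := by
        have h1 : (1 : ℝ) ≤ (r : ℝ) ^ 2 := one_le_pow₀ (by linarith)
        have h2 : (1 : ℝ) ≤ (s : ℝ) ^ 2 := one_le_pow₀ hσ
        nlinarith
      nlinarith
    obtain ⟨x, h1, h2⟩ := exists_containers_of_small hs (hs.trans hns) hn hq0 hq hp0 hp1 hpn hR hR'0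
      hη hFJanson hHunif hπ2
    refine ⟨{x}, ?_, fun I hI => ⟨x, Finset.mem_singleton_self x, h1 I hI⟩, fun y hy _ => ?_⟩
    · have : 1 ≤ (2 / q) ^ (4 * q * (n : ℝ)) := by
        refine Real.one_le_rpow ?_ (by positivity)
        rw [le_div_iff₀ hq0]
        linarith
      rw [Finset.card_singleton, Nat.cast_one]
      linarith
    · rw [Finset.mem_singleton.1 hy]
      refine ⟨x, subset_rfl, ?_, h2⟩
      have : 0 ≤ (n : ℝ) / (2 ^ 8 * r) := by positivity
      linarith

end
end

section
/- Let V be a finite set and let U ⊆ S ⊆ V with 2^{10} ≤ |U| ≤ |S|/4. For a graph G on V, let S′(G) = {v ∈ S ∖ U : d_G(v,U) > |U|/4}. Then the number of graphs G on V with |S′(G)| ≤ |S|/4 is at most exp(−2^{−6}|U||S|)·2^{|V|(|V|−1)/2}; equivalently, for the uniformly random graph G ∼ 𝔾(|V|,1/2), ℙ(|S′(G)| ≤ |S|/4) ≤ exp(−2^{−6}|U||S|). -/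
open scoped Classical

/-- Chernoff bound for the lower tail: few subsets of `U` have size at most `|U|/4`. -/
lemma card_powerset_filter_card_le_quarter {V : Type*} (U : Finset V) :
    ((U.powerset.filter fun A => (A.card : ℝ) ≤ (U.card : ℝ) / 4).card : ℝ)
      ≤ Real.exp (-(U.card : ℝ) / 16) * 2 ^ U.card := by
  set L := U.powerset.filter fun A => (A.card : ℝ) ≤ (U.card : ℝ) / 4
  have hmarkov : (L.card : ℝ) * Real.exp (-(U.card : ℝ) / 4) ≤ (Real.exp (-1) + 1) ^ U.card := by
    calc (L.card : ℝ) * Real.exp (-(U.card : ℝ) / 4)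
        = ∑ _A ∈ L, Real.exp (-(U.card : ℝ) / 4) := by rw [Finset.sum_const, nsmul_eq_mul]
      _ ≤ ∑ A ∈ L, Real.exp (-1) ^ A.card := by
          refine Finset.sum_le_sum fun A hA => ?_
          have hA' := (Finset.mem_filter.1 hA).2
          rw [← Real.exp_nat_mul]
          exact Real.exp_le_exp.2 (by linarith)
      _ ≤ ∑ A ∈ U.powerset, Real.exp (-1) ^ A.card :=
          Finset.sum_le_sum_of_subset_of_nonneg (Finset.filter_subset _ _)
            fun _ _ _ => by positivity
      _ = (Real.exp (-1) + 1) ^ U.card := by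
          simpa using Finset.sum_pow_mul_eq_add_pow (Real.exp (-1)) 1 U
  have hbase : Real.exp (-1) + 1 ≤ 2 * Real.exp (-(5 / 16)) := by
    have h1 := Real.exp_neg_one_lt_d9
    have h2 := Real.add_one_le_exp (-(5 / 16) : ℝ)
    linarith
  have hpow : (Real.exp (-1) + 1) ^ U.card
      ≤ (Real.exp (-(U.card : ℝ) / 16) * 2 ^ U.card) * Real.exp (-(U.card : ℝ) / 4) := by
    calc (Real.exp (-1) + 1) ^ U.card ≤ (2 * Real.exp (-(5 / 16))) ^ U.card :=
          pow_le_pow_left₀ (by positivity) hbase _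
      _ = (Real.exp (-(U.card : ℝ) / 16) * 2 ^ U.card) * Real.exp (-(U.card : ℝ) / 4) := by
          rw [mul_pow, ← Real.exp_nat_mul, mul_right_comm, ← Real.exp_add, mul_comm]
          congr 2
          ring
  exact le_of_mul_le_mul_right (hmarkov.trans hpow) (Real.exp_pos _)

/-- Graphs whose neighbourhoods in `U` of the vertices of a disjoint set `W` are prescribed to lie
in given families are counted by the sizes of these families and the remaining pairs. -/
lemma card_graphs_filter_neighbors_mem_le {V : Type*} [Fintype V] [DecidableEq V]
    {U W : Finset V} (hWU : Disjoint W U) (F : W → Finset (Finset V)) :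
    (Finset.univ.filter fun G : SimpleGraph V =>
        ∀ w : W, (U.filter fun u => G.Adj w u) ∈ F w).card * 2 ^ (W.card * U.card)
      ≤ (∏ w, (F w).card) * 2 ^ (Fintype.card V * (Fintype.card V - 1) / 2) := by
  set pairs : Finset (Sym2 V) := Finset.univ.filter fun e => ¬ e.IsDiag with hpairs
  set cross : Finset (Sym2 V) := (W ×ˢ U).image fun p => s(p.1, p.2) with hcross
  have hne : ∀ w ∈ W, ∀ u ∈ U, w ≠ u := fun w hw u hu h =>
    Finset.disjoint_left.1 hWU hw (h ▸ hu)
  have hcross_sub : cross ⊆ pairs := by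
    intro e he
    obtain ⟨⟨w, u⟩, hp, rfl⟩ := Finset.mem_image.1 he
    rw [Finset.mem_product] at hp
    simpa [hpairs] using hne w hp.1 u hp.2
  have hcross_card : cross.card = W.card * U.card := by
    rw [hcross, Finset.card_image_of_injOn, Finset.card_product]
    rintro ⟨w, u⟩ h ⟨w', u'⟩ h' heq
    simp only [Finset.coe_product, Set.mem_prod, Finset.mem_coe] at h h'
    rcases Sym2.eq_iff.1 heq with ⟨h1, h2⟩ | ⟨h1, -⟩
    · exact Prod.ext h1 h2
    · exact absurd h1 (hne w h.1 u' h'.2)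
  have hpairs_card : pairs.card = Fintype.card V * (Fintype.card V - 1) / 2 := by
    rw [hpairs, ← Fintype.card_subtype, Sym2.card_subtype_not_diag, Nat.choose_two_right]
  have hrest : (pairs \ cross).card + W.card * U.card
      = Fintype.card V * (Fintype.card V - 1) / 2 := by
    rw [← hpairs_card, ← hcross_card, Finset.card_sdiff_add_card_eq_card hcross_sub]
  have hinj : (Finset.univ.filter fun G : SimpleGraph V =>
      ∀ w : W, (U.filter fun u => G.Adj w u) ∈ F w).card
      ≤ (Fintype.piFinset F ×ˢ (pairs \ cross).powerset).card := by
    refine Finset.card_le_card_of_injOn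
      (fun G => (fun w : W => U.filter fun u => G.Adj w u,
        (pairs \ cross).filter fun e => e ∈ G.edgeSet)) ?_ ?_
    · intro G hG
      simp only [Finset.coe_filter, Finset.mem_univ, true_and, Set.mem_ofPred_eq] at hG
      simp only [Finset.mem_coe, Finset.mem_product, Fintype.mem_piFinset, Finset.mem_powerset]
      exact ⟨hG, Finset.filter_subset _ _⟩
    · intro G _ H _ hGH
      obtain ⟨h1, h2⟩ := Prod.ext_iff.1 hGH
      have hadj : ∀ w ∈ W, ∀ u ∈ U, (G.Adj w u ↔ H.Adj w u) := by
        intro w hw u hu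
        have h := Finset.ext_iff.1 (congrFun h1 ⟨w, hw⟩) u
        simpa [hu] using h
      ext a b
      by_cases hab : a = b
      · simp [hab]
      by_cases hc : s(a, b) ∈ cross
      · obtain ⟨⟨w, u⟩, hp, heq⟩ := Finset.mem_image.1 hc
        rw [Finset.mem_product] at hp
        have h := hadj w hp.1 u hp.2
        rcases Sym2.eq_iff.1 heq with ⟨rfl, rfl⟩ | ⟨rfl, rfl⟩
        · exact h
        · rw [G.adj_comm, H.adj_comm]
          exact h
      · have hr : s(a, b) ∈ pairs \ cross :=
          Finset.mem_sdiff.2 ⟨by simpa [hpairs] using hab, hc⟩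
        have h := Finset.ext_iff.1 h2 s(a, b)
        simpa only [Finset.mem_filter, hr, true_and, SimpleGraph.mem_edgeSet] using h
  rw [Finset.card_product, Fintype.card_piFinset, Finset.card_powerset] at hinj
  calc _ ≤ ((∏ w, (F w).card) * 2 ^ (pairs \ cross).card) * 2 ^ (W.card * U.card) :=
        Nat.mul_le_mul_right _ hinj
    _ = _ := by rw [mul_assoc, ← pow_add, hrest]

/-- The number of graphs in which all vertices of `T ⊆ W` have at most `|U|/4` neighbours
in `U`. -/
lemma card_graphs_filter_low_degree_le {V : Type*} [Fintype V] [DecidableEq V]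
    {U T : Finset V} (hTU : Disjoint T U) :
    ((Finset.univ.filter fun G : SimpleGraph V =>
        ∀ v ∈ T, ((U.filter fun u => G.Adj v u).card : ℝ) ≤ (U.card : ℝ) / 4).card : ℝ)
      ≤ Real.exp (-(U.card : ℝ) / 16) ^ T.card *
          2 ^ (Fintype.card V * (Fintype.card V - 1) / 2) := by
  set L := U.powerset.filter fun A => (A.card : ℝ) ≤ (U.card : ℝ) / 4 with hL
  have hcount := card_graphs_filter_neighbors_mem_le hTU fun _ => L
  have hset : (Finset.univ.filter fun G : SimpleGraph V =>
      ∀ w : T, (U.filter fun u => G.Adj w u) ∈ L) = Finset.univ.filter fun G : SimpleGraph V =>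
        ∀ v ∈ T, ((U.filter fun u => G.Adj v u).card : ℝ) ≤ (U.card : ℝ) / 4 := by
    ext G
    simp [hL]
  rw [hset, Finset.prod_const, Finset.card_univ, Fintype.card_coe] at hcount
  have hcountR := (Nat.cast_le (α := ℝ)).2 hcount
  push_cast at hcountR
  have hLpow := pow_le_pow_left₀ (Nat.cast_nonneg _) (card_powerset_filter_card_le_quarter U) T.card
  rw [mul_pow, ← pow_mul, mul_comm U.card] at hLpow
  refine le_of_mul_le_mul_right (hcountR.trans ?_)
    (by positivity : (0 : ℝ) < 2 ^ (T.card * U.card))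
  rw [mul_right_comm]
  gcongr

/-- **Observation 6.7 (counting form).**  Let `U ⊆ S ⊆ V` with `2^{10} ≤ |U| ≤ |S|/4`, and
for a graph `G` on `V` let `S'(G) = {v ∈ S ∖ U : d_G(v,U) > |U|/4}`.  Then the number of
graphs `G` on `V` with `|S'(G)| ≤ |S|/4` is at most
`exp(-2^{-6}|U||S|)·2^{|V|(|V|-1)/2}`. -/
theorem chernoff_degree_count {V : Type*} [Fintype V] [DecidableEq V]
    (U S : Finset V) (hUS : U ⊆ S)
    (hU : 2 ^ 10 ≤ U.card) (hUS4 : (U.card : ℝ) ≤ (S.card : ℝ) / 4) :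
    ((Finset.univ.filter fun G : SimpleGraph V =>
        ((((S \ U).filter fun v =>
            (U.card : ℝ) / 4 < ((U.filter fun u => G.Adj v u).card : ℝ)).card : ℝ)
          ≤ (S.card : ℝ) / 4)).card : ℝ)
      ≤ Real.exp (-(U.card : ℝ) * (S.card : ℝ) / 2 ^ 6) *
          2 ^ (Fintype.card V * (Fintype.card V - 1) / 2) := by
  set W := S \ U
  set N := Fintype.card V * (Fintype.card V - 1) / 2
  set low : SimpleGraph V → Finset V → Prop := fun G T =>
    ∀ v ∈ T, ((U.filter fun u => G.Adj v u).card : ℝ) ≤ (U.card : ℝ) / 4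
  set large : Finset (Finset V) := W.powerset.filter fun T => (S.card : ℝ) / 2 ≤ T.card
  have hWcard : (W.card : ℝ) + U.card = S.card := by
    exact_mod_cast Finset.card_sdiff_add_card_eq_card hUS
  have hUR : (1024 : ℝ) ≤ U.card := by
    have h : 1024 ≤ U.card := by simpa using hU
    exact_mod_cast h
  have hcover : (Finset.univ.filter fun G : SimpleGraph V =>
      (((W.filter fun v =>
        (U.card : ℝ) / 4 < ((U.filter fun u => G.Adj v u).card : ℝ)).card : ℝ)
          ≤ (S.card : ℝ) / 4)) ⊆
      large.biUnion fun T => Finset.univ.filter fun G : SimpleGraph V => low G T := by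
    intro G hG
    have hG' := (Finset.mem_filter.1 hG).2
    have hsplit := Finset.card_filter_add_card_filter_not (s := W) fun v =>
      (U.card : ℝ) / 4 < ((U.filter fun u => G.Adj v u).card : ℝ)
    have hsplitR := congrArg (Nat.cast (R := ℝ)) hsplit
    push_cast at hsplitR
    refine Finset.mem_biUnion.2 ⟨W.filter fun v =>
      ¬ (U.card : ℝ) / 4 < ((U.filter fun u => G.Adj v u).card : ℝ), ?_, ?_⟩
    · refine Finset.mem_filter.2 ⟨Finset.mem_powerset.2 (Finset.filter_subset _ _), ?_⟩
      linarith
    · exact Finset.mem_filter.2 ⟨Finset.mem_univ _, fun v hv =>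
        not_lt.1 (Finset.mem_filter.1 hv).2⟩
  have hterm : ∀ T ∈ large, ((Finset.univ.filter fun G : SimpleGraph V => low G T).card : ℝ)
      ≤ Real.exp (-(U.card : ℝ) * S.card / 32) * 2 ^ N := by
    intro T hT
    obtain ⟨hTW, hTcard⟩ := Finset.mem_filter.1 hT
    have hTU : Disjoint T U :=
      Finset.disjoint_of_subset_left (Finset.mem_powerset.1 hTW) Finset.sdiff_disjoint
    refine (card_graphs_filter_low_degree_le hTU).trans ?_
    rw [← Real.exp_nat_mul]
    gcongr
    nlinarith
  have hlarge_card : (large.card : ℝ) ≤ Real.exp S.card := by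
    have h1 : large.card ≤ 2 ^ S.card :=
      calc large.card ≤ W.powerset.card := Finset.card_filter_le _ _
        _ = 2 ^ W.card := Finset.card_powerset _
        _ ≤ 2 ^ S.card :=
          Nat.pow_le_pow_right two_pos (Finset.card_le_card Finset.sdiff_subset)
    calc (large.card : ℝ) ≤ 2 ^ S.card := by exact_mod_cast h1
      _ ≤ Real.exp 1 ^ S.card :=
        pow_le_pow_left₀ zero_le_two (by linarith [Real.exp_one_gt_d9]) _
      _ = Real.exp S.card := by rw [← Real.exp_nat_mul, mul_one]
  calc _ ≤ ((large.biUnion fun T =>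
        Finset.univ.filter fun G : SimpleGraph V => low G T).card : ℝ) :=
        Nat.cast_le.2 (Finset.card_le_card hcover)
    _ ≤ ∑ T ∈ large, ((Finset.univ.filter fun G : SimpleGraph V => low G T).card : ℝ) := by
        exact_mod_cast Finset.card_biUnion_le
    _ ≤ large.card * (Real.exp (-(U.card : ℝ) * S.card / 32) * 2 ^ N) := by
        simpa using Finset.sum_le_card_nsmul _ _ _ hterm
    _ ≤ Real.exp S.card * (Real.exp (-(U.card : ℝ) * S.card / 32) * 2 ^ N) := by gcongr
    _ ≤ _ := by
        rw [← mul_assoc, ← Real.exp_add]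
        gcongr
        nlinarith [mul_le_mul_of_nonneg_right hUR (Nat.cast_nonneg (α := ℝ) S.card),
          Nat.cast_nonneg (α := ℝ) S.card]
end
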